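/- arXiv:math/0110282 — 2 statements merged into one kernel-verified Lean document; each statement's English description precedes it below -/
import Mathlib

section
/- There exists a natural number M such that for every natural number n > M for which 4n^2 + 1 is either prime or a product of two distinct primes, the class number h_n of the real quadratic field ℚ(√(4n^2+1)) satisfies log h_n / log(4n^2+1) > 1/4. -/
open Complex Finset Set Filter Topology MeasureTheory

namespace SiegelBound

noncomputable def partialSumSeries (a : ℕ → ℂ) (s : ℂ) : ℂ :=
  s * mellin (fun t : ℝ => ∑ k ∈ Finset.Icc 1 ⌊t⌋₊, a k) (-s)

lemma measurable_partialSum (a : ℕ → ℂ) :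
    Measurable (fun t : ℝ => ∑ k ∈ Finset.Icc 1 ⌊t⌋₊, a k) :=
  (measurable_from_nat (f := fun n : ℕ => ∑ k ∈ Finset.Icc 1 n, a k)).comp Nat.measurable_floor

lemma differentiableAt_partialSumSeries {a : ℕ → ℂ} {q : ℝ}
    (ha : ∀ n, ‖∑ k ∈ Finset.Icc 1 n, a k‖ ≤ q) {s : ℂ} (hs : 0 < s.re) :
    DifferentiableAt ℂ (partialSumSeries a) s := by
  refine differentiableAt_id.mul ?_
  have hd : DifferentiableAt ℂ (mellin (fun t : ℝ => ∑ k ∈ Finset.Icc 1 ⌊t⌋₊, a k)) (-s) := by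
    refine mellin_differentiableAt_of_isBigO_rpow (a := 0) (b := -s.re - 1) ?_ ?_ ?_ ?_ ?_
    · refine LocallyIntegrable.locallyIntegrableOn ?_ _
      refine (locallyIntegrable_const q).mono (measurable_partialSum a).aestronglyMeasurable ?_
      exact Eventually.of_forall fun t => (ha _).trans (le_abs_self q)
    · refine Asymptotics.IsBigO.of_bound q (Eventually.of_forall fun t => ?_)
      simpa using ha _
    · simpa using hs
    · refine Asymptotics.IsBigO.of_bound 0 ?_
      filter_upwards [nhdsWithin_le_nhds (Iio_mem_nhds (zero_lt_one (α := ℝ)))] with t ht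
      simp [Nat.floor_eq_zero.mpr (Set.mem_Iio.mp ht)]
    · simp
  exact hd.comp s differentiableAt_id.neg

lemma partialSumSeries_eq_integral (a : ℕ → ℂ) (s : ℂ) :
    partialSumSeries a s =
      s * ∫ t in Set.Ioi (1 : ℝ), (∑ k ∈ Finset.Icc 1 ⌊t⌋₊, a k) * (t : ℂ) ^ (-(s + 1)) := by
  rw [partialSumSeries, mellin]
  congr 1
  rw [← integral_Ici_eq_integral_Ioi (x := (1 : ℝ)),
    setIntegral_eq_of_subset_of_forall_sdiff_eq_zero (s := Set.Ici (1 : ℝ)) measurableSet_Ioi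
      (fun t ht => Set.mem_Ioi.mpr (zero_lt_one.trans_le (Set.mem_Ici.mp ht))) (fun t ht => ?_)]
  · refine setIntegral_congr_fun measurableSet_Ici fun t _ => ?_
    rw [smul_eq_mul, mul_comm, neg_add, sub_eq_add_neg]
  · have : t < 1 := by simpa using ht.2
    simp [Nat.floor_eq_zero.mpr this]

lemma LSeries_eq_partialSumSeries {a : ℕ → ℂ} {q : ℝ}
    (ha : ∀ n, ‖∑ k ∈ Finset.Icc 1 n, a k‖ ≤ q) {s : ℂ} (hs : 0 < s.re)
    (h : LSeriesSummable a s) : LSeries a s = partialSumSeries a s := by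
  rw [partialSumSeries_eq_integral, LSeries_eq_mul_integral a le_rfl hs h]
  exact Asymptotics.IsBigO.of_bound q (Eventually.of_forall fun n => by simpa using ha n)

lemma norm_partialSumSeries_le {a : ℕ → ℂ} {q θ : ℝ}
    (ha : ∀ n, ‖∑ k ∈ Finset.Icc 1 n, a k‖ ≤ q) (ha1 : ∀ n, ‖a n‖ ≤ 1)
    (hθ0 : 0 ≤ θ) (hθ1 : θ ≤ 1) {s : ℂ} (hs : 1 - θ < s.re) :
    ‖partialSumSeries a s‖ ≤ ‖s‖ * (q ^ θ / (s.re - (1 - θ))) := by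
  rw [partialSumSeries_eq_integral, norm_mul]
  gcongr
  have hq : 0 ≤ q := (norm_nonneg _).trans (ha 0)
  have hi : IntegrableOn (fun t : ℝ => q ^ θ * t ^ (-θ - s.re)) (Set.Ioi 1) :=
    (integrableOn_Ioi_rpow_of_lt (by linarith) zero_lt_one).const_mul _
  calc _ ≤ ∫ t in Set.Ioi (1 : ℝ), q ^ θ * t ^ (-θ - s.re) := by
        refine norm_integral_le_of_norm_le hi ?_
        refine (ae_restrict_iff' measurableSet_Ioi).mpr (Eventually.of_forall fun t ht => ?_)
        have ht0 : (0 : ℝ) < t := zero_lt_one.trans ht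
        rw [norm_mul, norm_cpow_eq_rpow_re_of_pos ht0]
        set S := ‖∑ k ∈ Finset.Icc 1 ⌊t⌋₊, a k‖
        have h1 : S ≤ q := ha _
        have h2 : S ≤ t := by
          refine (norm_sum_le_of_le _ (fun k _ => ha1 k)).trans ?_
          simpa using Nat.floor_le ht0.le
        have h3 : S ≤ q ^ θ * t ^ (1 - θ) := by
          calc S = S ^ θ * S ^ (1 - θ) := by
                rw [← Real.rpow_add_of_nonneg (norm_nonneg _) hθ0 (by linarith)]; simp [S]
            _ ≤ _ := by gcongr
        calc _ ≤ q ^ θ * t ^ (1 - θ) * t ^ (-(s + 1)).re := by gcongr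
          _ = _ := by
            rw [mul_assoc, ← Real.rpow_add ht0]; congr 2; simp; ring
    _ = _ := by
        rw [integral_const_mul, integral_Ioi_rpow_of_lt (by linarith) zero_lt_one, Real.one_rpow,
          div_eq_mul_inv (q ^ θ), neg_div, ← div_neg, one_div]
        congr 2; ring

lemma partialSumSeries_ofReal_im {a : ℕ → ℂ} (ha : ∀ n, (a n).im = 0) (x : ℝ) :
    (partialSumSeries a x).im = 0 := by
  rw [← conj_eq_iff_im, partialSumSeries, mellin, map_mul, ← integral_conj, conj_ofReal]
  congr 1
  refine setIntegral_congr_fun measurableSet_Ioi fun t ht => ?_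
  have h : (-(x : ℂ) - 1) = ((-x - 1 : ℝ) : ℂ) := by push_cast; ring
  simp only [smul_eq_mul, map_mul, map_sum]
  rw [h, ← ofReal_cpow (le_of_lt ht), conj_ofReal]
  simp [conj_eq_iff_im.mpr (ha _)]

lemma iteratedDeriv_inv_sub_one_two (n : ℕ) :
    iteratedDeriv n (fun s : ℂ => (s - 1)⁻¹) 2 = (-1) ^ n * n.factorial := by
  have h : iteratedDeriv n (fun s : ℂ => (s - 1)⁻¹) 2 = iteratedDeriv n (fun s : ℂ => s⁻¹) (2 - 1) :=
    congrFun (iteratedDeriv_comp_sub_const n (fun s : ℂ => s⁻¹) 1) 2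
  rw [h, iteratedDeriv_eq_iterate, iter_deriv_inv]
  norm_num

lemma differentiableOn_update_zeta {G : ℂ → ℂ} (hG : ∀ s : ℂ, 0 < s.re → DifferentiableAt ℂ G s) :
    DifferentiableOn ℂ (Function.update (fun s => (s - 1) * riemannZeta s * G s) 1 (G 1))
      {s | 0 < s.re} := by
  have ho : IsOpen {s : ℂ | 0 < s.re} := isOpen_lt continuous_const continuous_re
  have h1 : {s : ℂ | 0 < s.re} ∈ 𝓝 (1 : ℂ) := ho.mem_nhds (by simp)
  rw [← differentiableOn_compl_singleton_and_continuousAt_iff h1]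
  constructor
  · intro s hs
    refine DifferentiableAt.differentiableWithinAt ?_
    have hs1 : s ≠ 1 := by simpa using hs.2
    have : DifferentiableAt ℂ (fun s => (s - 1) * riemannZeta s * G s) s :=
      ((differentiableAt_id.sub_const 1).mul (differentiableAt_riemannZeta hs1)).mul (hG s hs.1)
    refine this.congr_of_eventuallyEq ?_
    filter_upwards [isOpen_compl_singleton.mem_nhds hs1] with z hz
    exact Function.update_of_ne hz _ _
  · rw [continuousAt_update_same]
    simpa using riemannZeta_residue_one.mul
      ((hG 1 (by simp)).continuousAt.tendsto.mono_left nhdsWithin_le_nhds)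

/-- The regular part at `1` of `ζ * G`. -/
noncomputable def regularPart (G : ℂ → ℂ) : ℂ → ℂ :=
  dslope (Function.update (fun s => (s - 1) * riemannZeta s * G s) 1 (G 1)) 1

lemma differentiableOn_regularPart {G : ℂ → ℂ}
    (hG : ∀ s : ℂ, 0 < s.re → DifferentiableAt ℂ G s) :
    DifferentiableOn ℂ (regularPart G) {s | 0 < s.re} := by
  have ho : IsOpen {s : ℂ | 0 < s.re} := isOpen_lt continuous_const continuous_re
  exact (differentiableOn_dslope (ho.mem_nhds (by simp))).mpr (differentiableOn_update_zeta hG)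

lemma regularPart_of_ne {G : ℂ → ℂ} {s : ℂ} (hs : s ≠ 1) :
    regularPart G s = riemannZeta s * G s - G 1 * (s - 1)⁻¹ := by
  have := sub_ne_zero.mpr hs
  rw [regularPart, dslope_of_ne _ hs, slope, Function.update_of_ne hs, Function.update_self]
  simp only [vsub_eq_sub, smul_eq_mul]
  field_simp

lemma closedBall_subset_re_pos : Metric.closedBall (2 : ℂ) (4 / 3) ⊆ {s | 2 / 3 ≤ s.re} := by
  intro s hs
  have h := (abs_re_le_norm (s - 2)).trans (mem_closedBall_iff_norm.mp hs)
  simp only [sub_re, re_ofNat] at h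
  have := (abs_le.mp h).1
  simp only [Set.mem_ofPred_eq]
  linarith

/-- A bound for the regular part on the circle of radius `4/3` around `2`. -/
lemma exists_norm_regularPart_le : ∃ C : ℝ, 1 ≤ C ∧ ∀ (G : ℂ → ℂ) (B : ℝ),
    (∀ s ∈ Metric.closedBall (2 : ℂ) (4 / 3), ‖G s‖ ≤ B) →
    ∀ s ∈ Metric.sphere (2 : ℂ) (4 / 3), ‖regularPart G s‖ ≤ C * B := by
  have hne : ∀ s ∈ Metric.sphere (2 : ℂ) (4 / 3), s ≠ 1 := by
    rintro s hs rfl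
    rw [mem_sphere_iff_norm] at hs
    norm_num at hs
  have hc : ContinuousOn riemannZeta (Metric.sphere (2 : ℂ) (4 / 3)) := fun s hs =>
    (differentiableAt_riemannZeta (hne s hs)).continuousAt.continuousWithinAt
  obtain ⟨C, hC⟩ := (isCompact_sphere (2 : ℂ) (4 / 3)).exists_bound_of_continuousOn hc
  refine ⟨max C 0 + 3, by linarith [le_max_right C 0], fun G B hB s hs => ?_⟩
  rw [regularPart_of_ne (hne s hs)]
  have h1 : ‖G 1‖ ≤ B := hB 1 (by rw [mem_closedBall_iff_norm]; norm_num)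
  have h2 : ‖G s‖ ≤ B := hB s (Metric.sphere_subset_closedBall hs)
  have h3 : ‖(s - 1)⁻¹‖ ≤ 3 := by
    rw [norm_inv]
    have h4 : 1 / 3 ≤ ‖s - 1‖ := by
      have h5 := norm_sub_le (s - 1) 1
      rw [mem_sphere_iff_norm] at hs
      have : s - 1 - 1 = s - 2 := by ring
      rw [this, hs, norm_one] at h5
      linarith
    calc _ ≤ (1 / 3 : ℝ)⁻¹ := by gcongr
      _ = 3 := by norm_num
  have hB0 : 0 ≤ B := (norm_nonneg _).trans h1
  calc _ ≤ ‖riemannZeta s‖ * ‖G s‖ + ‖G 1‖ * ‖(s - 1)⁻¹‖ := by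
        rw [← norm_mul, ← norm_mul]; exact norm_sub_le _ _
    _ ≤ max C 0 * B + B * 3 := by
        gcongr
        exact (hC s hs).trans (le_max_left _ _)
    _ = _ := by ring

open scoped ComplexOrder

/-- The Taylor coefficients in `2 - s` of the regular part, for an `L`-series with nonnegative
coefficients. -/
lemma neg_re_le_taylorCoeff {a : ℕ → ℂ} {G : ℂ → ℂ} (ha : 0 ≤ a)
    (hsum : ∀ s : ℂ, 1 < s.re → LSeriesSummable a s)
    (heq : ∀ s : ℂ, 1 < s.re → LSeries a s = riemannZeta s * G s) (n : ℕ) :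
    -(G 1).re ≤ ((-1) ^ n * (n.factorial : ℂ)⁻¹ * iteratedDeriv n (regularPart G) 2).re := by
  have habs : LSeries.abscissaOfAbsConv a < (2 : ℝ) :=
    lt_of_le_of_lt (LSeries.abscissaOfAbsConv_le_of_forall_lt_LSeriesSummable
      (x := 1) fun y hy => hsum y (by simpa using hy)) (EReal.coe_lt_coe_iff.mpr one_lt_two)
  have hev : regularPart G =ᶠ[𝓝 2] fun s => LSeries a s - G 1 * (s - 1)⁻¹ := by
    have ho : IsOpen {s : ℂ | 1 < s.re} := isOpen_lt continuous_const continuous_re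
    filter_upwards [ho.mem_nhds (show (2 : ℂ) ∈ {s : ℂ | 1 < s.re} by simp)] with s hs
    rw [regularPart_of_ne (by rintro rfl; simp at hs), heq s hs]
  have hL : ContDiffAt ℂ n (LSeries a) 2 := by
    have : AnalyticAt ℂ (LSeries a) 2 := by
      refine (LSeries_analyticOnNhd a) 2 ?_
      simpa using! habs
    exact this.contDiffAt
  have hI : ContDiffAt ℂ n (fun s : ℂ => G 1 * (s - 1)⁻¹) 2 :=
    contDiffAt_const.mul ((contDiffAt_id.sub contDiffAt_const).inv (by norm_num))
  have hd : iteratedDeriv n (regularPart G) 2 =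
      iteratedDeriv n (LSeries a) 2 - G 1 * ((-1) ^ n * n.factorial) := by
    rw [hev.iteratedDeriv_eq n, iteratedDeriv_fun_sub hL hI, iteratedDeriv_const_mul_field,
      iteratedDeriv_inv_sub_one_two]
  have hpos := LSeries.iteratedDeriv_alternating ha habs n
  have hf : (n.factorial : ℂ) ≠ 0 := Nat.cast_ne_zero.mpr n.factorial_ne_zero
  have : (-1) ^ n * (n.factorial : ℂ)⁻¹ * iteratedDeriv n (regularPart G) 2 =
      ((n.factorial : ℝ)⁻¹ : ℝ) * ((-1) ^ n * iteratedDeriv n (LSeries a) (2 : ℝ)) - G 1 := by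
    rw [hd]
    have h1 : ((-1 : ℂ) ^ n) * (-1) ^ n = 1 := by rw [← mul_pow]; norm_num
    push_cast
    field_simp
    linear_combination (-(G 1 * n.factorial)) * h1
  rw [this, sub_re, re_ofReal_mul]
  have h2 : 0 ≤ ((-1) ^ n * iteratedDeriv n (LSeries a) (2 : ℝ)).re := (Complex.le_def.mp hpos).1
  have : 0 ≤ (n.factorial : ℝ)⁻¹ := by positivity
  nlinarith [mul_nonneg this h2]

lemma one_le_re_LSeries_two {a : ℕ → ℂ} (ha : 0 ≤ a) (ha1 : a 1 = 1)
    (hsum : LSeriesSummable a 2) : 1 ≤ (LSeries a 2).re := by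
  have h : LSeries.term a 2 1 ≤ LSeries a 2 := by
    refine hsum.le_tsum 1 fun n _ => ?_
    have := LSeries.term_nonneg (ha n) (2 : ℝ)
    simpa using this
  simpa [ha1] using (Complex.le_def.mp h).1

/-- Power series estimate: if `c n ≥ -l`, `c 0 ≥ 1 - l` and `|c n| ≤ B (3/4) ^ n`, then the value
of the power series at `x ∈ (1, 7/6]` is bounded below. -/
lemma power_series_lower_bound {c : ℕ → ℝ} {l B x S : ℝ} {N : ℕ} (hN : 1 ≤ N) (h0 : 1 - l ≤ c 0)
    (hl : ∀ n, -l ≤ c n) (hB : ∀ n, |c n| ≤ B * (3 / 4) ^ n) (hx1 : 1 < x) (hx2 : x ≤ 7 / 6)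
    (hS : HasSum (fun n => c n * x ^ n) S) :
    1 - l * ((x ^ N - 1) / (x - 1)) - 8 * B * (7 / 8) ^ N ≤ S := by
  have hB0 : 0 ≤ B := by simpa using (abs_nonneg _).trans (hB 0)
  have hhead : 1 - l * ((x ^ N - 1) / (x - 1)) ≤ ∑ n ∈ Finset.range N, c n * x ^ n := by
    rw [← geom_sum_eq hx1.ne', Finset.mul_sum]
    obtain ⟨M, rfl⟩ : ∃ M, N = M + 1 := ⟨N - 1, by omega⟩
    rw [Finset.sum_range_succ', Finset.sum_range_succ']
    have : ∑ k ∈ Finset.range M, -l * x ^ (k + 1) ≤ ∑ k ∈ Finset.range M, c (k + 1) * x ^ (k + 1) :=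
      Finset.sum_le_sum fun k _ => mul_le_mul_of_nonneg_right (hl _) (by positivity)
    simp only [neg_mul, Finset.sum_neg_distrib, pow_zero, mul_one] at this ⊢
    linarith
  have htail : |∑' n, c (n + N) * x ^ (n + N)| ≤ 8 * B * (7 / 8) ^ N := by
    have hg : HasSum (fun n : ℕ => B * (7 / 8 : ℝ) ^ N * (7 / 8) ^ n)
        (B * (7 / 8 : ℝ) ^ N * (1 - 7 / 8)⁻¹) :=
      (hasSum_geometric_of_lt_one (by norm_num) (by norm_num)).mul_left _
    refine (tsum_of_norm_bounded (f := fun n => c (n + N) * x ^ (n + N)) hg fun n => ?_).trans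
      (le_of_eq (by norm_num; ring))
    rw [Real.norm_eq_abs, abs_mul, abs_of_nonneg (by positivity : 0 ≤ x ^ (n + N))]
    calc _ ≤ B * (3 / 4) ^ (n + N) * (7 / 6) ^ (n + N) := by
          gcongr
          exact hB _
      _ = _ := by
          rw [mul_assoc, ← mul_pow, pow_add]; norm_num; ring
  have := hS.summable.sum_add_tsum_nat_add N
  rw [hS.tsum_eq] at this
  have := (abs_le.mp htail).1
  linarith

/-- **Estermann's lemma.** -/
theorem one_sub_le_of_re_zeta_mul_nonpos : ∃ C : ℝ, 0 < C ∧ ∀ (a : ℕ → ℂ) (G : ℂ → ℂ) (B β : ℝ),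
    0 ≤ a → a 1 = 1 → (∀ s : ℂ, 0 < s.re → DifferentiableAt ℂ G s) →
    (∀ s : ℂ, 1 < s.re → LSeriesSummable a s) →
    (∀ s : ℂ, 1 < s.re → LSeries a s = riemannZeta s * G s) →
    1 ≤ B → (∀ s ∈ Metric.closedBall (2 : ℂ) (4 / 3), ‖G s‖ ≤ B) →
    5 / 6 ≤ β → β < 1 → (riemannZeta β * G β).re ≤ 0 →
    1 - β ≤ C * (G 1).re * B ^ (8 * (1 - β)) := by
  obtain ⟨C, hC1, hC⟩ := exists_norm_regularPart_le
  refine ⟨2 * Real.exp 1 * (16 * C) ^ (8 : ℝ), by positivity, ?_⟩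
  intro a G B β ha ha1 hG hsum heq hB1 hB hβ hβ1 hF
  have hU : Metric.closedBall (2 : ℂ) (4 / 3) ⊆ {s | 0 < s.re} := fun s hs =>
    (by norm_num : (0 : ℝ) < 2 / 3).trans_le (closedBall_subset_re_pos hs)
  have hdiff := (differentiableOn_regularPart hG).mono hU
  set c : ℕ → ℝ := fun n =>
    ((-1) ^ n * (n.factorial : ℂ)⁻¹ * iteratedDeriv n (regularPart G) 2).re with hc
  set l := (G 1).re with hl
  have hcl : ∀ n, -l ≤ c n := neg_re_le_taylorCoeff ha hsum heq
  have hc0 : 1 - l ≤ c 0 := by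
    have h2 := one_le_re_LSeries_two ha ha1 (hsum 2 (by simp))
    rw [heq 2 (by simp)] at h2
    have h3 : c 0 = (riemannZeta 2 * G 2).re - l := by
      simp only [hc, pow_zero, Nat.factorial_zero, Nat.cast_one, inv_one, mul_one, one_mul,
        iteratedDeriv_zero, regularPart_of_ne (by norm_num : (2 : ℂ) ≠ 1), sub_re]
      norm_num
      rfl
    linarith
  have hcB : ∀ n, |c n| ≤ C * B * (3 / 4) ^ n := by
    intro n
    have h1 := norm_iteratedDeriv_le_of_forall_mem_sphere_norm_le n (by norm_num : (0 : ℝ) < 4 / 3)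
      (DifferentiableOn.diffContOnCl (hdiff.mono Metric.closure_ball_subset_closedBall)) (hC G B hB)
    have hf : (0 : ℝ) < n.factorial := by positivity
    calc |c n| ≤ ‖(-1) ^ n * (n.factorial : ℂ)⁻¹ * iteratedDeriv n (regularPart G) 2‖ :=
          abs_re_le_norm _
      _ = (n.factorial : ℝ)⁻¹ * ‖iteratedDeriv n (regularPart G) 2‖ := by simp
      _ ≤ (n.factorial : ℝ)⁻¹ * (n.factorial * (C * B) / (4 / 3) ^ n) := by gcongr
      _ = _ := by
        rw [show (3 / 4 : ℝ) = (4 / 3)⁻¹ by norm_num, inv_pow]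
        field_simp
  have hS : HasSum (fun n => c n * (2 - β) ^ n) (regularPart G β).re := by
    have hmem : (β : ℂ) ∈ Metric.ball (2 : ℂ) (4 / 3) := by
      rw [mem_ball_iff_norm, show (β : ℂ) - 2 = ((β - 2 : ℝ) : ℂ) by push_cast; ring, norm_real,
        Real.norm_eq_abs, abs_lt]
      constructor <;> linarith
    have h1 := hasSum_re (hasSum_taylorSeries_on_ball
      (hdiff.mono Metric.ball_subset_closedBall) hmem)
    refine h1.congr_fun ?_
    intro n
    have h2 : ((β : ℂ) - 2) ^ n = (-1) ^ n * ((2 - β : ℝ) ^ n : ℝ) := by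
      push_cast; rw [← mul_pow]; ring
    simp only [hc, smul_eq_mul]
    rw [← re_mul_ofReal, h2]
    ring_nf
  obtain ⟨N, hN1, hN2, hN3⟩ : ∃ N : ℕ, 1 ≤ N ∧ 8 * (C * B) * (7 / 8 : ℝ) ^ N ≤ 1 / 2 ∧
      (N : ℝ) ≤ 8 * Real.log (16 * (C * B)) + 1 := by
    have hCB : 1 ≤ C * B := by nlinarith
    have hlog : 0 < Real.log (16 * (C * B)) := Real.log_pos (by linarith)
    refine ⟨⌈8 * Real.log (16 * (C * B))⌉₊, Nat.one_le_ceil_iff.mpr (by linarith), ?_,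
      (Nat.ceil_lt_add_one (by linarith)).le⟩
    have h3 := Nat.le_ceil (8 * Real.log (16 * (C * B)))
    set N := ⌈8 * Real.log (16 * (C * B))⌉₊
    have h4 : (7 / 8 : ℝ) ≤ Real.exp (-(1 / 8)) := by
      have := Real.add_one_le_exp (-(1 / 8) : ℝ); linarith
    have h5 : (7 / 8 : ℝ) ^ N ≤ (16 * (C * B))⁻¹ := by
      calc (7 / 8 : ℝ) ^ N ≤ Real.exp (-(1 / 8)) ^ N := by gcongr
        _ = Real.exp (N * (-(1 / 8))) := by rw [← Real.exp_nat_mul]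
        _ ≤ Real.exp (-Real.log (16 * (C * B))) := by gcongr; linarith
        _ = _ := by rw [Real.exp_neg, Real.exp_log (by linarith)]
    calc _ ≤ 8 * (C * B) * (16 * (C * B))⁻¹ := by gcongr
      _ = 1 / 2 := by field_simp; norm_num
  have hlow := power_series_lower_bound hN1 hc0 hcl hcB (by linarith : 1 < 2 - β)
    (by linarith) hS
  have hb : 0 < 1 - β := by linarith
  have hreg : (regularPart G β).re = (riemannZeta β * G β).re + l / (1 - β) := by
    have hne : (β : ℂ) ≠ 1 := by exact_mod_cast hβ1.ne
    rw [regularPart_of_ne hne, sub_re,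
      show ((β : ℂ) - 1)⁻¹ = (((β - 1)⁻¹ : ℝ) : ℂ) by push_cast; ring, re_mul_ofReal,
      ← neg_sub 1 β, inv_neg]
    ring
  rw [hreg] at hlow
  have hkey : 1 / 2 ≤ l * (2 - β) ^ N / (1 - β) := by
    have : l * (((2 - β) ^ N - 1) / (2 - β - 1)) = l * (2 - β) ^ N / (1 - β) - l / (1 - β) := by
      rw [show 2 - β - 1 = 1 - β by ring]; field_simp
    linarith
  rw [le_div_iff₀ hb] at hkey
  have hpos : 0 < (2 - β) ^ N := pow_pos (by linarith) N
  have hlpos : 0 < l := by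
    by_contra h
    nlinarith
  have hpow : (2 - β) ^ N ≤ Real.exp 1 * (16 * C) ^ (8 : ℝ) * B ^ (8 * (1 - β)) := by
    have h16 : 1 ≤ 16 * C := by linarith
    calc (2 - β) ^ N ≤ Real.exp (1 - β) ^ N := by
          have := Real.add_one_le_exp (1 - β)
          gcongr
          · linarith
          · linarith
      _ = Real.exp (N * (1 - β)) := by rw [← Real.exp_nat_mul]
      _ ≤ Real.exp ((8 * Real.log (16 * (C * B)) + 1) * (1 - β)) := by gcongr
      _ = Real.exp (1 - β) * ((16 * C) ^ (8 * (1 - β)) * B ^ (8 * (1 - β))) := by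
          rw [← Real.mul_rpow (by linarith) (by linarith),
            Real.rpow_def_of_pos (by positivity), ← Real.exp_add, mul_assoc 16]
          ring_nf
      _ ≤ Real.exp 1 * ((16 * C) ^ (8 : ℝ) * B ^ (8 * (1 - β))) := by
          gcongr
          · linarith
          · linarith
      _ = _ := by ring
  calc 1 - β ≤ 2 * (l * (2 - β) ^ N) := by linarith
    _ ≤ 2 * (l * (Real.exp 1 * (16 * C) ^ (8 : ℝ) * B ^ (8 * (1 - β)))) := by gcongr
    _ = _ := by ring

lemma exists_prime_factorization_odd {D : ℕ} (hD0 : D ≠ 0) (hD : ¬ IsSquare D) :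
    ∃ p, p.Prime ∧ Odd (D.factorization p) := by
  obtain ⟨a, b, hab, ha⟩ := Nat.sq_mul_squarefree D
  have ha1 : a ≠ 1 := by
    rintro rfl
    exact hD ⟨b, by rw [← hab]; ring⟩
  have hp := Nat.minFac_prime ha1
  have ha0 : a ≠ 0 := ha.ne_zero
  have hb0 : b ^ 2 ≠ 0 := by rintro h; simp [h] at hab; exact hD0 hab.symm
  refine ⟨a.minFac, hp, b.factorization a.minFac, ?_⟩
  have h1 : a.factorization a.minFac = 1 :=
    le_antisymm (ha.natFactorization_le_one _)
      (hp.dvd_iff_one_le_factorization ha0 |>.mp (Nat.minFac_dvd a))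
  rw [← hab, Nat.factorization_mul hb0 ha0, Nat.factorization_pow]
  simp [h1]

lemma exists_jacobiSym_eq_neg_one {D : ℕ} (hodd : Odd D) (hD : ¬ IsSquare D) :
    ∃ m : ℕ, jacobiSym m D = -1 := by
  have hD0 : D ≠ 0 := hodd.pos.ne'
  obtain ⟨p, hp, hk⟩ := exists_prime_factorization_odd hD0 hD
  have := Fact.mk hp
  have hpD : p ∣ D := Nat.dvd_of_factorization_pos hk.pos.ne'
  have hp2 : p ≠ 2 := by
    rintro rfl
    exact (Nat.not_even_iff_odd.mpr hodd) (even_iff_two_dvd.mpr hpD)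
  have hcop : Nat.Coprime p (ordCompl[p] D) := Nat.coprime_ordCompl hp hD0
  obtain ⟨u, hu⟩ := quadraticChar_exists_neg_one (F := ZMod p) (by rwa [ZMod.ringChar_zmod_n])
  obtain ⟨m, hm1, hm2⟩ := Nat.chineseRemainder hcop u.val 1
  refine ⟨m, ?_⟩
  rw [← Nat.ordProj_mul_ordCompl_eq_self D p, jacobiSym.mul_right' _
    (pow_ne_zero _ hp.ne_zero) (Nat.ordCompl_pos p hD0).ne', jacobiSym.pow_right]
  have h1 : jacobiSym m p = -1 := by
    rw [← jacobiSym.legendreSym.to_jacobiSym, legendreSym, ← hu]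
    congr 1
    have := (ZMod.natCast_eq_natCast_iff _ _ _).mpr hm1
    simpa using this
  have h2 : jacobiSym m (ordCompl[p] D) = 1 := by
    rw [jacobiSym.mod_left' (a₂ := 1), jacobiSym.one_left]
    exact_mod_cast hm2
  rw [h1, h2, hk.neg_one_pow, mul_one]

lemma jacobiSym_natCast_add_mul (k m D : ℕ) :
    jacobiSym ((D * m + k : ℕ) : ℤ) D = jacobiSym k D :=
  jacobiSym.mod_left' (by push_cast; rw [add_comm, Int.add_mul_emod_self_left])

lemma sum_range_jacobiSym {D : ℕ} (hodd : Odd D) (hD : ¬ IsSquare D) :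
    ∑ k ∈ Finset.range D, jacobiSym k D = 0 := by
  obtain ⟨m, hm⟩ := exists_jacobiSym_eq_neg_one hodd hD
  have : NeZero D := ⟨hodd.pos.ne'⟩
  have hval : ∀ n : ℕ, jacobiSym ((n : ZMod D).val : ℤ) D = jacobiSym n D := fun n => by
    rw [ZMod.val_natCast]
    exact (jacobiSym.mod_left n D).symm
  have hsum : ∑ k ∈ Finset.range D, jacobiSym k D = ∑ a : ZMod D, jacobiSym (a.val : ℤ) D := by
    refine Finset.sum_bij (fun k _ => (k : ZMod D)) (fun _ _ => Finset.mem_univ _) ?_ ?_ ?_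
    · intro a ha b hb h
      have := (ZMod.natCast_eq_natCast_iff' _ _ _).mp h
      rwa [Nat.mod_eq_of_lt (Finset.mem_range.mp ha), Nat.mod_eq_of_lt (Finset.mem_range.mp hb)]
        at this
    · intro b _
      exact ⟨b.val, Finset.mem_range.mpr (ZMod.val_lt b), by simp⟩
    · intro a _
      exact (hval a).symm
  have hcop : m.Coprime D := by
    by_contra h
    have := (jacobiSym.eq_zero_iff_not_coprime (a := (m : ℤ)) (b := D)).mpr (by simpa using h)
    omega
  have hmul : ∑ a : ZMod D, jacobiSym (a.val : ℤ) D = -∑ a : ZMod D, jacobiSym (a.val : ℤ) D := by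
    rw [← Finset.sum_neg_distrib]
    symm
    refine Fintype.sum_equiv (Units.mulLeft (ZMod.unitOfCoprime m hcop)) _ _ fun a => ?_
    have h : (ZMod.unitOfCoprime m hcop : ZMod D) * a = ((m * a.val : ℕ) : ZMod D) := by simp
    change _ = jacobiSym (((ZMod.unitOfCoprime m hcop : ZMod D) * a).val : ℤ) D
    rw [h, hval]
    push_cast
    rw [jacobiSym.mul_left, hm]
    ring
  omega

lemma abs_sum_range_jacobiSym_le {D : ℕ} (hodd : Odd D) (hD : ¬ IsSquare D) (n : ℕ) :
    |∑ k ∈ Finset.range n, jacobiSym k D| ≤ D := by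
  have hper : ∀ m, ∑ k ∈ Finset.range (D * m), jacobiSym k D = 0 := by
    intro m
    induction m with
    | zero => simp
    | succ m ih =>
      rw [mul_add_one, Finset.sum_range_add, ih, zero_add]
      simp_rw [jacobiSym_natCast_add_mul]
      exact sum_range_jacobiSym hodd hD
  rw [← Nat.div_add_mod n D, Finset.sum_range_add, hper, zero_add]
  refine (Finset.abs_sum_le_sum_abs _ _).trans ?_
  have h1 : ∀ k ∈ Finset.range (n % D), |jacobiSym ((D * (n / D) + k : ℕ) : ℤ) D| ≤ 1 := by
    intro k _
    rcases jacobiSym.trichotomy ((D * (n / D) + k : ℕ) : ℤ) D with h | h | h <;> rw [h] <;> simp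
  refine (Finset.sum_le_card_nsmul _ _ _ h1).trans ?_
  simp only [Finset.card_range, nsmul_eq_mul, mul_one]
  exact_mod_cast (Nat.mod_lt n hodd.pos).le

/-- The Jacobi symbol `n ↦ (n / D)` as an arithmetic function. -/
def jacobiArith (D : ℕ) : ArithmeticFunction ℤ :=
  ⟨fun n => if n = 0 then 0 else jacobiSym n D, if_pos rfl⟩

lemma jacobiArith_apply {D n : ℕ} (hn : n ≠ 0) : jacobiArith D n = jacobiSym n D := if_neg hn

@[simp] lemma jacobiArith_one (D : ℕ) : jacobiArith D 1 = 1 := by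
  simp [jacobiArith_apply]

lemma jacobiArith_map_mul (D m n : ℕ) :
    jacobiArith D (m * n) = jacobiArith D m * jacobiArith D n := by
  rcases eq_or_ne m 0 with rfl | hm
  · simp
  rcases eq_or_ne n 0 with rfl | hn
  · simp
  rw [jacobiArith_apply hm, jacobiArith_apply hn, jacobiArith_apply (mul_ne_zero hm hn)]
  push_cast
  exact jacobiSym.mul_left _ _ _

lemma jacobiArith_map_pow (D m k : ℕ) : jacobiArith D (m ^ k) = jacobiArith D m ^ k := by
  induction k with
  | zero => simp
  | succ k ih => rw [pow_succ, pow_succ, jacobiArith_map_mul, ih]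

lemma jacobiArith_isMultiplicative (D : ℕ) : (jacobiArith D).IsMultiplicative :=
  ⟨jacobiArith_one D, fun _ => jacobiArith_map_mul D _ _⟩

lemma jacobiArith_trichotomy (D n : ℕ) :
    jacobiArith D n = 0 ∨ jacobiArith D n = 1 ∨ jacobiArith D n = -1 := by
  rcases eq_or_ne n 0 with rfl | hn
  · simp
  · rw [jacobiArith_apply hn]; exact jacobiSym.trichotomy _ _

lemma jacobiArith_mul_modulus {D E : ℕ} (hD : D ≠ 0) (hE : E ≠ 0) (n : ℕ) :
    jacobiArith (D * E) n = jacobiArith D n * jacobiArith E n := by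
  rcases eq_or_ne n 0 with rfl | hn
  · simp
  · simp only [jacobiArith_apply hn]; exact jacobiSym.mul_right' _ hD hE

lemma norm_jacobiArith_le (D n : ℕ) : ‖(jacobiArith D n : ℂ)‖ ≤ 1 := by
  rcases jacobiArith_trichotomy D n with h | h | h <;> simp [h]

lemma norm_sum_jacobiArith_le {D : ℕ} (hodd : Odd D) (hD : ¬ IsSquare D) (n : ℕ) :
    ‖∑ k ∈ Finset.Icc 1 n, (jacobiArith D k : ℂ)‖ ≤ D := by
  have hD1 : 1 < D := by
    rcases Nat.lt_or_ge 1 D with h | h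
    · exact h
    · interval_cases D <;> simp at hD
  have h : ∑ k ∈ Finset.Icc 1 n, jacobiArith D k = ∑ k ∈ Finset.range (n + 1), jacobiSym k D := by
    rw [Finset.sum_range_succ', Nat.cast_zero, jacobiSym.zero_left hD1, add_zero,
      Finset.range_eq_Ico, Finset.sum_Ico_add' (fun k => jacobiSym (k : ℕ) D) 0 n 1]
    refine Finset.sum_congr (by ext; simp) fun k hk => jacobiArith_apply ?_
    have := (Finset.mem_Icc.mp hk).1
    omega
  have h2 := abs_sum_range_jacobiSym_le hodd hD (n + 1)
  rw [← h] at h2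
  rw [← Int.cast_sum, Complex.norm_intCast]
  exact_mod_cast h2

/-- Comparison of a multiplicative function with a supermultiplicative one. -/
lemma le_of_prime_pow_le {f : ArithmeticFunction ℤ} (hf : f.IsMultiplicative) {g : ℕ → ℤ}
    (hg0 : ∀ n, 0 ≤ g n) (hg1 : 1 ≤ g 1) (hmul : ∀ m n, Nat.Coprime m n → g m * g n ≤ g (m * n))
    (hf0 : ∀ p k : ℕ, p.Prime → 0 ≤ f (p ^ k)) (hle : ∀ p k : ℕ, p.Prime → f (p ^ k) ≤ g (p ^ k))
    (n : ℕ) : 0 ≤ f n ∧ f n ≤ g n := by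
  induction n using Nat.recOnPosPrimePosCoprime with
  | zero => simpa using hg0 0
  | one => simpa [hf.map_one] using hg1
  | prime_pow p k hp _ => exact ⟨hf0 p k hp, hle p k hp⟩
  | coprime a b _ _ hab iha ihb =>
    rw [hf.map_mul_of_coprime hab]
    exact ⟨mul_nonneg iha.1 ihb.1,
      (mul_le_mul iha.2 ihb.2 ihb.1 (hg0 a)).trans (hmul a b hab)⟩

lemma nonneg_of_prime_pow {f : ArithmeticFunction ℤ} (hf : f.IsMultiplicative)
    (hf0 : ∀ p k : ℕ, p.Prime → 0 ≤ f (p ^ k)) (n : ℕ) : 0 ≤ f n := by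
  induction n using Nat.recOnPosPrimePosCoprime with
  | zero => simp
  | one => simp [hf.map_one]
  | prime_pow p k hp _ => exact hf0 p k hp
  | coprime a b _ _ hab iha ihb =>
    rw [hf.map_mul_of_coprime hab]
    exact mul_nonneg iha ihb

lemma mul_apply_prime_pow (f g : ArithmeticFunction ℤ) {p : ℕ} (hp : p.Prime) (k : ℕ) :
    (f * g) (p ^ k) = ∑ i ∈ Finset.range (k + 1), f (p ^ i) * g (p ^ (k - i)) := by
  rw [ArithmeticFunction.mul_apply, Nat.sum_divisorsAntidiagonal (fun x y => f x * g y),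
    Nat.sum_divisors_prime_pow hp]
  refine Finset.sum_congr rfl fun i hi => ?_
  rw [Nat.pow_div (Nat.lt_succ_iff.mp (Finset.mem_range.mp hi)) hp.pos]

lemma zeta_prime_pow {p : ℕ} (hp : p.Prime) (k : ℕ) :
    (ArithmeticFunction.zeta : ArithmeticFunction ℤ) (p ^ k) = 1 := by
  simp [hp.ne_zero]

lemma sum_pow_mul_pow_nonneg {x y : ℤ} (hx : x = 0 ∨ x = 1 ∨ x = -1)
    (hy : y = 0 ∨ y = 1 ∨ y = -1) (h : 0 ≤ x + y) (k : ℕ) :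
    0 ≤ ∑ i ∈ Finset.range (k + 1), x ^ i * y ^ (k - i) := by
  have hneg : ∀ k : ℕ, 0 ≤ ∑ i ∈ Finset.range (k + 1), (-1 : ℤ) ^ i := by
    intro k
    rw [neg_one_geom_sum]
    split <;> simp
  rcases hx with rfl | rfl | rfl <;> rcases hy with rfl | rfl | rfl
  · exact Finset.sum_nonneg fun i _ => by positivity
  · exact Finset.sum_nonneg fun i _ => by positivity
  · simp at h
  · exact Finset.sum_nonneg fun i _ => by positivity
  · exact Finset.sum_nonneg fun i _ => by positivity
  · have := hneg k
    rw [← Finset.sum_range_reflect] at this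
    simpa using this
  · simp at h
  · simpa using hneg k
  · simp at h

lemma jacobiArith_mul_prime_pow (D E : ℕ) {p : ℕ} (hp : p.Prime) (k : ℕ) :
    (jacobiArith D * jacobiArith E) (p ^ k) =
      ∑ i ∈ Finset.range (k + 1), jacobiArith D p ^ i * jacobiArith E p ^ (k - i) := by
  simp_rw [mul_apply_prime_pow _ _ hp, jacobiArith_map_pow]

lemma zeta_mul_jacobiArith_prime_pow (D : ℕ) {p : ℕ} (hp : p.Prime) (k : ℕ) :
    ((ArithmeticFunction.zeta : ArithmeticFunction ℤ) * jacobiArith D) (p ^ k) =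
      ∑ i ∈ Finset.range (k + 1), 1 ^ i * jacobiArith D p ^ (k - i) := by
  simp_rw [mul_apply_prime_pow _ _ hp, jacobiArith_map_pow, zeta_prime_pow hp, one_pow]

lemma zeta_mul_jacobiArith_prime_pow_nonneg (D : ℕ) {p : ℕ} (hp : p.Prime) (k : ℕ) :
    0 ≤ ((ArithmeticFunction.zeta : ArithmeticFunction ℤ) * jacobiArith D) (p ^ k) := by
  rw [zeta_mul_jacobiArith_prime_pow _ hp]
  refine sum_pow_mul_pow_nonneg (by simp) (jacobiArith_trichotomy _ _) ?_ k
  rcases jacobiArith_trichotomy D p with h | h | h <;> simp [h]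

lemma zeta_mul_jacobiArith_isMultiplicative (D : ℕ) :
    ((ArithmeticFunction.zeta : ArithmeticFunction ℤ) * jacobiArith D).IsMultiplicative :=
  ArithmeticFunction.isMultiplicative_zeta.natCast.mul (jacobiArith_isMultiplicative D)

/-- The coefficients of `ζ(s) L(s, χ_D) L(s, χ_E) L(s, χ_D χ_E)`. -/
def siegelArith (D E : ℕ) : ArithmeticFunction ℤ :=
  (ArithmeticFunction.zeta : ArithmeticFunction ℤ) * jacobiArith D *
    (jacobiArith E * jacobiArith (D * E))

lemma siegelArith_comm (D E : ℕ) : siegelArith D E = siegelArith E D := by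
  rw [siegelArith, siegelArith, mul_comm D E]; ring

lemma siegelArith_isMultiplicative (D E : ℕ) : (siegelArith D E).IsMultiplicative :=
  (zeta_mul_jacobiArith_isMultiplicative D).mul
    ((jacobiArith_isMultiplicative E).mul (jacobiArith_isMultiplicative _))

lemma siegelArith_prime_pow_nonneg_of {D E p : ℕ} (hp : p.Prime)
    (h : 0 ≤ jacobiArith E p + jacobiArith (D * E) p) (k : ℕ) :
    0 ≤ siegelArith D E (p ^ k) := by
  rw [siegelArith, mul_apply_prime_pow _ _ hp]
  refine Finset.sum_nonneg fun i _ => mul_nonneg (zeta_mul_jacobiArith_prime_pow_nonneg D hp i) ?_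
  rw [jacobiArith_mul_prime_pow _ _ hp]
  exact sum_pow_mul_pow_nonneg (jacobiArith_trichotomy _ _) (jacobiArith_trichotomy _ _) h _

lemma siegelArith_nonneg {D E : ℕ} (hD : D ≠ 0) (hE : E ≠ 0) (n : ℕ) :
    0 ≤ siegelArith D E n := by
  refine nonneg_of_prime_pow (siegelArith_isMultiplicative D E) (fun p k hp => ?_) n
  by_cases h : 0 ≤ jacobiArith E p + jacobiArith (D * E) p
  · exact siegelArith_prime_pow_nonneg_of hp h k
  · rw [siegelArith_comm]
    refine siegelArith_prime_pow_nonneg_of hp ?_ k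
    rw [jacobiArith_mul_modulus hE hD]
    rw [jacobiArith_mul_modulus hD hE] at h
    rcases jacobiArith_trichotomy D p with h1 | h1 | h1 <;>
      rcases jacobiArith_trichotomy E p with h2 | h2 | h2 <;> simp_all

/-- The analytic continuation to `0 < re s` of the `L`-series of the Jacobi symbol modulo `D`. -/
noncomputable def jacobiL (D : ℕ) : ℂ → ℂ := partialSumSeries (fun n => (jacobiArith D n : ℂ))

lemma not_isSquare_of_squarefree {D : ℕ} (hD : Squarefree D) (h1 : 1 < D) : ¬ IsSquare D := by
  rintro ⟨k, rfl⟩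
  have := Nat.isUnit_iff.mp (hD k dvd_rfl)
  subst this
  simp at h1

lemma not_isSquare_mul {D E : ℕ} (hD : Squarefree D) (hE : Squarefree E) (hne : D ≠ E) :
    ¬ IsSquare (D * E) := by
  rintro ⟨k, hk⟩
  refine hne (Nat.eq_of_factorization_eq hD.ne_zero hE.ne_zero fun p => ?_)
  have h1 := hD.natFactorization_le_one p
  have h2 := hE.natFactorization_le_one p
  have hk0 : k ≠ 0 := by
    rintro rfl
    exact mul_ne_zero hD.ne_zero hE.ne_zero (by simpa using hk)
  have h3 := congrArg (fun n => n.factorization p) hk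
  simp only [Nat.factorization_mul hD.ne_zero hE.ne_zero, Nat.factorization_mul hk0 hk0,
    Finsupp.add_apply] at h3
  omega

section
variable {D : ℕ} (hodd : Odd D) (hD : ¬ IsSquare D)
include hodd hD

lemma differentiableAt_jacobiL {s : ℂ} (hs : 0 < s.re) : DifferentiableAt ℂ (jacobiL D) s :=
  differentiableAt_partialSumSeries (norm_sum_jacobiArith_le hodd hD) hs

omit hodd hD in
lemma LSeriesSummable_jacobiArith (D : ℕ) {s : ℂ} (hs : 1 < s.re) :
    LSeriesSummable (fun n => (jacobiArith D n : ℂ)) s :=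
  LSeriesSummable_of_bounded_of_one_lt_re (m := 1) (fun n _ => norm_jacobiArith_le D n) hs

lemma LSeries_jacobiArith {s : ℂ} (hs : 1 < s.re) :
    LSeries (fun n => (jacobiArith D n : ℂ)) s = jacobiL D s :=
  LSeries_eq_partialSumSeries (norm_sum_jacobiArith_le hodd hD) (zero_lt_one.trans hs)
    (LSeriesSummable_jacobiArith D hs)

lemma norm_jacobiL_le_of_mem_closedBall {s : ℂ} (hs : s ∈ Metric.closedBall (2 : ℂ) (4 / 3)) :
    ‖jacobiL D s‖ ≤ 5 * D := by
  have h1 : 2 / 3 ≤ s.re := closedBall_subset_re_pos hs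
  have h2 : ‖s‖ ≤ 10 / 3 := by
    have h3 := norm_le_norm_add_norm_sub' s 2
    rw [mem_closedBall_iff_norm] at hs
    have h4 : ‖(2 : ℂ)‖ = 2 := by simp
    linarith
  have h := norm_partialSumSeries_le (norm_sum_jacobiArith_le hodd hD) (norm_jacobiArith_le D)
    zero_le_one le_rfl (s := s) (by linarith)
  calc _ ≤ _ := h
    _ ≤ 10 / 3 * ((D : ℝ) / (2 / 3)) := by
      rw [Real.rpow_one, sub_self, sub_zero]
      have : 0 < s.re := by linarith
      gcongr
    _ = _ := by ring

lemma norm_jacobiL_one_le {θ : ℝ} (h0 : 0 < θ) (h1 : θ ≤ 1) :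
    ‖jacobiL D 1‖ ≤ (D : ℝ) ^ θ / θ := by
  have h := norm_partialSumSeries_le (norm_sum_jacobiArith_le hodd hD) (norm_jacobiArith_le D)
    h0.le h1 (s := 1) (by simp [h0])
  simpa [jacobiL] using h

omit hodd hD in
lemma jacobiL_ofReal_im (D : ℕ) (x : ℝ) : (jacobiL D x).im = 0 :=
  partialSumSeries_ofReal_im (fun n => by simp) x

lemma jacobiL_one_ne_zero : jacobiL D 1 ≠ 0 := by
  have : NeZero D := ⟨hodd.pos.ne'⟩
  have hD1 : 1 < D := by
    rcases Nat.lt_or_ge 1 D with h | h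
    · exact h
    · interval_cases D <;> simp at hD
  have : Fact (1 < D) := ⟨hD1⟩
  let χ : DirichletCharacter ℂ D :=
    { toFun := fun a => (jacobiSym (a.val : ℤ) D : ℂ)
      map_one' := by simp [ZMod.val_one]
      map_mul' := fun a b => by
        rw [ZMod.val_mul, ← Int.cast_mul, ← jacobiSym.mul_left]
        congr 1
        exact jacobiSym.mod_left' (by push_cast; simp)
      map_nonunit' := fun a ha => by
        have h0 : ¬ a.val.Coprime D := fun h => ha <| by
          have := (ZMod.isUnit_iff_coprime a.val D).mpr h
          rwa [ZMod.natCast_zmod_val] at this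
        have h1 : jacobiSym (a.val : ℤ) D = 0 := by
          rw [jacobiSym.eq_zero_iff_not_coprime, Int.gcd_natCast_natCast]
          exact h0
        rw [h1, Int.cast_zero] }
  have hχ : ∀ n : ℕ, n ≠ 0 → χ n = (jacobiArith D n : ℂ) := fun n hn => by
    change ((jacobiSym (((n : ZMod D).val : ℕ) : ℤ) D : ℤ) : ℂ) = _
    rw [jacobiArith_apply hn, ZMod.val_natCast]
    congr 1
    exact (jacobiSym.mod_left n D).symm
  have hχ1 : χ ≠ 1 := by
    obtain ⟨m, hm⟩ := exists_jacobiSym_eq_neg_one hodd hD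
    intro h
    have hm0 : m ≠ 0 := by
      rintro rfl
      rw [Nat.cast_zero, jacobiSym.zero_left hD1] at hm
      norm_num at hm
    have h2 := hχ m hm0
    rw [jacobiArith_apply hm0, hm, h] at h2
    by_cases hu : IsUnit (m : ZMod D)
    · rw [MulChar.one_apply hu] at h2
      norm_num at h2
    · rw [MulChar.map_nonunit _ hu] at h2
      norm_num at h2
  have hlim : Tendsto (fun x : ℝ => (x : ℂ)) (𝓝[>] 1) (𝓝 1) :=
    (continuous_ofReal.tendsto' 1 1 (by simp)).mono_left nhdsWithin_le_nhds
  have h1 := ((DirichletCharacter.differentiable_LFunction hχ1).continuous.tendsto 1).comp hlim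
  have h2 := (differentiableAt_jacobiL hodd hD (s := 1) (by simp)).continuousAt.tendsto.comp hlim
  have h3 : DirichletCharacter.LFunction χ 1 = jacobiL D 1 := by
    refine tendsto_nhds_unique (h1.congr' ?_) h2
    filter_upwards [self_mem_nhdsWithin] with x hx
    have hx' : 1 < (x : ℂ).re := by simpa using hx
    simp only [Function.comp_apply]
    rw [DirichletCharacter.LFunction_eq_LSeries χ hx', ← LSeries_jacobiArith hodd hD hx']
    exact LSeries_congr (fun hn => hχ _ hn) _
  rw [← h3]
  exact DirichletCharacter.LFunction_apply_one_ne_zero hχ1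

end

lemma LSeriesHasSum_intCast_mul {f g : ArithmeticFunction ℤ} {s a b : ℂ}
    (hf : LSeriesHasSum (fun n => (f n : ℂ)) s a) (hg : LSeriesHasSum (fun n => (g n : ℂ)) s b) :
    LSeriesHasSum (fun n => ((f * g) n : ℂ)) s (a * b) := by
  have h := ArithmeticFunction.LSeriesHasSum_mul (f := (f : ArithmeticFunction ℂ))
    (g := (g : ArithmeticFunction ℂ)) hf hg
  rw [← ArithmeticFunction.intCoe_mul] at h
  exact h

lemma LSeriesHasSum_zeta_mul_jacobiArith {D : ℕ} (hodd : Odd D) (hD : ¬ IsSquare D) {s : ℂ}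
    (hs : 1 < s.re) :
    LSeriesHasSum (fun n => (((ArithmeticFunction.zeta : ArithmeticFunction ℤ) *
      jacobiArith D) n : ℂ)) s (riemannZeta s * jacobiL D s) := by
  refine LSeriesHasSum_intCast_mul ?_ ?_
  · simpa using! ArithmeticFunction.LSeriesHasSum_zeta hs
  · rw [← LSeries_jacobiArith hodd hD hs]
    exact (LSeriesSummable_jacobiArith D hs).LSeriesHasSum

lemma LSeriesHasSum_siegelArith {D E : ℕ} (hD : Odd D) (hE : Odd E) (hDs : ¬ IsSquare D)
    (hEs : ¬ IsSquare E) (hDE : ¬ IsSquare (D * E)) {s : ℂ} (hs : 1 < s.re) :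
    LSeriesHasSum (fun n => (siegelArith D E n : ℂ)) s
      (riemannZeta s * (jacobiL D s * (jacobiL E s * jacobiL (D * E) s))) := by
  rw [← mul_assoc]
  refine LSeriesHasSum_intCast_mul (LSeriesHasSum_zeta_mul_jacobiArith hD hDs hs)
    (LSeriesHasSum_intCast_mul ?_ ?_)
  · rw [← LSeries_jacobiArith hE hEs hs]
    exact (LSeriesSummable_jacobiArith _ hs).LSeriesHasSum
  · rw [← LSeries_jacobiArith (hD.mul hE) hDE hs]
    exact (LSeriesSummable_jacobiArith _ hs).LSeriesHasSum

lemma zeta_mul_jacobiArith_nonneg (D n : ℕ) :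
    0 ≤ ((ArithmeticFunction.zeta : ArithmeticFunction ℤ) * jacobiArith D) n :=
  nonneg_of_prime_pow (zeta_mul_jacobiArith_isMultiplicative D)
    (fun _ k hp => zeta_mul_jacobiArith_prime_pow_nonneg D hp k) n

lemma intCast_nonneg {f : ℕ → ℤ} (hf : ∀ n, 0 ≤ f n) : 0 ≤ fun n => (f n : ℂ) :=
  fun n => Int.cast_nonneg (hf n)

lemma jacobiL_ne_zero_of_one_lt {D : ℕ} (hodd : Odd D) (hD : ¬ IsSquare D) {x : ℝ} (hx : 1 < x) :
    jacobiL D x ≠ 0 := by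
  intro h
  have hpos := LSeries.positive
    (a := fun n => (((ArithmeticFunction.zeta : ArithmeticFunction ℤ) * jacobiArith D) n : ℂ))
    (intCast_nonneg (zeta_mul_jacobiArith_nonneg D))
    (by simp [(zeta_mul_jacobiArith_isMultiplicative D).map_one]) (x := x)
    (lt_of_le_of_lt (LSeries.abscissaOfAbsConv_le_of_forall_lt_LSeriesSummable (x := 1)
      fun y hy => (LSeriesHasSum_zeta_mul_jacobiArith hodd hD
        (by simpa using hy)).LSeriesSummable) (EReal.coe_lt_coe_iff.mpr hx))
  rw [(LSeriesHasSum_zeta_mul_jacobiArith hodd hD (by simpa using hx)).LSeries_eq, h] at hpos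
  simp at hpos

lemma jacobiL_two_re_pos {D : ℕ} (hodd : Odd D) (hD : ¬ IsSquare D) : 0 < (jacobiL D 2).re := by
  have h := LSeriesHasSum_zeta_mul_jacobiArith hodd hD (s := 2) (by simp)
  have h1 := one_le_re_LSeries_two (intCast_nonneg (zeta_mul_jacobiArith_nonneg D))
    (by simp [(zeta_mul_jacobiArith_isMultiplicative D).map_one]) h.LSeriesSummable
  rw [h.LSeries_eq, riemannZeta_two,
    show (Real.pi : ℂ) ^ 2 / 6 = ((Real.pi ^ 2 / 6 : ℝ) : ℂ) by push_cast; rfl, re_ofReal_mul] at h1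
  have h2 : 0 < Real.pi ^ 2 / 6 := by positivity
  by_contra hn
  nlinarith

/-- A negative value on the real line forces a real zero to the left of `1`. -/
lemma exists_zero_of_jacobiL_neg {D : ℕ} (hodd : Odd D) (hD : ¬ IsSquare D) {b : ℝ} (hb0 : 0 < b)
    (hb1 : b < 1) (hb : (jacobiL D b).re < 0) : ∃ β : ℝ, b < β ∧ β < 1 ∧ jacobiL D β = 0 := by
  have hc : ContinuousOn (fun x : ℝ => (jacobiL D x).re) (Set.Icc b 2) := by
    intro x hx
    have : ContinuousAt (fun x : ℝ => jacobiL D x) x :=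
      ContinuousAt.comp (f := fun x : ℝ => (x : ℂ)) (differentiableAt_jacobiL hodd hD
        (by simpa using hb0.trans_le hx.1)).continuousAt continuous_ofReal.continuousAt
    exact (continuous_re.continuousAt.comp this).continuousWithinAt
  obtain ⟨β, hβ, hβ0⟩ := intermediate_value_Ioo (by linarith) hc
    (show (0 : ℝ) ∈ Set.Ioo _ _ from ⟨hb, by simpa using jacobiL_two_re_pos hodd hD⟩)
  have hz : jacobiL D β = 0 := Complex.ext hβ0 (jacobiL_ofReal_im D β)
  refine ⟨β, hβ.1, ?_, hz⟩
  rcases lt_trichotomy β 1 with h | h | h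
  · exact h
  · subst h
    exact absurd (by simpa using hz) (jacobiL_one_ne_zero hodd hD)
  · exact absurd hz (jacobiL_ne_zero_of_one_lt hodd hD h)

lemma exists_riemannZeta_re_neg {b : ℝ} (hb : b < 1) :
    ∃ β : ℝ, b < β ∧ β < 1 ∧ (riemannZeta β).re < 0 := by
  have hlim : Tendsto (fun x : ℝ => (x : ℂ)) (𝓝[<] 1) (𝓝[≠] 1) := by
    refine tendsto_nhdsWithin_iff.mpr
      ⟨(continuous_ofReal.tendsto' 1 1 (by simp)).mono_left nhdsWithin_le_nhds, ?_⟩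
    filter_upwards [self_mem_nhdsWithin] with x hx
    simpa using (Set.mem_Iio.mp hx).ne
  have h := (continuous_re.tendsto 1).comp (riemannZeta_residue_one.comp hlim)
  have h1 : ∀ᶠ x : ℝ in 𝓝[<] 1, 0 < (((x : ℂ) - 1) * riemannZeta x).re :=
    h.eventually (lt_mem_nhds (by simp))
  have h3 : ∀ᶠ x : ℝ in 𝓝[<] 1, x < 1 := self_mem_nhdsWithin
  have h4 : ∀ᶠ x : ℝ in 𝓝[<] 1, b < x := nhdsWithin_le_nhds (lt_mem_nhds hb)
  obtain ⟨β, h2, h5, h4⟩ := (h1.and (h3.and h4)).exists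
  refine ⟨β, h4, h5, ?_⟩
  rw [show (β : ℂ) - 1 = ((β - 1 : ℝ) : ℂ) by push_cast; rfl, re_ofReal_mul] at h2
  by_contra hn
  nlinarith

/-- **Siegel's theorem** with exponent `1 / 8` for Jacobi symbols with odd squarefree modulus. -/
theorem siegel : ∃ c : ℝ, 0 < c ∧ ∃ D₀ : ℕ, ∀ D : ℕ, D₀ < D → Odd D → Squarefree D →
    c ≤ ‖jacobiL D 1‖ * (D : ℝ) ^ (1 / 8 : ℝ) := by
  obtain ⟨C, hC, hmain⟩ := one_sub_le_of_re_zeta_mul_nonpos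
  obtain ⟨b, hb, hb1, hzb⟩ := exists_riemannZeta_re_neg (b := 255 / 256) (by norm_num)
  by_cases hneg : ∃ E : ℕ, 1 < E ∧ Odd E ∧ Squarefree E ∧ (jacobiL E b).re < 0
  · obtain ⟨E, hE1, hEo, hEs, hE⟩ := hneg
    have hE' := not_isSquare_of_squarefree hEs hE1
    obtain ⟨β, hβb, hβ1, hβ⟩ := exists_zero_of_jacobiL_neg hEo hE' (by linarith) hb1 hE
    set K := C * ‖jacobiL E 1‖ * 16 * (125 : ℝ) ^ (1 / 32 : ℝ) * (E : ℝ) ^ (1 / 8 : ℝ) with hK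
    have hKpos : 0 < K := by
      have := norm_pos_iff.mpr (jacobiL_one_ne_zero hEo hE')
      have : (0 : ℝ) < E := by exact_mod_cast hEo.pos
      positivity
    refine ⟨(1 - β) / K, div_pos (by linarith) hKpos, E, fun D hDE hDo hDs => ?_⟩
    have hD' := not_isSquare_of_squarefree hDs (hE1.trans hDE)
    have hED' := not_isSquare_mul hEs hDs hDE.ne
    have hEDo := hEo.mul hDo
    have hE1' : (1 : ℝ) ≤ E := by exact_mod_cast hE1.le
    have hD1' : (1 : ℝ) ≤ D := by exact_mod_cast (hE1.trans hDE).le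
    have hsum := fun (s : ℂ) (hs : 1 < s.re) =>
      LSeriesHasSum_siegelArith hEo hDo hE' hD' hED' hs
    have h := hmain (fun n => (siegelArith E D n : ℂ))
      (fun s => jacobiL E s * (jacobiL D s * jacobiL (E * D) s)) (125 * (E * D) ^ (2 : ℝ)) β
      (intCast_nonneg (siegelArith_nonneg hEo.pos.ne' hDo.pos.ne'))
      (by simp [(siegelArith_isMultiplicative E D).map_one])
      (fun s hs => (differentiableAt_jacobiL hEo hE' hs).mul
        ((differentiableAt_jacobiL hDo hD' hs).mul (differentiableAt_jacobiL hEDo hED' hs)))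
      (fun s hs => (hsum s hs).LSeriesSummable) (fun s hs => (hsum s hs).LSeries_eq)
      (by
        have : (1 : ℝ) ≤ (E * D : ℝ) ^ (2 : ℝ) := Real.one_le_rpow (by nlinarith) (by norm_num)
        linarith)
      (fun s hs => by
        rw [norm_mul, norm_mul]
        have h1 := norm_jacobiL_le_of_mem_closedBall hEo hE' hs
        have h2 := norm_jacobiL_le_of_mem_closedBall hDo hD' hs
        have h3 := norm_jacobiL_le_of_mem_closedBall hEDo hED' hs
        calc _ ≤ (5 * E : ℝ) * ((5 * D) * (5 * (E * D : ℕ))) := by gcongr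
          _ = _ := by push_cast; rw [Real.rpow_two]; ring)
      (by linarith) hβ1 (by simp [hβ])
    have hL := norm_jacobiL_one_le hEDo hED' (θ := 1 / 16) (by norm_num) (by norm_num)
    rw [div_le_iff₀ hKpos]
    have hpow : (125 * (E * D : ℝ) ^ (2 : ℝ)) ^ (8 * (1 - β)) ≤
        (125 : ℝ) ^ (1 / 32 : ℝ) * (E * D : ℝ) ^ (1 / 16 : ℝ) := by
      calc _ ≤ (125 * (E * D : ℝ) ^ (2 : ℝ)) ^ (1 / 32 : ℝ) := by
            refine Real.rpow_le_rpow_of_exponent_le ?_ (by linarith)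
            have : (1 : ℝ) ≤ (E * D : ℝ) ^ (2 : ℝ) := Real.one_le_rpow (by nlinarith) (by norm_num)
            linarith
        _ = _ := by
            rw [Real.mul_rpow (by positivity) (by positivity), ← Real.rpow_mul (by positivity)]
            norm_num
    have hre : (jacobiL E 1 * (jacobiL D 1 * jacobiL (E * D) 1)).re ≤
        ‖jacobiL E 1‖ * (‖jacobiL D 1‖ * (16 * (E * D : ℝ) ^ (1 / 16 : ℝ))) := by
      refine (re_le_norm _).trans ?_
      rw [norm_mul, norm_mul]
      gcongr
      calc _ ≤ _ := hL
        _ = _ := by push_cast; ring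
    calc 1 - β ≤ _ := h
      _ ≤ C * (‖jacobiL E 1‖ * (‖jacobiL D 1‖ * (16 * (E * D : ℝ) ^ (1 / 16 : ℝ)))) *
          ((125 : ℝ) ^ (1 / 32 : ℝ) * (E * D : ℝ) ^ (1 / 16 : ℝ)) := by gcongr
      _ = C * ‖jacobiL E 1‖ * 16 * (125 : ℝ) ^ (1 / 32 : ℝ) * ‖jacobiL D 1‖ *
          ((E * D : ℝ) ^ (1 / 16 : ℝ) * (E * D : ℝ) ^ (1 / 16 : ℝ)) := by ring
      _ = ‖jacobiL D 1‖ * (D : ℝ) ^ (1 / 8 : ℝ) * K := by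
        rw [← Real.rpow_add (by positivity), hK, Real.mul_rpow (by positivity) (by positivity)]
        norm_num
        ring
  · push Not at hneg
    refine ⟨(1 - b) / (C * (5 : ℝ) ^ (1 / 8 : ℝ)), div_pos (by linarith) (by positivity), 1,
      fun D hD1 hDo hDs => ?_⟩
    have hD' := not_isSquare_of_squarefree hDs hD1
    have hD1' : (1 : ℝ) ≤ D := by exact_mod_cast hD1.le
    have hsum := fun (s : ℂ) (hs : 1 < s.re) => LSeriesHasSum_zeta_mul_jacobiArith hDo hD' hs
    have h := hmain _ (jacobiL D) (5 * D) b
      (intCast_nonneg (zeta_mul_jacobiArith_nonneg D))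
      (by simp [(zeta_mul_jacobiArith_isMultiplicative D).map_one])
      (fun s hs => differentiableAt_jacobiL hDo hD' hs)
      (fun s hs => (hsum s hs).LSeriesSummable) (fun s hs => (hsum s hs).LSeries_eq)
      (by linarith) (fun s hs => norm_jacobiL_le_of_mem_closedBall hDo hD' hs)
      (by linarith) hb1 (by
        rw [mul_re, jacobiL_ofReal_im, mul_zero, sub_zero]
        exact mul_nonpos_of_nonpos_of_nonneg hzb.le (hneg D hD1 hDo hDs))
    rw [div_le_iff₀ (by positivity)]
    calc 1 - b ≤ _ := h
      _ ≤ C * ‖jacobiL D 1‖ * (5 * D : ℝ) ^ (1 / 8 : ℝ) := by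
        gcongr
        · exact re_le_norm _
        · linarith
        · linarith
      _ = _ := by rw [Real.mul_rpow (by positivity) (by positivity)]; ring

section IdealCount
variable (S : Type*) [CommRing S] [IsDedekindDomain S] [Module.Free ℤ S] [Module.Finite ℤ S]
  [CharZero S]

/-- The number of ideals of norm `m`. -/
noncomputable def idealCount (m : ℕ) : ℕ := Nat.card {I : Ideal S // Ideal.absNorm I = m}

lemma finite_ideals_of_absNorm_eq (m : ℕ) : Finite {I : Ideal S // Ideal.absNorm I = m} :=
  Ideal.finite_setOfPred_absNorm_eq m

variable {S}

lemma one_le_idealCount {I : Ideal S} {m : ℕ} (h : Ideal.absNorm I = m) : 1 ≤ idealCount S m := by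
  have := finite_ideals_of_absNorm_eq S m
  have : Nonempty {I : Ideal S // Ideal.absNorm I = m} := ⟨⟨I, h⟩⟩
  exact Nat.card_pos

omit [Module.Finite ℤ S] [CharZero S] in
lemma eq_mul_sup_span_absNorm {I J : Ideal S} (h : (Ideal.absNorm I).Coprime (Ideal.absNorm J)) :
    I = I * J ⊔ Ideal.span {(Ideal.absNorm I : S)} := by
  refine le_antisymm ?_ (sup_le Ideal.mul_le_left ?_)
  · have h1 : J ⊔ Ideal.span {(Ideal.absNorm I : S)} = ⊤ := by
      obtain ⟨u, v, huv⟩ := Nat.isCoprime_iff_coprime.mpr h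
      rw [Ideal.eq_top_iff_one, ← Int.cast_one, ← huv]
      push_cast
      rw [add_comm]
      exact Submodule.add_mem_sup (J.mul_mem_left _ (Ideal.absNorm_mem J))
        (Ideal.mul_mem_left _ _ (Ideal.mem_span_singleton_self _))
    calc I = I * (J ⊔ Ideal.span {(Ideal.absNorm I : S)}) := by rw [h1, Ideal.mul_top]
      _ = I * J ⊔ I * Ideal.span {(Ideal.absNorm I : S)} := Ideal.mul_sup _ _ _
      _ ≤ _ := sup_le_sup_left Ideal.mul_le_right _
  · rw [Ideal.span_singleton_le_iff_mem]
    exact Ideal.absNorm_mem I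

lemma idealCount_mul_le {m n : ℕ} (h : m.Coprime n) :
    idealCount S m * idealCount S n ≤ idealCount S (m * n) := by
  have := finite_ideals_of_absNorm_eq S (m * n)
  rw [idealCount, idealCount, ← Nat.card_prod]
  refine Nat.card_le_card_of_injective
    (fun p => (⟨p.1.1 * p.2.1, by rw [map_mul, p.1.2, p.2.2]⟩ :
      {I : Ideal S // Ideal.absNorm I = m * n})) ?_
  rintro ⟨⟨I, hI⟩, ⟨J, hJ⟩⟩ ⟨⟨I', hI'⟩, ⟨J', hJ'⟩⟩ hIJ
  have hIJ' : I * J = I' * J' := congrArg Subtype.val hIJ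
  have h1 : I = I' := by
    rw [eq_mul_sup_span_absNorm (I := I) (J := J) (by rwa [hI, hJ]),
      eq_mul_sup_span_absNorm (I := I') (J := J') (by rwa [hI', hJ']), hIJ', hI, hI']
  have h2 : J = J' := by
    rw [eq_mul_sup_span_absNorm (I := J) (J := I) (by rw [hI, hJ]; exact h.symm),
      eq_mul_sup_span_absNorm (I := J') (J := I') (by rw [hI', hJ']; exact h.symm), mul_comm J,
      hIJ', mul_comm J', hJ, hJ']
  subst h1 h2
  rfl

lemma le_idealCount_of_isCoprime {P Q : Ideal S} {p : ℕ} (hp : p.Prime)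
    (hP : Ideal.absNorm P = p) (hQ : Ideal.absNorm Q = p) (hPQ : P ⊔ Q = ⊤) (k : ℕ) :
    k + 1 ≤ idealCount S (p ^ k) := by
  have := finite_ideals_of_absNorm_eq S (p ^ k)
  have hP0 : P ≠ 0 := by
    rintro rfl
    exact hp.ne_zero (by simpa using hP.symm)
  have hQ0 : Q ≠ 0 := by
    rintro rfl
    exact hp.ne_zero (by simpa using hQ.symm)
  have key : ∀ i j : ℕ, i < j → j ≤ k → P ^ i * Q ^ (k - i) ≠ P ^ j * Q ^ (k - j) := by
    intro i j hij hjk h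
    obtain ⟨e, rfl⟩ := Nat.exists_eq_add_of_lt hij
    rw [show k - i = (e + 1) + (k - (i + e + 1)) by omega, pow_add Q,
      show i + e + 1 = i + (e + 1) by omega, pow_add P, mul_assoc] at h
    have h1 := mul_left_cancel₀ (pow_ne_zero i hP0) h
    have h2 := mul_right_cancel₀ (pow_ne_zero _ hQ0) h1
    have h3 : P ^ (e + 1) ⊔ Q ^ (e + 1) = ⊤ := Ideal.pow_sup_pow_eq_top hPQ
    rw [h2, sup_idem, ← Ideal.absNorm_eq_one_iff, map_pow, hP] at h3
    exact hp.one_lt.ne' ((Nat.pow_eq_one.mp h3).resolve_right (by omega))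
  calc k + 1 = Nat.card (Fin (k + 1)) := by simp
    _ ≤ _ := Nat.card_le_card_of_injective
      (fun i : Fin (k + 1) => (⟨P ^ (i : ℕ) * Q ^ (k - i), by
        rw [map_mul, map_pow, map_pow, hP, hQ, ← pow_add]
        congr 1
        omega⟩ : {I : Ideal S // Ideal.absNorm I = p ^ k})) (by
        intro i j hij
        have hij' := congrArg Subtype.val hij
        by_contra hne
        rcases lt_or_gt_of_ne (Fin.val_ne_of_ne hne) with h | h
        · exact key i j h (by omega) hij'
        · exact key j i h (by omega) hij'.symm)

variable {ω : S} {n : ℕ} (hω : ω ^ 2 = ω + (n : S) ^ 2) (htr : Algebra.trace ℤ S ω = 1)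
  (hrank : Module.finrank ℤ S = 2)
include hω hrank

include htr in
lemma exists_ideals_of_root {p : ℕ} (hp : p.Prime) {b : ℤ} (hb : (p : ℤ) ∣ b ^ 2 - b - n ^ 2)
    (hb' : ¬ (p : ℤ) ∣ 1 - 2 * b) :
    ∃ P Q : Ideal S, Ideal.absNorm P = p ∧ Ideal.absNorm Q = p ∧ P ⊔ Q = ⊤ := by
  have hpb : IsCoprime (p : ℤ) (1 - 2 * b) :=
    (Nat.prime_iff_prime_int.mp hp).coprime_iff_not_dvd.mpr hb'
  obtain ⟨u, v, huv⟩ := hpb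
  obtain ⟨w, hw⟩ := hb
  have huv' : (u : S) * p + v * (1 - 2 * b) = 1 := by exact_mod_cast congrArg (Int.cast : ℤ → S) huv
  have hw' : (b : S) ^ 2 - b - n ^ 2 = p * w := by exact_mod_cast congrArg (Int.cast : ℤ → S) hw
  set P : Ideal S := Ideal.span {(p : S), ω - b} with hP
  set Q : Ideal S := Ideal.span {(p : S), 1 - ω - b} with hQ
  have hpP : (p : S) ∈ P := Ideal.subset_span (by simp)
  have hpQ : (p : S) ∈ Q := Ideal.subset_span (by simp)
  have hωP : ω - b ∈ P := Ideal.subset_span (by simp)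
  have hωQ : 1 - ω - b ∈ Q := Ideal.subset_span (by simp)
  have hPQ : P * Q = Ideal.span {(p : S)} := by
    apply le_antisymm
    · rw [hP, hQ, Ideal.span_mul_span', Ideal.span_le]
      rintro _ ⟨a, ha, c, hc, rfl⟩
      simp only [Set.mem_insert_iff, Set.mem_singleton_iff] at ha hc
      simp only [SetLike.mem_coe, Ideal.mem_span_singleton]
      rcases ha with rfl | rfl <;> rcases hc with rfl | rfl
      · exact dvd_mul_right _ _
      · exact dvd_mul_right _ _
      · exact dvd_mul_left _ _
      · exact ⟨w, by linear_combination hw' - hω⟩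
    · rw [Ideal.span_singleton_le_iff_mem]
      have h1 : (p : S) = u * (p * p) + v * ((ω - b) * p + p * (1 - ω - b)) := by
        linear_combination (- (p : S)) * huv'
      rw [h1]
      exact add_mem (Ideal.mul_mem_left _ _ (Ideal.mul_mem_mul hpP hpQ)) (Ideal.mul_mem_left _ _
        (add_mem (Ideal.mul_mem_mul hωP hpQ) (Ideal.mul_mem_mul hpP hωQ)))
  have htr1 : ∀ c : ℤ, Algebra.trace ℤ S (c : S) = 2 * c := fun c => by
    have := Algebra.trace_algebraMap (S := S) c
    rw [hrank] at this
    simpa using this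
  have htr2 : ∀ z : S, Algebra.trace ℤ S (p * z) = p * Algebra.trace ℤ S z := fun z => by
    rw [← nsmul_eq_mul, map_nsmul, nsmul_eq_mul]
  have hQ1 : Q ≠ ⊤ := by
    intro h
    rw [h, Ideal.mul_top] at hPQ
    rw [hPQ, Ideal.mem_span_singleton] at hωP
    obtain ⟨z, hz⟩ := hωP
    have := congrArg (Algebra.trace ℤ S) hz
    rw [map_sub, htr, htr1, htr2] at this
    exact hb' ⟨_, this⟩
  have hP1 : P ≠ ⊤ := by
    intro h
    rw [h, Ideal.top_mul] at hPQ
    rw [hPQ, Ideal.mem_span_singleton] at hωQ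
    obtain ⟨z, hz⟩ := hωQ
    have := congrArg (Algebra.trace ℤ S) hz
    have h1 := htr1 1
    rw [Int.cast_one] at h1
    rw [map_sub, map_sub, htr, htr1, htr2, h1] at this
    exact hb' ⟨Algebra.trace ℤ S z, by linarith⟩
  have hnorm := congrArg Ideal.absNorm hPQ
  rw [map_mul, Ideal.absNorm_span_natCast, hrank, hp.mul_eq_prime_sq_iff
    (by rwa [Ne, Ideal.absNorm_eq_one_iff]) (by rwa [Ne, Ideal.absNorm_eq_one_iff])] at hnorm
  refine ⟨P, Q, hnorm.1, hnorm.2, ?_⟩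
  rw [Ideal.eq_top_iff_one, show (1 : S) = (u * p + v * (ω - b)) + v * (1 - ω - b) by
    linear_combination - huv']
  exact Submodule.add_mem_sup
    (add_mem (Ideal.mul_mem_left _ _ hpP) (Ideal.mul_mem_left _ _ hωP)) (Ideal.mul_mem_left _ _ hωQ)

lemma exists_ideal_of_dvd {p : ℕ} (hp : p.Prime) (hsq : Squarefree (4 * n ^ 2 + 1))
    (hpd : p ∣ 4 * n ^ 2 + 1) : ∃ P : Ideal S, Ideal.absNorm P = p := by
  obtain ⟨e, he⟩ := hpd
  have hcop : p.Coprime e := by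
    rw [hp.coprime_iff_not_dvd]
    rintro ⟨f, rfl⟩
    exact hp.not_isUnit (hsq p ⟨f, by rw [he]; ring⟩)
  obtain ⟨u, v, huv⟩ := Nat.isCoprime_iff_coprime.mpr hcop
  have huv' : (u : S) * p + v * e = 1 := by exact_mod_cast congrArg (Int.cast : ℤ → S) huv
  have he' : 4 * (n : S) ^ 2 + 1 = p * e := by exact_mod_cast congrArg (Nat.cast : ℕ → S) he
  set P : Ideal S := Ideal.span {(p : S), 2 * ω - 1} with hP
  have hpP : (p : S) ∈ P := Ideal.subset_span (by simp)
  have hωP : 2 * ω - 1 ∈ P := Ideal.subset_span (by simp)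
  have hPP : P * P = Ideal.span {(p : S)} := by
    apply le_antisymm
    · rw [hP, Ideal.span_mul_span', Ideal.span_le]
      rintro _ ⟨a, ha, c, hc, rfl⟩
      simp only [Set.mem_insert_iff, Set.mem_singleton_iff] at ha hc
      simp only [SetLike.mem_coe, Ideal.mem_span_singleton]
      rcases ha with rfl | rfl <;> rcases hc with rfl | rfl
      · exact dvd_mul_right _ _
      · exact dvd_mul_right _ _
      · exact dvd_mul_left _ _
      · exact ⟨e, by linear_combination he' + 4 * hω⟩
    · rw [Ideal.span_singleton_le_iff_mem]
      have h1 : (p : S) = u * (p * p) + v * ((2 * ω - 1) * (2 * ω - 1)) := by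
        linear_combination (- (p : S)) * huv' - v * he' - 4 * v * hω
      rw [h1]
      exact add_mem (Ideal.mul_mem_left _ _ (Ideal.mul_mem_mul hpP hpP)) (Ideal.mul_mem_left _ _
        (Ideal.mul_mem_mul hωP hωP))
  have hnorm := congrArg Ideal.absNorm hPP
  rw [map_mul, Ideal.absNorm_span_natCast, hrank, ← sq] at hnorm
  exact ⟨P, Nat.pow_left_injective two_ne_zero hnorm⟩

omit [CharZero S] [IsDedekindDomain S] [Module.Free ℤ S] [Module.Finite ℤ S] hω hrank in
lemma exists_root_of_jacobiArith_eq_one {p : ℕ} (hp : p.Prime)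
    (h : jacobiArith (4 * n ^ 2 + 1) p = 1) :
    ∃ b : ℤ, (p : ℤ) ∣ b ^ 2 - b - n ^ 2 ∧ ¬ (p : ℤ) ∣ 1 - 2 * b := by
  rw [jacobiArith_apply hp.ne_zero] at h
  rcases hp.eq_two_or_odd' with rfl | hodd
  · have hd : Odd (4 * n ^ 2 + 1) := ⟨2 * n ^ 2, by ring⟩
    have hn : Even n := by
      by_contra hn
      rw [Nat.not_even_iff_odd] at hn
      obtain ⟨t, rfl⟩ := hn
      rw [Nat.cast_two, jacobiSym.at_two hd] at h
      have : ((4 * (2 * t + 1) ^ 2 + 1 : ℕ) : ZMod 8) = 5 := by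
        have h2 : 4 * (2 * t + 1) ^ 2 + 1 = 8 * (2 * t ^ 2 + 2 * t) + 5 := by ring
        rw [h2]
        push_cast
        rw [show (8 : ZMod 8) = 0 from rfl, zero_mul, zero_add]
      rw [this] at h
      revert h
      decide
    obtain ⟨t, rfl⟩ := hn
    refine ⟨0, ⟨- 2 * t ^ 2, by push_cast; ring⟩, by norm_num⟩
  · have := Fact.mk hp
    rw [jacobiSym.quadratic_reciprocity_one_mod_four' hodd (by omega),
      ← jacobiSym.legendreSym.to_jacobiSym] at h
    have hd0 : (((4 * n ^ 2 + 1 : ℕ) : ℤ) : ZMod p) ≠ 0 := by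
      intro h0
      rw [(legendreSym.eq_zero_iff p _).mpr h0] at h
      exact zero_ne_one h
    obtain ⟨c, hc⟩ := (legendreSym.eq_one_iff p hd0).mp h
    obtain ⟨a, ha, haodd⟩ : ∃ a : ℤ, (a : ZMod p) = c ∧ Odd a := by
      rcases Int.even_or_odd (c.val : ℤ) with he | ho
      · exact ⟨c.val + p, by simp, he.add_odd (by exact_mod_cast hodd)⟩
      · exact ⟨c.val, by simp, ho⟩
    obtain ⟨t, rfl⟩ := haodd
    have hdvd : (p : ℤ) ∣ (2 * t + 1) ^ 2 - (4 * n ^ 2 + 1) := by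
      rw [← ZMod.intCast_zmod_eq_zero_iff_dvd]
      rw [Int.cast_sub, Int.cast_pow, ha, sub_eq_zero, sq, ← hc]
      push_cast
      rfl
    have hp2 : IsCoprime (p : ℤ) 4 := by
      have : p.Coprime (2 ^ 2) := Nat.Coprime.pow_right 2 (Nat.coprime_two_right.mpr hodd)
      exact_mod_cast Nat.isCoprime_iff_coprime.mpr this
    refine ⟨t + 1, hp2.dvd_of_dvd_mul_left ?_, fun h1 => ?_⟩
    · rwa [show 4 * ((t + 1) ^ 2 - (t + 1) - (n : ℤ) ^ 2) =
        (2 * t + 1) ^ 2 - (4 * n ^ 2 + 1) by ring]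
    apply hd0
    rw [hc, ← ha]
    have : ((2 * t + 1 : ℤ) : ZMod p) = 0 := by
      rw [ZMod.intCast_zmod_eq_zero_iff_dvd, ← dvd_neg]
      rwa [show -(2 * t + 1) = 1 - 2 * (t + 1) by ring]
    rw [this, zero_mul]

include htr in
lemma zeta_mul_jacobiArith_le_idealCount (hsq : Squarefree (4 * n ^ 2 + 1)) (m : ℕ) :
    ((ArithmeticFunction.zeta : ArithmeticFunction ℤ) * jacobiArith (4 * n ^ 2 + 1)) m ≤
      idealCount S m := by
  refine (le_of_prime_pow_le (zeta_mul_jacobiArith_isMultiplicative _)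
    (g := fun m => (idealCount S m : ℤ)) (fun m => by positivity) ?_ ?_
    (fun p k hp => zeta_mul_jacobiArith_prime_pow_nonneg _ hp k) ?_ m).2
  · exact_mod_cast one_le_idealCount (S := S) (I := ⊤) (by simp)
  · intro a b hab
    exact_mod_cast idealCount_mul_le hab
  · intro p k hp
    rw [zeta_mul_jacobiArith_prime_pow _ hp]
    simp only [one_pow, one_mul]
    rcases jacobiArith_trichotomy (4 * n ^ 2 + 1) p with h | h | h
    · rw [h, ← Finset.sum_range_reflect]
      have h0 : ∑ j ∈ Finset.range (k + 1), (0 : ℤ) ^ (k - (k + 1 - 1 - j)) = 1 := by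
        rw [Finset.sum_eq_single 0]
        · simp
        · intro j hj hj0
          rw [Finset.mem_range] at hj
          exact zero_pow (by omega)
        · simp
      rw [h0]
      have hpd : p ∣ 4 * n ^ 2 + 1 := by
        rw [jacobiArith_apply hp.ne_zero, jacobiSym.eq_zero_iff_not_coprime,
          Int.gcd_natCast_natCast] at h
        by_contra hn
        exact h ((hp.coprime_iff_not_dvd).mpr hn)
      obtain ⟨P, hP⟩ := exists_ideal_of_dvd hω hrank hp hsq hpd
      exact_mod_cast one_le_idealCount (I := P ^ k) (by rw [map_pow, hP])
    · rw [h]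
      simp only [one_pow, Finset.sum_const, Finset.card_range, nsmul_eq_mul, mul_one]
      obtain ⟨b, hb, hb'⟩ := exists_root_of_jacobiArith_eq_one hp h
      obtain ⟨P, Q, hP, hQ, hPQ⟩ := exists_ideals_of_root hω htr hrank hp hb hb'
      exact_mod_cast le_idealCount_of_isCoprime hp hP hQ hPQ k
    · rw [h, ← Finset.sum_range_reflect]
      have h0 : ∑ j ∈ Finset.range (k + 1), (-1 : ℤ) ^ (k - (k + 1 - 1 - j)) =
          ∑ j ∈ Finset.range (k + 1), (-1 : ℤ) ^ j :=
        Finset.sum_congr rfl fun j hj => by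
          rw [Finset.mem_range] at hj
          congr 1
          omega
      rw [h0, neg_one_geom_sum]
      split_ifs with hk
      · positivity
      · obtain ⟨t, rfl⟩ : Even k := by
          rw [Nat.even_add_one, not_not] at hk
          exact hk
        exact_mod_cast one_le_idealCount (I := Ideal.span {((p ^ t : ℕ) : S)}) (by
          rw [Ideal.absNorm_span_natCast, hrank, ← pow_mul, mul_two])

end IdealCount

open NumberField Polynomial

section QuadraticField
variable {K : Type*} [Field K] [NumberField K]

/-- A coefficientwise lower bound for the ideal counting function gives a lower bound for the
residue of the Dedekind zeta function. -/
lemma norm_jacobiL_one_le_residue {D : ℕ} (hodd : Odd D) (hD : ¬ IsSquare D)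
    (h : ∀ m, ((ArithmeticFunction.zeta : ArithmeticFunction ℤ) * jacobiArith D) m ≤
      idealCount (𝓞 K) m) : ‖jacobiL D 1‖ ≤ dedekindZeta_residue K := by
  have hκ := dedekindZeta_residue_pos K
  have h1 := tendsto_sub_one_mul_dedekindZeta_nhdsGT K
  have hlim : Tendsto (fun x : ℝ => (x : ℂ)) (𝓝[>] 1) (𝓝[≠] 1) := by
    refine tendsto_nhdsWithin_iff.mpr
      ⟨(continuous_ofReal.tendsto' 1 1 (by simp)).mono_left nhdsWithin_le_nhds, ?_⟩
    filter_upwards [self_mem_nhdsWithin] with x hx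
    simpa using (Set.mem_Ioi.mp hx).ne'
  have h2 := (riemannZeta_residue_one.comp hlim).mul
    ((differentiableAt_jacobiL hodd hD (s := 1) (by simp)).continuousAt.tendsto.comp
      (hlim.mono_right nhdsWithin_le_nhds))
  have h3 : ‖((dedekindZeta_residue K : ℝ) : ℂ)‖ = dedekindZeta_residue K := by
    rw [norm_real, Real.norm_of_nonneg hκ.le]
  rw [← h3, ← one_mul (jacobiL D 1)]
  refine le_of_tendsto_of_tendsto h2.norm h1.norm ?_
  have h4 : ∀ᶠ s : ℝ in 𝓝[>] 1, ((s : ℂ) - 1) * dedekindZeta K s ≠ 0 :=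
    h1.eventually_ne (ofReal_ne_zero.mpr hκ.ne')
  filter_upwards [h4, self_mem_nhdsWithin] with s hs hs1
  have hs1' : 1 < (s : ℂ).re := by simpa using hs1
  have hsum : LSeriesSummable (fun m => (idealCount (𝓞 K) m : ℂ)) s := by
    by_contra hn
    have h0 : dedekindZeta K s = 0 := tsum_eq_zero_of_not_summable hn
    exact hs (by rw [h0, mul_zero])
  simp only [Function.comp_apply, norm_mul, mul_assoc]
  refine mul_le_mul_of_nonneg_left ?_ (norm_nonneg _)
  rw [← norm_mul]
  refine le_trans ?_ (re_le_norm _)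
  refine HasSum.norm_le_of_bounded (LSeriesHasSum_zeta_mul_jacobiArith hodd hD hs1')
    (hasSum_re hsum.LSeriesHasSum) fun m => ?_
  rcases eq_or_ne m 0 with rfl | hm
  · simp
  · rw [LSeries.term_of_ne_zero hm, LSeries.term_of_ne_zero hm, norm_div, norm_natCast_cpow_of_pos
      (Nat.pos_of_ne_zero hm), ← ofReal_natCast m, ← ofReal_cpow (Nat.cast_nonneg m),
      ← ofReal_natCast, ← ofReal_div, ofReal_re, ofReal_re, norm_intCast]
    gcongr
    rw [← Int.cast_abs, abs_of_nonneg (zeta_mul_jacobiArith_nonneg D m)]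
    exact_mod_cast h m

variable {ω : 𝓞 K} {n : ℕ} (hω : ω ^ 2 = ω + (n : 𝓞 K) ^ 2)
include hω

lemma discr_eq_of_trace_eq_one (htr : Algebra.trace ℤ (𝓞 K) ω = 1)
    (hrank : Module.finrank ℤ (𝓞 K) = 2) (hsq : Squarefree (4 * n ^ 2 + 1)) :
    discr K = 4 * n ^ 2 + 1 := by
  have htr1 : ∀ c : ℤ, Algebra.trace ℤ (𝓞 K) (c : 𝓞 K) = 2 * c := fun c => by
    have := Algebra.trace_algebraMap (S := 𝓞 K) c
    rw [hrank] at this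
    simpa using this
  have h1 : Algebra.discr ℤ ![1, ω] = 4 * n ^ 2 + 1 := by
    have h11 := htr1 1
    have h22 := htr1 (n ^ 2)
    push_cast at h11 h22
    rw [Algebra.discr_def, Matrix.det_fin_two]
    simp only [Algebra.traceMatrix_apply, Algebra.traceForm_apply, Matrix.cons_val_zero,
      Matrix.cons_val_one, mul_one, one_mul]
    rw [← sq ω, hω, map_add, htr, h11, h22]
    ring
  let b := Module.finBasisOfFinrankEq ℤ (𝓞 K) hrank
  rw [← b.toMatrix_map_vecMul ![1, ω], Algebra.discr_of_matrix_vecMul, discr_eq_discr] at h1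
  have h2 : IsUnit (b.toMatrix ![1, ω]).det := by
    rw [Int.isUnit_iff_natAbs_eq]
    refine Nat.isUnit_iff.mp (hsq _ ?_)
    have h3 := congrArg Int.natAbs h1
    rw [Int.natAbs_mul, Int.natAbs_pow, sq] at h3
    exact ⟨_, by rw [h3]; rfl⟩
  rw [← h1, Int.isUnit_sq h2, one_mul]

lemma regulator_le (hn : n ≠ 0) (hcard : Fintype.card (InfinitePlace K) = 2) :
    Units.regulator K ≤ 2 * Real.log (2 * n + Real.sqrt (4 * n ^ 2 + 1)) := by
  classical
  let ε : (𝓞 K)ˣ := Units.mkOfMulEqOne (2 * n - 1 + 2 * ω) (2 * ω - 1 - 2 * n)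
    (by linear_combination 4 * hω)
  set B := 2 * (n : ℝ) + Real.sqrt (4 * n ^ 2 + 1) with hB
  set y : K := algebraMap (𝓞 K) K (2 * ω - 1) with hy
  have hωK : (algebraMap (𝓞 K) K ω) ^ 2 = algebraMap (𝓞 K) K ω + (n : K) ^ 2 := by
    have := congrArg (algebraMap (𝓞 K) K) hω
    simpa using this
  have hy2 : y ^ 2 = ((4 * n ^ 2 + 1 : ℕ) : K) := by
    rw [hy]
    push_cast [map_sub, map_mul]
    simp only [map_ofNat]
    linear_combination 4 * hωK
  have hwn : ∀ (w : InfinitePlace K) (m : ℕ), w (m : K) = m := fun w m => by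
    rw [← w.norm_embedding_eq, map_natCast, Complex.norm_natCast]
  have hadd : ∀ (w : InfinitePlace K) (a b : K), w (a + b) ≤ w a + w b := fun w a b => by
    simpa only [← w.norm_embedding_eq, map_add] using norm_add_le _ _
  have hsub : ∀ (w : InfinitePlace K) (a b : K), w (a - b) ≤ w a + w b := fun w a b => by
    simpa only [← w.norm_embedding_eq, map_sub] using norm_sub_le _ _
  have hwy : ∀ w : InfinitePlace K, w y = Real.sqrt (4 * n ^ 2 + 1) := fun w => by
    have h := congrArg w hy2
    rw [map_pow, hwn] at h
    rw [← Real.sqrt_sq (apply_nonneg w y), h]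
    push_cast
    rfl
  have hε : algebraMap (𝓞 K) K ε = ((2 * n : ℕ) : K) + y := by
    change algebraMap (𝓞 K) K (2 * n - 1 + 2 * ω) = _
    rw [hy]
    push_cast
    simp only [map_ofNat]
    ring
  have hεy : algebraMap (𝓞 K) K ε * (y - ((2 * n : ℕ) : K)) = 1 := by
    rw [hε]
    push_cast at hy2 ⊢
    linear_combination hy2
  have hle : ∀ w : InfinitePlace K, w (algebraMap (𝓞 K) K ε) ≤ B := fun w => by
    rw [hε]
    refine (hadd w _ _).trans_eq ?_
    rw [hwn, hwy]
    push_cast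
    rfl
  have hle' : ∀ w : InfinitePlace K, w (y - ((2 * n : ℕ) : K)) ≤ B := fun w => by
    refine (hsub w _ _).trans_eq ?_
    rw [hwn, hwy, add_comm]
    push_cast
    rfl
  have hpos : ∀ w : InfinitePlace K, 0 < w (algebraMap (𝓞 K) K ε) := fun w =>
    w.pos_iff.mpr (left_ne_zero_of_mul_eq_one hεy)
  have hlog : ∀ w : InfinitePlace K, |Real.log (w (algebraMap (𝓞 K) K ε))| ≤ Real.log B :=
    fun w => by
    have h1 : w (algebraMap (𝓞 K) K ε) * w (y - ((2 * n : ℕ) : K)) = 1 := by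
      rw [← map_mul, hεy, map_one]
    refine abs_le.mpr ⟨?_, Real.log_le_log (hpos w) (hle w)⟩
    rw [eq_inv_of_mul_eq_one_left h1, Real.log_inv, neg_le_neg_iff]
    exact Real.log_le_log (pos_of_mul_pos_right (h1 ▸ one_pos) (hpos w).le) (hle' w)
  have hne : ∀ w : InfinitePlace K, Real.log (w (algebraMap (𝓞 K) K ε)) ≠ 0 := fun w h => by
    have h1 : w (algebraMap (𝓞 K) K ε) = 1 := Real.eq_one_of_pos_of_log_eq_zero (hpos w) h
    have h2 : (algebraMap (𝓞 K) K ε) ^ 2 - 1 = ((4 * n : ℕ) : K) * algebraMap (𝓞 K) K ε := by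
      rw [hε]
      push_cast at hy2 ⊢
      linear_combination hy2
    have h3 := hsub w ((algebraMap (𝓞 K) K ε) ^ 2) 1
    rw [h2, map_mul, map_pow, h1, hwn, map_one] at h3
    have h4 : (1 : ℝ) ≤ n := by exact_mod_cast Nat.one_le_iff_ne_zero.mpr hn
    push_cast at h3
    linarith
  have hr : Units.rank K = 1 := by rw [Units.rank, hcard]
  obtain ⟨w'⟩ : Nonempty (InfinitePlace K) := inferInstance
  have hc : Fintype.card {w // w ≠ w'} = Fintype.card (Fin (Units.rank K)) := by
    rw [Fintype.card_subtype_compl, hcard, Fintype.card_fin, hr]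
    simp
  let e := Fintype.equivOfCardEq hc
  have hc1 : Fintype.card {w // w ≠ w'} = 1 := by rw [hc, Fintype.card_fin, hr]
  obtain ⟨w₀, hw₀⟩ := Fintype.card_eq_one_iff.mp hc1
  have : Unique {w // w ≠ w'} := ⟨⟨w₀⟩, hw₀⟩
  have hreg := Units.regOfFamily_eq_det (fun _ => ε) w' e
  rw [Matrix.det_unique] at hreg
  simp only [Matrix.of_apply] at hreg
  set w := (default : {w // w ≠ w'}).1
  have hmult : (w.mult : ℝ) ≤ 2 := by
    rw [InfinitePlace.mult]
    split_ifs <;> norm_num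
  have hmult' : (w.mult : ℝ) ≠ 0 := by exact_mod_cast InfinitePlace.mult_ne_zero
  have hR := Units.regulator_pos K
  have hreg_le : Units.regOfFamily (fun _ => ε) ≤ 2 * Real.log B := by
    rw [hreg, abs_mul, Nat.abs_cast]
    exact mul_le_mul hmult (hlog w) (abs_nonneg _) zero_le_two
  have hreg_ne : Units.regOfFamily (fun _ : Fin (Units.rank K) => ε) ≠ 0 := by
    rw [hreg]
    exact abs_ne_zero.mpr (mul_ne_zero hmult' (hne w))
  have hidx := Units.regOfFamily_div_regulator (fun _ : Fin (Units.rank K) => ε)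
  rw [div_eq_iff hR.ne'] at hidx
  have hidx_ne : (Subgroup.closure (Set.range fun _ : Fin (Units.rank K) => ε) ⊔
      Units.torsion K).index ≠ 0 := by
    intro h0
    rw [h0, Nat.cast_zero, zero_mul] at hidx
    exact hreg_ne hidx
  refine le_trans ?_ hreg_le
  rw [hidx]
  exact le_mul_of_one_le_left hR.le (by exact_mod_cast Nat.one_le_iff_ne_zero.mpr hidx_ne)

end QuadraticField

section Setup
variable {K : Type*} [Field K] [NumberField K] {y : K} {d : ℕ}

lemma minpoly_eq_of_sq_eq (hd : ¬ IsSquare d) {L : Type*} [Field L] [Algebra ℚ L] {y : L}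
    (hy : y ^ 2 = d) : minpoly ℚ y = X ^ 2 - C (d : ℚ) := by
  refine (minpoly.eq_of_irreducible_of_monic ?_ (by simp [hy]) (monic_X_pow_sub_C _ two_ne_zero)).symm
  refine X_pow_sub_C_irreducible_of_prime Nat.prime_two fun b hb => hd ?_
  rw [← Rat.isSquare_natCast_iff]
  exact ⟨b, by rw [← hb, sq]⟩

lemma trace_eq_zero_of_sq_eq (hd : ¬ IsSquare d) (hy : y ^ 2 = d) : Algebra.trace ℚ K y = 0 := by
  rw [trace_eq_finrank_mul_minpoly_nextCoeff, minpoly_eq_of_sq_eq hd hy,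
    nextCoeff_of_natDegree_pos (by rw [natDegree_X_pow_sub_C]; norm_num), natDegree_X_pow_sub_C]
  simp

lemma exists_half_one_add {n : ℕ} (hd : ¬ IsSquare (4 * n ^ 2 + 1))
    (hy : y ^ 2 = ((4 * n ^ 2 + 1 : ℕ) : K)) (hrank : Module.finrank ℚ K = 2) :
    ∃ ω : 𝓞 K, ω ^ 2 = ω + (n : 𝓞 K) ^ 2 ∧ Algebra.trace ℤ (𝓞 K) ω = 1 := by
  have h1 : ((1 + y) / 2) ^ 2 = (1 + y) / 2 + (n : K) ^ 2 := by
    push_cast at hy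
    linear_combination hy / 4
  have h_int : IsIntegral ℤ ((1 + y) / 2) := by
    refine ⟨X ^ 2 - (X + C ((n : ℤ) ^ 2)), monic_X_pow_sub ?_, ?_⟩
    · rw [degree_X_add_C]
      norm_num
    · simp [h1, eval₂_pow]
  obtain ⟨ω, hω⟩ : ∃ ω : 𝓞 K, algebraMap (𝓞 K) K ω = (1 + y) / 2 := ⟨⟨_, h_int⟩, rfl⟩
  refine ⟨ω, RingOfIntegers.coe_injective (by simpa [hω] using h1), ?_⟩
  have h2 : (Algebra.trace ℤ (𝓞 K) ω : ℚ) = Algebra.trace ℚ K (algebraMap (𝓞 K) K ω) :=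
    Algebra.coe_trace_int _
  have h3 : (1 + y) / 2 = (1 / 2 : ℚ) • (1 + y) := by
    rw [Algebra.smul_def]
    simp
    ring
  have h4 : Algebra.trace ℚ K 1 = 2 := by
    have := Algebra.trace_algebraMap (S := K) (1 : ℚ)
    rw [hrank] at this
    simpa using this
  rw [hω, h3, map_smul, map_add, h4, trace_eq_zero_of_sq_eq hd hy] at h2
  norm_num at h2
  exact_mod_cast h2

lemma card_infinitePlace_eq_two (hrank : Module.finrank ℚ K = 2) (φ : K →+* ℝ) :
    Fintype.card (InfinitePlace K) = 2 ∧ InfinitePlace.nrRealPlaces K = 2 ∧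
      InfinitePlace.nrComplexPlaces K = 0 := by
  have h1 := InfinitePlace.card_add_two_mul_card_eq_rank K
  have h2 := InfinitePlace.card_eq_nrRealPlaces_add_nrComplexPlaces K
  have h3 : 0 < InfinitePlace.nrRealPlaces K := by
    have : Nonempty {w : InfinitePlace K // w.IsReal} :=
      ⟨⟨InfinitePlace.mk (Complex.ofRealHom.comp φ), InfinitePlace.isReal_mk_iff.mpr (by
        rw [ComplexEmbedding.isReal_iff]
        ext x
        simp [ComplexEmbedding.conjugate_coe_eq])⟩⟩
    classical
    rw [InfinitePlace.nrRealPlaces]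
    exact Fintype.card_pos
  rw [hrank] at h1
  omega

/-- The class number formula for `ℚ(√(4 n ^ 2 + 1))` as a lower bound for the class number. -/
lemma norm_jacobiL_mul_sqrt_le {n : ℕ} (hn : n ≠ 0) (hsq : Squarefree (4 * n ^ 2 + 1))
    (hy : y ^ 2 = ((4 * n ^ 2 + 1 : ℕ) : K)) (hrank : Module.finrank ℚ K = 2) (φ : K →+* ℝ) :
    ‖jacobiL (4 * n ^ 2 + 1) 1‖ * Real.sqrt (4 * n ^ 2 + 1) ≤
      8 * Real.log (2 * n + Real.sqrt (4 * n ^ 2 + 1)) * classNumber K := by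
  have hn2 : 0 < n ^ 2 := by positivity
  have hodd : Odd (4 * n ^ 2 + 1) := ⟨2 * n ^ 2, by ring⟩
  have hd := not_isSquare_of_squarefree hsq (by omega)
  obtain ⟨ω, hω, htr⟩ := exists_half_one_add hd hy hrank
  obtain ⟨hc, hr1, hr2⟩ := card_infinitePlace_eq_two hrank φ
  have hrank' : Module.finrank ℤ (𝓞 K) = 2 := by rw [RingOfIntegers.rank, hrank]
  have h1 := norm_jacobiL_one_le_residue (K := K) hodd hd
    (zeta_mul_jacobiArith_le_idealCount hω htr hrank' hsq)
  have hdisc := discr_eq_of_trace_eq_one hω htr hrank' hsq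
  have hreg := regulator_le hω hn hc
  have hw : (1 : ℝ) ≤ Units.torsionOrder K := by exact_mod_cast Units.torsionOrder_pos K
  have hsqrt : 0 < Real.sqrt (4 * n ^ 2 + 1) := Real.sqrt_pos.mpr (by positivity)
  rw [dedekindZeta_residue_def, hr1, hr2, hdisc, abs_of_pos (by positivity), pow_zero, mul_one,
    le_div_iff₀ (by push_cast; positivity)] at h1
  push_cast at h1
  calc _ ≤ ‖jacobiL (4 * n ^ 2 + 1) 1‖ * (Units.torsionOrder K * Real.sqrt (4 * n ^ 2 + 1)) := by
        gcongr
        exact le_mul_of_one_le_left hsqrt.le hw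
    _ ≤ _ := h1
    _ ≤ 2 ^ 2 * (2 * Real.log (2 * n + Real.sqrt (4 * n ^ 2 + 1))) * classNumber K := by gcongr
    _ = _ := by ring

end Setup

lemma exists_data_of_algEquiv {d : ℕ} (hd : ¬ IsSquare d) {x : ℝ} (hx : x ^ 2 = d) {K : Type*}
    [Field K] [NumberField K] (e : K ≃ₐ[ℚ] IntermediateField.adjoin ℚ {x}) :
    (∃ y : K, y ^ 2 = d) ∧ Module.finrank ℚ K = 2 ∧ Nonempty (K →+* ℝ) := by
  refine ⟨⟨e.symm (IntermediateField.AdjoinSimple.gen ℚ x), ?_⟩, ?_,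
    ⟨(IntermediateField.val _).toRingHom.comp e.toRingEquiv.toRingHom⟩⟩
  · rw [← map_pow, show (IntermediateField.AdjoinSimple.gen ℚ x) ^ 2 = d from
      Subtype.ext (by simpa using hx), map_natCast]
  · have hm := minpoly_eq_of_sq_eq hd hx
    have h_int : IsIntegral ℚ x := ⟨X ^ 2 - C (d : ℚ), monic_X_pow_sub_C _ two_ne_zero, by simp [hx]⟩
    rw [e.toLinearEquiv.finrank_eq, IntermediateField.adjoin.finrank h_int, hm,
      natDegree_X_pow_sub_C]

lemma squarefree_of_prime_or_mul {m : ℕ}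
    (h : m.Prime ∨ ∃ p q : ℕ, p.Prime ∧ q.Prime ∧ p ≠ q ∧ m = p * q) : Squarefree m := by
  rcases h with h | ⟨p, q, hp, hq, hpq, rfl⟩
  · exact h.prime.squarefree
  · exact (Nat.squarefree_mul ((Nat.coprime_primes hp hq).mpr hpq)).mpr
      ⟨hp.prime.squarefree, hq.prime.squarefree⟩

lemma exists_forall_log_lt {c : ℝ} (hc : 0 < c) :
    ∃ N : ℕ, ∀ d : ℕ, N < d → 16 * Real.log d < c * (d : ℝ) ^ (1 / 8 : ℝ) := by
  have h := (isLittleO_log_rpow_atTop (r := 1 / 8) (by norm_num)).def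
    (c := c / 32) (by positivity)
  obtain ⟨N, hN⟩ := eventually_atTop.mp (tendsto_natCast_atTop_atTop.eventually h)
  refine ⟨N, fun d hd => ?_⟩
  have hd0 : (0 : ℝ) < d := by exact_mod_cast (Nat.zero_le N).trans_lt hd
  have h1 := hN d hd.le
  have h2 : 0 < (d : ℝ) ^ (1 / 8 : ℝ) := by positivity
  rw [Real.norm_of_nonneg h2.le] at h1
  have h3 := (le_abs_self _).trans h1
  nlinarith

end SiegelBound

/-- There is `M : ℕ` such that for every `n > M` for which `4n²+1` is prime or a
product of two distinct primes, the class number `h` of the real quadratic field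
`ℚ(√(4n²+1))` (the subfield of `ℝ` generated over `ℚ` by `√(4n²+1)`) satisfies
`log h / log (4n²+1) > 1/4`. -/
theorem stmt_4 :
    ∃ M : ℕ, ∀ n : ℕ, M < n →
      (Nat.Prime (4 * n ^ 2 + 1) ∨
        ∃ p q : ℕ, p.Prime ∧ q.Prime ∧ p ≠ q ∧ 4 * n ^ 2 + 1 = p * q) →
      ∀ x : ℝ, x = Real.sqrt (4 * (n : ℝ) ^ 2 + 1) →
      ∀ (K : Type) [Field K] [NumberField K],
        Nonempty (K ≃ₐ[ℚ] (IntermediateField.adjoin ℚ {x})) →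
        (1 : ℝ) / 4 < Real.log (NumberField.classNumber K) /
            Real.log (4 * (n : ℝ) ^ 2 + 1) := by
  obtain ⟨c, hc, D₀, hsiegel⟩ := SiegelBound.siegel
  obtain ⟨N, hN⟩ := SiegelBound.exists_forall_log_lt hc
  refine ⟨max D₀ N, fun n hn hfac x hx K _ _ ⟨e⟩ => ?_⟩
  have hn0 : n ≠ 0 := (Nat.zero_le _).trans_lt hn |>.ne'
  have hn1 : (1 : ℝ) ≤ n := by exact_mod_cast Nat.one_le_iff_ne_zero.mpr hn0
  have hsq := SiegelBound.squarefree_of_prime_or_mul hfac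
  have hnd : n < 4 * n ^ 2 + 1 := by nlinarith
  have hn2 : 0 < n ^ 2 := by positivity
  have hodd : Odd (4 * n ^ 2 + 1) := ⟨2 * n ^ 2, by ring⟩
  obtain ⟨⟨y, hy⟩, hrank, ⟨φ⟩⟩ := SiegelBound.exists_data_of_algEquiv
    (SiegelBound.not_isSquare_of_squarefree hsq (by omega))
    (by rw [hx, Real.sq_sqrt (by positivity)]; push_cast; rfl) e
  have h1 := SiegelBound.norm_jacobiL_mul_sqrt_le hn0 hsq hy hrank φ
  have h2 := hsiegel _ ((le_max_left _ _).trans_lt hn |>.trans hnd) hodd hsq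
  have h3 := hN _ ((le_max_right _ _).trans_lt hn |>.trans hnd)
  push_cast at h2 h3
  set d : ℝ := 4 * (n : ℝ) ^ 2 + 1 with hd
  have hd4 : 4 < d := by nlinarith
  have hd0 : 0 < d := by linarith
  have hlogd : 0 < Real.log d := Real.log_pos (by linarith)
  have hlog : Real.log (2 * n + Real.sqrt d) ≤ 2 * Real.log d := by
    rw [← Real.log_rpow hd0, Real.rpow_two]
    have h4 : Real.sqrt d ≤ d := Real.sqrt_le_iff.mpr ⟨hd0.le, by nlinarith⟩
    exact Real.log_le_log (by positivity) (by nlinarith)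
  set h : ℝ := (NumberField.classNumber K : ℝ)
  have hh : 0 < h := Nat.cast_pos.mpr (NumberField.classNumber_pos K)
  have hkey : d ^ (1 / 4 : ℝ) < h := by
    have h5 : c * d ^ (3 / 8 : ℝ) ≤ 16 * Real.log d * h := by
      calc c * d ^ (3 / 8 : ℝ) ≤
            ‖SiegelBound.jacobiL (4 * n ^ 2 + 1) 1‖ * d ^ (1 / 8 : ℝ) * d ^ (3 / 8 : ℝ) := by gcongr
        _ = ‖SiegelBound.jacobiL (4 * n ^ 2 + 1) 1‖ * Real.sqrt d := by
          rw [mul_assoc, ← Real.rpow_add hd0, Real.sqrt_eq_rpow]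
          norm_num
        _ ≤ _ := h1
        _ ≤ 8 * (2 * Real.log d) * h := by gcongr
        _ = _ := by ring
    have h6 : d ^ (3 / 8 : ℝ) = d ^ (1 / 8 : ℝ) * d ^ (1 / 4 : ℝ) := by
      rw [← Real.rpow_add hd0]
      norm_num
    have h7 : 0 < d ^ (1 / 4 : ℝ) := by positivity
    refine lt_of_mul_lt_mul_left ?_ (by positivity : 0 ≤ 16 * Real.log d)
    calc _ < c * d ^ (1 / 8 : ℝ) * d ^ (1 / 4 : ℝ) := by gcongr
      _ ≤ _ := by rwa [mul_assoc, ← h6]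
  rw [lt_div_iff₀ hlogd, ← Real.log_rpow hd0]
  exact Real.log_lt_log (by positivity) hkey
end

section
/- For every constant C there exists a natural number M such that for every natural number n > M for which 4n^2 + 1 is either prime or a product of two distinct primes, the class number of the real quadratic field ℚ(√(4n^2+1)) is greater than C. In other words, the class number h_n tends to infinity as n → ∞ along such n. -/
section

open Complex Filter Topology Metric Finset

/-- Real-variable core of Estermann's argument. -/
theorem pow_le_mul_pow_of_hasSum_taylor {β : ℕ → ℝ} {l M t g : ℝ} {m : ℕ} (hβ : ∀ k, 0 ≤ β k)
    (hβ0 : 1 ≤ β 0) (hl : 0 ≤ l) (hM : 1 ≤ M) (hβM : ∀ k, |β k - l| ≤ M * (2 / 3) ^ k)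
    (ht : 1 < t) (ht' : t ≤ 9 / 8) (htm : t ^ m ≤ 4 / 3)
    (hg : HasSum (fun k ↦ (β k - l) * t ^ k) g) (hgl : g ≤ l / (t - 1)) :
    ((t - 1) / 2) ^ m ≤ 11 * M * l ^ m := by
  obtain ⟨n, hn1, hn2⟩ := exists_nat_pow_near (x := 8 * M) (y := (4 / 3 : ℝ)) (by linarith)
    (by norm_num)
  have ht1 : 0 < t - 1 := by linarith
  have hsplit := hg.summable.sum_add_tsum_nat_add (n + 1)
  rw [hg.tsum_eq] at hsplit
  have hhead : 1 - l * ((t ^ (n + 1) - 1) / (t - 1)) ≤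
      ∑ k ∈ range (n + 1), (β k - l) * t ^ k := by
    have h1 : ∑ k ∈ range (n + 1), (β k - l) * t ^ k =
        ∑ k ∈ range (n + 1), β k * t ^ k - l * ∑ k ∈ range (n + 1), t ^ k := by
      rw [mul_sum, ← sum_sub_distrib]
      exact sum_congr rfl fun k _ ↦ by ring
    rw [h1, geom_sum_eq ht.ne']
    gcongr
    calc 1 ≤ β 0 * t ^ 0 := by simpa
      _ ≤ _ := single_le_sum (f := fun k ↦ β k * t ^ k)
          (fun k _ ↦ mul_nonneg (hβ k) (by positivity)) (by simp)
  have hgeo : HasSum (fun k ↦ M * (3 / 4 : ℝ) ^ (k + (n + 1))) (M * (3 / 4) ^ (n + 1) * 4) := by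
    have h := (hasSum_geometric_of_lt_one (r := (3 / 4 : ℝ)) (by norm_num) (by norm_num)).mul_left
      (M * (3 / 4) ^ (n + 1))
    rw [show ((1 : ℝ) - 3 / 4)⁻¹ = 4 by norm_num] at h
    refine h.congr_fun fun k ↦ ?_
    rw [pow_add]
    ring
  have htail : -(M * (3 / 4) ^ (n + 1) * 4) ≤
      ∑' k, (β (k + (n + 1)) - l) * t ^ (k + (n + 1)) := by
    have key := Summable.tsum_le_tsum (f := fun k ↦ -(M * (3 / 4 : ℝ) ^ (k + (n + 1))))
      (g := fun k ↦ (β (k + (n + 1)) - l) * t ^ (k + (n + 1))) (fun k ↦ ?_) hgeo.summable.neg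
      ((summable_nat_add_iff (f := fun k ↦ (β k - l) * t ^ k) (n + 1)).mpr hg.summable)
    · rwa [tsum_neg, hgeo.tsum_eq] at key
    set j := k + (n + 1)
    have h2 : |(β j - l) * t ^ j| ≤ M * (3 / 4) ^ j := by
      rw [abs_mul, abs_of_nonneg (by positivity : 0 ≤ t ^ j)]
      calc |β j - l| * t ^ j ≤ M * (2 / 3) ^ j * (9 / 8) ^ j := by
            gcongr
            exact hβM j
        _ = M * (3 / 4) ^ j := by rw [mul_assoc, ← mul_pow]; norm_num
    exact (abs_le.mp h2).1
  have hpow : M * (3 / 4) ^ (n + 1) * 4 ≤ 1 / 2 := by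
    have h3 : (3 / 4 : ℝ) ^ (n + 1) * (4 / 3) ^ (n + 1) = 1 := by
      rw [← mul_pow]; norm_num
    have h4 : 0 < (3 / 4 : ℝ) ^ (n + 1) := by positivity
    nlinarith
  have hfin : (t - 1) / 2 ≤ l * t ^ (n + 1) := by
    have h5 : 1 / 2 - l * ((t ^ (n + 1) - 1) / (t - 1)) ≤ l / (t - 1) := by linarith
    have h6 : l * ((t ^ (n + 1) - 1) / (t - 1)) + l / (t - 1) = l * t ^ (n + 1) / (t - 1) := by
      field_simp
      ring
    have h7 : 1 / 2 ≤ l * t ^ (n + 1) / (t - 1) := by linarith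
    rw [le_div_iff₀ ht1] at h7
    linarith
  calc ((t - 1) / 2) ^ m ≤ (l * t ^ (n + 1)) ^ m := by gcongr
    _ = (t ^ m) ^ (n + 1) * l ^ m := by rw [mul_pow]; ring
    _ ≤ (4 / 3) ^ (n + 1) * l ^ m := by gcongr
    _ ≤ 11 * M * l ^ m := by
      gcongr
      rw [pow_succ]
      linarith

open scoped ComplexOrder Nat

theorem iteratedDeriv_dslope_of_eq_mul_LSeries {a : ℕ → ℂ}
    (hs : LSeries.abscissaOfAbsConv a ≤ 1) {P : ℂ → ℂ}
    (hPa : ∀ s : ℂ, 1 < s.re → P s = (s - 1) * LSeries a s) (k : ℕ) :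
    iteratedDeriv k (dslope P 1) 2 = iteratedDeriv k (LSeries a) 2 - P 1 * ((-1) ^ k * k !) := by
  have hopen : IsOpen {s : ℂ | 1 < s.re} := isOpen_lt continuous_const continuous_re
  have h2 : (2 : ℂ) ∈ {s : ℂ | 1 < s.re} := by simp
  have heq : dslope P 1 =ᶠ[𝓝 2] fun s ↦ LSeries a s - P 1 * (1 * s - 1)⁻¹ := by
    filter_upwards [hopen.mem_nhds h2] with s hs
    have hs1 : s ≠ 1 := by
      rintro rfl
      simp at hs
    have : s - 1 ≠ 0 := sub_ne_zero.mpr hs1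
    rw [dslope_of_ne _ hs1, slope_def_field, hPa s hs]
    field_simp
  have hLa : AnalyticAt ℂ (LSeries a) 2 := LSeries_analyticOnNhd a 2 <| by
    have h12 : (1 : EReal) < (2 : ℝ) := by exact_mod_cast (one_lt_two : (1 : ℝ) < 2)
    exact hs.trans_lt h12
  have hinv : AnalyticAt ℂ (fun s : ℂ ↦ (1 * s - 1)⁻¹) 2 := by
    refine AnalyticAt.inv (by fun_prop) (by norm_num)
  rw [heq.iteratedDeriv_eq, iteratedDeriv_fun_sub hLa.contDiffAt
    (contDiffAt_const.mul hinv.contDiffAt), iteratedDeriv_const_mul_field]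
  congr 2
  rw [iteratedDeriv_eq_iterate, iter_deriv_inv_linear_sub]
  norm_num

theorem norm_dslope_le_of_norm_le {P : ℂ → ℂ} {B : ℝ}
    (hB : ∀ s ∈ closedBall (2 : ℂ) (3 / 2), ‖P s‖ ≤ B) {s : ℂ} (hs : s ∈ sphere (2 : ℂ) (3 / 2)) :
    ‖dslope P 1 s‖ ≤ 4 * B := by
  have h1 : ‖P 1‖ ≤ B := hB 1 (by simp [dist_eq_norm]; norm_num)
  have hd : 1 / 2 ≤ ‖s - 1‖ := by
    have := norm_sub_norm_le (s - 2) (-1)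
    rw [mem_sphere, dist_eq_norm] at hs
    rw [hs, norm_neg, norm_one] at this
    calc (1 / 2 : ℝ) = 3 / 2 - 1 := by norm_num
      _ ≤ _ := this
      _ = ‖s - 1‖ := by ring_nf
  have hs1 : s ≠ 1 := by
    rintro rfl
    norm_num at hd
  rw [dslope_of_ne _ hs1, slope_def_field, norm_div, div_le_iff₀ (by linarith)]
  have h0 : 0 ≤ B := (norm_nonneg _).trans h1
  calc ‖P s - P 1‖ ≤ ‖P s‖ + ‖P 1‖ := norm_sub_le _ _
    _ ≤ B + B := add_le_add (hB s (sphere_subset_closedBall hs)) h1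
    _ ≤ 4 * B * ‖s - 1‖ := by nlinarith

/-- Estermann's lemma. -/
theorem estermann {a : ℕ → ℂ} (ha : 0 ≤ a) (ha1 : 1 ≤ a 1)
    (hs : LSeries.abscissaOfAbsConv a ≤ 1) {P : ℂ → ℂ} (hP : Differentiable ℂ P)
    (hPa : ∀ s : ℂ, 1 < s.re → P s = (s - 1) * LSeries a s) {B : ℝ} (hB1 : 1 ≤ B)
    (hB : ∀ s ∈ closedBall (2 : ℂ) (3 / 2), ‖P s‖ ≤ B) :
    0 ≤ P 1 ∧ ∀ x : ℝ, 7 / 8 ≤ x → x < 1 → (P x).im = 0 ∧ ∀ m : ℕ, (2 - x) ^ m ≤ 4 / 3 →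
      0 ≤ (P x).re → ((1 - x) / 2) ^ m ≤ 44 * B * ‖P 1‖ ^ m := by
  have hG : Differentiable ℂ (dslope P 1) := by
    rw [← differentiableOn_univ] at hP ⊢
    exact (differentiableOn_dslope (by simp)).mpr hP
  set b : ℕ → ℂ := fun k ↦ (-1) ^ k * iteratedDeriv k (LSeries a) 2 / k ! with hb
  have hb0 : ∀ k, 0 ≤ b k := fun k ↦ by
    have hlt : LSeries.abscissaOfAbsConv a < (2 : ℝ) := hs.trans_lt (by exact_mod_cast one_lt_two (α := ℝ))
    have := LSeries.iteratedDeriv_alternating ha (x := 2) hlt k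
    have h2 : (0 : ℂ) ≤ ((k ! : ℝ) : ℂ)⁻¹ := by
      rw [← ofReal_inv]
      exact_mod_cast (by positivity : (0 : ℝ) ≤ (k ! : ℝ)⁻¹)
    simpa [hb, div_eq_mul_inv] using mul_nonneg this h2
  have hGb : ∀ k, (-1) ^ k * iteratedDeriv k (dslope P 1) 2 / k ! = b k - P 1 := fun k ↦ by
    have hk : (k ! : ℂ) ≠ 0 := by exact_mod_cast k.factorial_ne_zero
    have h1 : ((-1 : ℂ) ^ k) * (-1) ^ k = 1 := by rw [← mul_pow]; norm_num
    rw [iteratedDeriv_dslope_of_eq_mul_LSeries hs hPa, hb]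
    field_simp
    linear_combination (-P 1 * (k ! : ℂ)) * h1
  have hbound : ∀ k, ‖b k - P 1‖ ≤ 4 * B * (2 / 3) ^ k := fun k ↦ by
    have := norm_iteratedDeriv_le_of_forall_mem_sphere_norm_le (c := 2) k
      (by norm_num : (0 : ℝ) < 3 / 2) hG.diffContOnCl fun z hz ↦ norm_dslope_le_of_norm_le hB hz
    rw [← hGb, norm_div, norm_mul, norm_pow, norm_neg, norm_one, one_pow, one_mul,
      Complex.norm_natCast, div_le_iff₀ (by positivity)]
    refine this.trans_eq ?_
    rw [div_eq_mul_inv, ← inv_pow]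
    norm_num
    ring
  have hlim : Tendsto b atTop (𝓝 (P 1)) := by
    rw [tendsto_iff_norm_sub_tendsto_zero]
    refine squeeze_zero (fun _ ↦ norm_nonneg _) hbound ?_
    simpa using (tendsto_pow_atTop_nhds_zero_of_lt_one (by norm_num : (0 : ℝ) ≤ 2 / 3)
      (by norm_num)).const_mul (4 * B)
  have hP1 : 0 ≤ P 1 := ge_of_tendsto' hlim hb0
  refine ⟨hP1, fun x hx hx1 ↦ ?_⟩
  obtain ⟨l, hl⟩ : ∃ l : ℝ, P 1 = l := ⟨(P 1).re, (eq_re_of_ofReal_le hP1)⟩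
  have hl0 : 0 ≤ l := by rw [hl] at hP1; exact_mod_cast hP1
  have hbr : ∀ k, b k = ((b k).re : ℂ) := fun k ↦ eq_re_of_ofReal_le (hb0 k)
  have hsum : HasSum (fun k ↦ ((((b k).re - l) * (2 - x) ^ k : ℝ) : ℂ)) (dslope P 1 x) := by
    have := hasSum_taylorSeries_of_entire hG 2 (x : ℂ)
    convert! this using 1
    ext k
    have h1 : (2 - (x : ℂ)) ^ k = (-1) ^ k * (x - 2) ^ k := by rw [← mul_pow]; ring
    push_cast
    rw [← hbr, ← hl, ← hGb, h1]
    have h2 : ((-1 : ℂ) ^ k) * (-1) ^ k = 1 := by rw [← mul_pow]; norm_num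
    simp only [smul_eq_mul]
    have hk : (k ! : ℂ) ≠ 0 := by exact_mod_cast k.factorial_ne_zero
    field_simp
    linear_combination (((x : ℂ) - 2) ^ k * iteratedDeriv k (dslope P 1) 2) * h2
  have hsre := hasSum_re hsum
  simp only [ofReal_re] at hsre
  have him : (dslope P 1 x).im = 0 := by
    have := hasSum_im hsum
    simp only [ofReal_im] at this
    exact this.unique hasSum_zero
  have hx1' : (x : ℂ) ≠ 1 := by exact_mod_cast hx1.ne
  have hPx : P x = (((dslope P 1 x).re * (x - 1) + l : ℝ) : ℂ) := by
    have h1 : dslope P 1 x = ((dslope P 1 x).re : ℂ) := by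
      apply Complex.ext <;> simp [him]
    push_cast
    rw [← h1, ← hl, dslope_of_ne _ hx1', slope_def_field]
    have : (x : ℂ) - 1 ≠ 0 := sub_ne_zero.mpr hx1'
    field_simp
    ring
  refine ⟨by rw [hPx, ofReal_im], fun m hm hre ↦ ?_⟩
  rw [hPx, ofReal_re] at hre
  have := pow_le_mul_pow_of_hasSum_taylor (m := m) (M := 4 * B) (l := l)
    (fun k ↦ (Complex.nonneg_iff.mp (hb0 k)).1)
    ?_ hl0 (by linarith) (fun k ↦ ?_) (by linarith : 1 < 2 - x) (by linarith) hm hsre ?_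
  · rw [hl, norm_real, Real.norm_of_nonneg hl0]
    convert! this using 1
    · ring
    · ring
  · have h0 : 1 ≤ b 0 := by
      simp only [hb, pow_zero, one_mul, iteratedDeriv_zero, Nat.factorial_zero, Nat.cast_one,
        div_one]
      have hsm : LSeriesSummable a 2 :=
        LSeriesSummable_of_abscissaOfAbsConv_lt_re (hs.trans_lt (by
          rw [re_ofNat]
          exact_mod_cast one_lt_two (α := ℝ)))
      refine ha1.trans ?_
      have := hsm.le_tsum 1 (fun j _ ↦ LSeries.term_nonneg (ha j) (2 : ℝ))
      simpa [LSeries, LSeries.term_def] using this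
    exact (Complex.le_def.mp h0).1
  · have := hbound k
    rw [hl, hbr, ← ofReal_sub, norm_real] at this
    exact this
  · rw [le_div_iff₀ (by linarith)]
    linarith

end

section

open Complex Filter Topology Metric Finset

theorem norm_natCast_cpow_neg_sub_le (n : ℕ) {s : ℂ} (hs : 0 < s.re) :
    ‖((n + 1 : ℕ) : ℂ) ^ (-s) - ((n + 2 : ℕ) : ℂ) ^ (-s)‖ ≤ ‖s‖ * ((n + 1 : ℕ) : ℝ) ^ (-s.re - 1) := by
  have hpos : (0 : ℝ) < (n + 1 : ℕ) := by positivity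
  have hs0 : -s ≠ 0 := by
    rintro h
    rw [neg_eq_zero] at h
    simp [h] at hs
  have := Convex.norm_image_sub_le_of_norm_hasDerivWithin_le (𝕜 := ℝ)
    (f := fun x : ℝ ↦ (x : ℂ) ^ (-s)) (f' := fun x : ℝ ↦ -s * (x : ℂ) ^ (-s - 1))
    (s := Set.Icc ((n + 1 : ℕ) : ℝ) ((n + 2 : ℕ) : ℝ)) (x := ((n + 2 : ℕ) : ℝ))
    (y := ((n + 1 : ℕ) : ℝ)) (C := ‖s‖ * ((n + 1 : ℕ) : ℝ) ^ (-s.re - 1))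
    (fun x hx ↦ (hasDerivAt_ofReal_cpow_const (hpos.trans_le hx.1).ne' hs0).hasDerivWithinAt)
    (fun x hx ↦ ?_) (convex_Icc _ _) ⟨by push_cast; linarith, le_rfl⟩
    ⟨le_rfl, by push_cast; linarith⟩
  · have h1 : |(1 : ℝ) - 2| = 1 := by norm_num
    simpa [h1] using this
  · have hx0 : 0 < x := hpos.trans_le hx.1
    rw [norm_mul, norm_neg, norm_cpow_eq_rpow_re_of_pos hx0]
    simp only [sub_re, neg_re, one_re]
    gcongr ‖s‖ * ?_
    exact Real.rpow_le_rpow_of_nonpos hpos hx.1 (by linarith)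

theorem summable_nat_succ_rpow {α : ℝ} (hα : α < -1) :
    Summable fun n : ℕ ↦ ((n + 1 : ℕ) : ℝ) ^ α :=
  (summable_nat_add_iff (f := fun n : ℕ ↦ (n : ℝ) ^ α) 1).mpr (Real.summable_nat_rpow.mpr hα)

namespace DirichletCharacter

variable {N : ℕ} (χ : DirichletCharacter ℂ N)

/-- The sum of the first `n` values `χ 1, …, χ n`. -/
noncomputable def partialSum (n : ℕ) : ℂ := ∑ k ∈ range n, χ ((k + 1 : ℕ) : ZMod N)

theorem norm_partialSum_le_self (n : ℕ) : ‖χ.partialSum n‖ ≤ n :=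
  (norm_sum_le_of_le _ fun _ _ ↦ χ.norm_le_one _).trans (by simp)

theorem sum_range_mul_cpow_eq (s : ℂ) (n : ℕ) :
    ∑ k ∈ range n, χ ((k + 1 : ℕ) : ZMod N) * ((k + 1 : ℕ) : ℂ) ^ (-s) =
      χ.partialSum n * ((n + 1 : ℕ) : ℂ) ^ (-s) + ∑ k ∈ range n, χ.partialSum (k + 1) *
        (((k + 1 : ℕ) : ℂ) ^ (-s) - ((k + 2 : ℕ) : ℂ) ^ (-s)) := by
  induction n with
  | zero => simp [partialSum]
  | succ n ih =>
    rw [sum_range_succ, ih, sum_range_succ _ n]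
    have : χ.partialSum (n + 1) = χ.partialSum n + χ ((n + 1 : ℕ) : ZMod N) := sum_range_succ _ _
    rw [this]
    ring

variable {χ}

theorem norm_abel_term_le {A α σ : ℝ} (hA : ∀ n : ℕ, ‖χ.partialSum (n + 1)‖ ≤ A * ((n + 1 : ℕ) : ℝ) ^ α)
    (hσ : 0 < σ) {s : ℂ} (hs : σ ≤ s.re) (n : ℕ) :
    ‖χ.partialSum (n + 1) * (((n + 1 : ℕ) : ℂ) ^ (-s) - ((n + 2 : ℕ) : ℂ) ^ (-s))‖ ≤
      A * ‖s‖ * ((n + 1 : ℕ) : ℝ) ^ (α - σ - 1) := by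
  have hpos : (0 : ℝ) < (n + 1 : ℕ) := by positivity
  have hA0 := (norm_nonneg _).trans (hA n)
  rw [norm_mul]
  calc _ ≤ (A * ((n + 1 : ℕ) : ℝ) ^ α) * (‖s‖ * ((n + 1 : ℕ) : ℝ) ^ (-s.re - 1)) := by
        gcongr
        · exact hA n
        · exact norm_natCast_cpow_neg_sub_le n (hσ.trans_le hs)
    _ ≤ (A * ((n + 1 : ℕ) : ℝ) ^ α) * (‖s‖ * ((n + 1 : ℕ) : ℝ) ^ (-σ - 1)) := by
        gcongr
        simp
    _ = A * ‖s‖ * (((n + 1 : ℕ) : ℝ) ^ α * ((n + 1 : ℕ) : ℝ) ^ (-σ - 1)) := by ring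
    _ = _ := by
        rw [← Real.rpow_add hpos]
        ring_nf

variable [NeZero N]

theorem partialSum_period (hχ : χ ≠ 1) : χ.partialSum N = 0 := by
  have h0 : ∑ a : ZMod N, χ (a + 1) = 0 := by
    rw [Fintype.sum_equiv (Equiv.addRight (1 : ZMod N)) (fun a ↦ χ (a + 1)) χ fun _ ↦ rfl]
    exact MulChar.sum_eq_zero_of_ne_one hχ
  rw [partialSum, ← h0]
  refine sum_bij (fun k _ ↦ (k : ZMod N)) (by simp) (fun a ha b hb hab ↦ ?_) (fun b _ ↦ ?_) (by simp)
  · rw [mem_range] at ha hb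
    rw [ZMod.natCast_eq_natCast_iff'] at hab
    rwa [Nat.mod_eq_of_lt ha, Nat.mod_eq_of_lt hb] at hab
  · exact ⟨b.val, mem_range.mpr b.val_lt, ZMod.natCast_zmod_val b⟩

theorem norm_partialSum_le_level (hχ : χ ≠ 1) (n : ℕ) : ‖χ.partialSum n‖ ≤ N := by
  have hper : Function.Periodic χ.partialSum N := fun n ↦ by
    rw [add_comm, partialSum, sum_range_add]
    have := partialSum_period hχ
    rw [partialSum] at this
    rw [this, zero_add, partialSum]
    exact sum_congr rfl fun k _ ↦ by push_cast; simp
  rw [← hper.map_mod_nat]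
  exact (χ.norm_partialSum_le_self _).trans (mod_cast (Nat.mod_lt _ (NeZero.pos N)).le)

theorem LFunction_eq_abel_of_one_lt_re (hχ : χ ≠ 1) {s : ℂ} (hs : 1 < s.re) :
    LFunction χ s = ∑' n : ℕ, χ.partialSum (n + 1) *
      (((n + 1 : ℕ) : ℂ) ^ (-s) - ((n + 2 : ℕ) : ℂ) ^ (-s)) := by
  rw [LFunction_eq_LSeries χ hs]
  have hsum := LSeriesSummable_of_bounded_of_one_lt_re (f := fun n : ℕ ↦ χ n) (m := 1)
    (fun n _ ↦ χ.norm_le_one _) hs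
  have h1 := hsum.hasSum
  rw [← hasSum_nat_add_iff' 1] at h1
  simp only [range_one, sum_singleton, LSeries.term_zero, sub_zero] at h1
  have h2 := h1.tendsto_sum_nat
  have h3 : ∀ n : ℕ, ∑ k ∈ range n, LSeries.term (fun n : ℕ ↦ χ n) s (k + 1) =
      ∑ k ∈ range n, χ ((k + 1 : ℕ) : ZMod N) * ((k + 1 : ℕ) : ℂ) ^ (-s) := fun n ↦
    sum_congr rfl fun k _ ↦ by rw [LSeries.term_of_ne_zero k.succ_ne_zero, div_eq_mul_inv, cpow_neg]
  simp_rw [h3, sum_range_mul_cpow_eq] at h2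
  have hT : Tendsto (fun n : ℕ ↦ χ.partialSum n * ((n + 1 : ℕ) : ℂ) ^ (-s)) atTop (𝓝 0) := by
    rw [tendsto_zero_iff_norm_tendsto_zero]
    have hz : Tendsto (fun n : ℕ ↦ (N : ℝ) * ((n + 1 : ℕ) : ℝ) ^ (-s.re)) atTop (𝓝 0) := by
      have := ((tendsto_rpow_neg_atTop (by linarith : 0 < s.re)).comp
        (tendsto_natCast_atTop_atTop (R := ℝ))).comp (tendsto_add_atTop_nat 1)
      simpa using this.const_mul (N : ℝ)
    refine squeeze_zero (fun _ ↦ norm_nonneg _) (fun n ↦ ?_) hz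
    rw [norm_mul, norm_natCast_cpow_of_pos n.succ_pos, neg_re]
    gcongr
    exact norm_partialSum_le_level hχ n
  have hs2 : Summable fun n : ℕ ↦ χ.partialSum (n + 1) *
      (((n + 1 : ℕ) : ℂ) ^ (-s) - ((n + 2 : ℕ) : ℂ) ^ (-s)) := by
    refine Summable.of_norm_bounded ?_ (norm_abel_term_le (χ := χ) (A := N) (α := 0) (σ := 1)
      (fun n ↦ by simpa using norm_partialSum_le_level hχ (n + 1)) one_pos hs.le)
    exact (summable_nat_succ_rpow (by norm_num)).mul_left _
  have h4 := hT.add hs2.hasSum.tendsto_sum_nat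
  rw [zero_add] at h4
  exact tendsto_nhds_unique h2 h4

theorem LFunction_eq_abel (hχ : χ ≠ 1) {s : ℂ} (hs : 0 < s.re) :
    LFunction χ s = ∑' n : ℕ, χ.partialSum (n + 1) *
      (((n + 1 : ℕ) : ℂ) ^ (-s) - ((n + 2 : ℕ) : ℂ) ^ (-s)) := by
  set δ := min s.re 1 / 2 with hδ
  have hδ0 : 0 < δ := by positivity
  set R := ‖s‖ + 3 with hR
  set U : Set ℂ := {z | δ < z.re} ∩ ball 0 R with hU
  have hUo : IsOpen U := (isOpen_lt continuous_const continuous_re).inter isOpen_ball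
  have hUc : IsPreconnected U := ((convex_halfSpace_re_gt δ).inter (convex_ball 0 R)).isPreconnected
  have h2U : (2 : ℂ) ∈ U := by
    refine ⟨?_, ?_⟩
    · have := min_le_right s.re 1
      simp only [Set.mem_ofPred_eq, re_ofNat]
      linarith
    · rw [mem_ball_zero_iff, Complex.norm_ofNat]
      linarith [norm_nonneg s]
  have hsU : s ∈ U := by
    refine ⟨?_, ?_⟩
    · have := min_le_left s.re 1
      simp only [Set.mem_ofPred_eq]
      linarith
    · rw [mem_ball_zero_iff]
      linarith [norm_nonneg s]
  have hH : DifferentiableOn ℂ (fun z ↦ ∑' n : ℕ, χ.partialSum (n + 1) *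
      (((n + 1 : ℕ) : ℂ) ^ (-z) - ((n + 2 : ℕ) : ℂ) ^ (-z))) U := by
    refine differentiableOn_tsum_of_summable_norm
      (u := fun n ↦ N * R * ((n + 1 : ℕ) : ℝ) ^ (0 - δ - 1))
      ((summable_nat_succ_rpow (by linarith)).mul_left _) (fun n z _ ↦ ?_) hUo fun n z hz ↦ ?_
    · have h1 : ((n + 1 : ℕ) : ℂ) ≠ 0 := by exact_mod_cast n.succ_ne_zero
      have h2 : ((n + 2 : ℕ) : ℂ) ≠ 0 := by exact_mod_cast (n + 1).succ_ne_zero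
      refine DifferentiableAt.differentiableWithinAt ?_
      exact (((differentiableAt_id.neg).const_cpow (Or.inl h1)).sub
        ((differentiableAt_id.neg).const_cpow (Or.inl h2))).const_mul _
    · refine (norm_abel_term_le (χ := χ) (A := N) (α := 0) (σ := δ)
        (fun n ↦ by simpa using norm_partialSum_le_level hχ (n + 1)) hδ0 (le_of_lt hz.1) n).trans ?_
      have := (mem_ball_zero_iff.mp hz.2).le
      gcongr
  refine AnalyticOnNhd.eqOn_of_preconnected_of_eventuallyEq (𝕜 := ℂ)
    ((differentiable_LFunction hχ).differentiableOn.analyticOnNhd hUo) (hH.analyticOnNhd hUo) hUc h2U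
    ?_ hsU
  filter_upwards [(isOpen_lt continuous_const continuous_re).mem_nhds
    (show (2 : ℂ) ∈ {z : ℂ | (1 : ℝ) < z.re} by simp)] with z hz
  exact LFunction_eq_abel_of_one_lt_re hχ hz

theorem norm_LFunction_le {A α σ : ℝ} (hχ : χ ≠ 1)
    (hA : ∀ n : ℕ, ‖χ.partialSum (n + 1)‖ ≤ A * ((n + 1 : ℕ) : ℝ) ^ α) (hσ : 0 < σ) (hασ : α < σ)
    {s : ℂ} (hs : σ ≤ s.re) :
    ‖LFunction χ s‖ ≤ A * ‖s‖ * ∑' n : ℕ, ((n + 1 : ℕ) : ℝ) ^ (α - σ - 1) := by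
  rw [LFunction_eq_abel hχ (hσ.trans_le hs), ← tsum_mul_left]
  exact tsum_of_norm_bounded ((summable_nat_succ_rpow (by linarith)).mul_left _).hasSum
    (norm_abel_term_le hA hσ hs)

/-- Bounds for `L(s, χ)` on a disc around `2` and at `1`, uniform in `χ`. -/
theorem exists_norm_LFunction_le : ∃ c : ℝ, 1 ≤ c ∧ ∀ {N : ℕ} [NeZero N]
    {χ : DirichletCharacter ℂ N}, χ ≠ 1 →
      (∀ s ∈ closedBall (2 : ℂ) (3 / 2), ‖LFunction χ s‖ ≤ c * N) ∧
      ‖LFunction χ 1‖ ≤ c * (N : ℝ) ^ (1 / 8 : ℝ) := by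
  set c₁ := ∑' n : ℕ, ((n + 1 : ℕ) : ℝ) ^ ((0 : ℝ) - 1 / 2 - 1) with hc₁
  set c₂ := ∑' n : ℕ, ((n + 1 : ℕ) : ℝ) ^ ((7 / 8 : ℝ) - 1 - 1) with hc₂
  have hc₁0 : 0 ≤ c₁ := tsum_nonneg fun n ↦ by positivity
  have hc₂0 : 0 ≤ c₂ := tsum_nonneg fun n ↦ by positivity
  refine ⟨4 * c₁ + c₂ + 1, by linarith, fun {N} _ χ hχ ↦ ⟨fun s hs ↦ ?_, ?_⟩⟩
  · rw [mem_closedBall, dist_eq_norm] at hs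
    have hre : 1 / 2 ≤ s.re := by
      have := (abs_re_le_norm (s - 2)).trans hs
      rw [sub_re, re_ofNat, abs_le] at this
      linarith [this.1]
    have hn : ‖s‖ ≤ 4 := by
      have := norm_sub_norm_le s 2
      rw [Complex.norm_ofNat] at this
      linarith
    calc ‖LFunction χ s‖ ≤ N * ‖s‖ * c₁ := norm_LFunction_le (α := 0) hχ
          (fun n ↦ by simpa using norm_partialSum_le_level hχ (n + 1)) (by norm_num) (by norm_num) hre
      _ ≤ N * 4 * c₁ := by gcongr
      _ = (4 * c₁) * N := by ring
      _ ≤ _ := by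
        gcongr
        linarith
  · calc ‖LFunction χ 1‖ ≤ (N : ℝ) ^ (1 / 8 : ℝ) * ‖(1 : ℂ)‖ * c₂ := norm_LFunction_le hχ
          (fun n ↦ ?_) (by norm_num) (by norm_num) (by simp)
      _ = c₂ * (N : ℝ) ^ (1 / 8 : ℝ) := by rw [norm_one]; ring
      _ ≤ _ := by
        gcongr
        linarith
    have h1 := χ.norm_partialSum_le_self (n + 1)
    have h2 := norm_partialSum_le_level hχ (n + 1)
    set x := ‖χ.partialSum (n + 1)‖
    have hx : 0 ≤ x := norm_nonneg _
    calc x = x ^ (1 / 8 : ℝ) * x ^ (7 / 8 : ℝ) := by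
          rw [← Real.rpow_add_of_nonneg hx (by norm_num) (by norm_num)]
          norm_num
      _ ≤ _ := by gcongr

end DirichletCharacter

end

section

open Complex Filter Topology Metric Finset
open scoped ComplexOrder Nat

namespace ArithmeticFunction

theorem mul_apply_prime_pow {R : Type*} [Semiring R] (f g : ArithmeticFunction R) {p : ℕ}
    (hp : p.Prime) (k : ℕ) :
    (f * g) (p ^ k) = ∑ i ∈ range (k + 1), f (p ^ i) * g (p ^ (k - i)) := by
  rw [mul_apply, Nat.sum_divisorsAntidiagonal (f := fun a b ↦ f a * g b),
    Nat.sum_divisors_prime_pow hp]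
  refine sum_congr rfl fun i hi ↦ ?_
  rw [Nat.pow_div (Nat.lt_succ_iff.mp (mem_range.mp hi)) hp.pos]

theorem mul_apply_prime_pow_nonneg {f g : ArithmeticFunction ℂ} {p : ℕ} (hp : p.Prime)
    (hf : ∀ k, 0 ≤ f (p ^ k)) (hg : ∀ k, 0 ≤ g (p ^ k)) (k : ℕ) : 0 ≤ (f * g) (p ^ k) := by
  rw [mul_apply_prime_pow f g hp]
  exact sum_nonneg fun i _ ↦ mul_nonneg (hf _) (hg _)

end ArithmeticFunction

namespace DirichletCharacter

variable {N N₁ N₂ N₃ : ℕ}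

/-- A Dirichlet character as an arithmetic function. -/
noncomputable abbrev arith (χ : DirichletCharacter ℂ N) : ArithmeticFunction ℂ :=
  toArithmeticFunction (χ ·)

theorem arith_prime_pow (χ : DirichletCharacter ℂ N) {p : ℕ} (hp : p.Prime) (k : ℕ) :
    χ.arith (p ^ k) = χ p ^ k := by
  rw [arith, ← apply_eq_toArithmeticFunction_apply χ (pow_ne_zero k hp.ne_zero)]
  simp

theorem arith_mul_arith_prime_pow {χ : DirichletCharacter ℂ N₁} {ψ : DirichletCharacter ℂ N₂}
    {p : ℕ} (hp : p.Prime) {y : ℂ} (hy : ψ p = χ p * y) (k : ℕ) :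
    (χ.arith * ψ.arith) (p ^ k) = χ p ^ k * ∑ j ∈ range (k + 1), y ^ j := by
  rw [mul_comm, ArithmeticFunction.mul_apply_prime_pow _ _ hp, mul_sum]
  refine sum_congr rfl fun i hi ↦ ?_
  rw [arith_prime_pow _ hp, arith_prime_pow _ hp, hy, mul_pow, mul_right_comm, ← pow_add,
    Nat.add_sub_cancel' (Nat.lt_succ_iff.mp (mem_range.mp hi))]

theorem zetaMul_mul_nonneg {χ₁ : DirichletCharacter ℂ N₁} {χ₂ : DirichletCharacter ℂ N₂}
    {χ₃ : DirichletCharacter ℂ N₃} (h₁ : χ₁ ^ 2 = 1) (h₂ : χ₂ ^ 2 = 1)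
    (h₃ : ∀ p : ℕ, p.Prime → χ₃ p = χ₁ p * χ₂ p) :
    0 ≤ ⇑(χ₁.zetaMul * (χ₂.arith * χ₃.arith)) := by
  have hmul : (χ₁.zetaMul * (χ₂.arith * χ₃.arith)).IsMultiplicative :=
    χ₁.isMultiplicative_zetaMul.mul <|
      (isMultiplicative_toArithmeticFunction χ₂).mul (isMultiplicative_toArithmeticFunction χ₃)
  have hgeom : ∀ {y : ℂ}, y = 0 ∨ y = 1 ∨ y = -1 → ∀ k, 0 ≤ ∑ j ∈ range (k + 1), y ^ j := by
    rintro y (rfl | rfl | rfl) k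
    · exact sum_nonneg fun j _ ↦ pow_nonneg le_rfl j
    · exact sum_nonneg fun j _ ↦ pow_nonneg zero_le_one j
    · rw [neg_one_geom_sum]
      split_ifs
      exacts [le_rfl, zero_le_one]
  have hpp : ∀ {p : ℕ}, p.Prime → ∀ k, 0 ≤ (χ₁.zetaMul * (χ₂.arith * χ₃.arith)) (p ^ k) := by
    intro p hp k
    have hχ₁ := MulChar.isQuadratic_iff_sq_eq_one.mpr h₁ p
    have hχ₂ := MulChar.isQuadratic_iff_sq_eq_one.mpr h₂ p
    by_cases ha : 0 ≤ χ₁ p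
    · have hswap : χ₁.zetaMul * (χ₂.arith * χ₃.arith) =
          χ₂.zetaMul * (χ₁.arith * χ₃.arith) := by
        rw [zetaMul, zetaMul]
        ring
      rw [hswap]
      refine ArithmeticFunction.mul_apply_prime_pow_nonneg hp (zetaMul_prime_pow_nonneg h₂ hp)
        (fun k ↦ ?_) k
      rw [arith_mul_arith_prime_pow hp (h₃ p hp)]
      exact mul_nonneg (pow_nonneg ha k) (hgeom hχ₂ k)
    · have ha' : χ₁ p = -1 := by
        rcases hχ₁ with h | h | h
        · exact absurd h.ge ha
        · exact absurd (h ▸ zero_le_one) ha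
        · exact h
      refine ArithmeticFunction.mul_apply_prime_pow_nonneg hp (zetaMul_prime_pow_nonneg h₁ hp)
        (fun k ↦ ?_) k
      rw [arith_mul_arith_prime_pow hp ((h₃ p hp).trans (mul_comm _ _)), ha', neg_one_geom_sum]
      split_ifs with hk
      · rw [mul_zero]
      · have hk' : _root_.Even k := by
          rw [Nat.even_add_one, not_not] at hk
          exact hk
        rw [mul_one]
        rcases hχ₂ with h | h | h
        · rw [h]; exact pow_nonneg le_rfl k
        · rw [h]; exact pow_nonneg zero_le_one k
        · rw [h, hk'.neg_one_pow]; exact zero_le_one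
  intro n
  rcases eq_or_ne n 0 with rfl | hn
  · simp
  · simp only [Pi.zero_apply]
    rw [hmul.multiplicative_factorization _ hn]
    exact prod_nonneg fun p hp ↦ hpp (Nat.prime_of_mem_primeFactors hp) _

variable [NeZero N] [NeZero N₁] [NeZero N₂] [NeZero N₃]

theorem LSeriesSummable_arith (χ : DirichletCharacter ℂ N) {s : ℂ} (hs : 1 < s.re) :
    LSeriesSummable χ.arith s :=
  (LSeriesSummable_congr _ fun h ↦ (χ.apply_eq_toArithmeticFunction_apply h).symm).mpr <|
    ZMod.LSeriesSummable_of_one_lt_re χ hs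

theorem LSeries_arith (χ : DirichletCharacter ℂ N) {s : ℂ} (hs : 1 < s.re) :
    LSeries χ.arith s = LFunction χ s := by
  rw [LFunction_eq_LSeries χ hs]
  exact (LSeries_congr (χ.apply_eq_toArithmeticFunction_apply) s).symm

theorem LSeries_zetaMul (χ : DirichletCharacter ℂ N) {s : ℂ} (hs : 1 < s.re) :
    LSeries χ.zetaMul s = riemannZeta s * LFunction χ s := by
  rw [← LSeries_arith χ hs, ← ArithmeticFunction.LSeries_zeta_eq_riemannZeta hs, zetaMul,
    ArithmeticFunction.LSeries_mul' _ (LSeriesSummable_arith χ hs)]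
  · simp_rw [← ArithmeticFunction.natCoe_apply]
  · exact ArithmeticFunction.LSeriesSummable_zeta_iff.mpr hs

theorem LSeries_zetaMul_mul (χ₁ : DirichletCharacter ℂ N₁) (χ₂ : DirichletCharacter ℂ N₂)
    (χ₃ : DirichletCharacter ℂ N₃) {s : ℂ} (hs : 1 < s.re) :
    LSeriesSummable ⇑(χ₁.zetaMul * (χ₂.arith * χ₃.arith)) s ∧
    LSeries ⇑(χ₁.zetaMul * (χ₂.arith * χ₃.arith)) s =
      riemannZeta s * LFunction χ₁ s * (LFunction χ₂ s * LFunction χ₃ s) := by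
  have h23 := ArithmeticFunction.LSeriesSummable_mul (LSeriesSummable_arith χ₂ hs)
    (LSeriesSummable_arith χ₃ hs)
  refine ⟨ArithmeticFunction.LSeriesSummable_mul (χ₁.LSeriesSummable_zetaMul hs) h23, ?_⟩
  rw [ArithmeticFunction.LSeries_mul' (χ₁.LSeriesSummable_zetaMul hs) h23, LSeries_zetaMul χ₁ hs,
    ArithmeticFunction.LSeries_mul' (LSeriesSummable_arith χ₂ hs) (LSeriesSummable_arith χ₃ hs),
    LSeries_arith χ₂ hs, LSeries_arith χ₃ hs]

theorem LFunctionTrivChar₁_one_apply {s : ℂ} (hs : s ≠ 1) :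
    LFunctionTrivChar₁ 1 s = (s - 1) * riemannZeta s := by
  rw [LFunctionTrivChar₁, Function.update_of_ne hs, LFunctionTrivChar, LFunction_modOne_eq]

theorem LFunctionTrivChar₁_one_one : LFunctionTrivChar₁ 1 1 = 1 := by
  simp [LFunctionTrivChar₁]

theorem exists_norm_LFunctionTrivChar₁_le :
    ∃ c : ℝ, 1 ≤ c ∧ ∀ s ∈ closedBall (2 : ℂ) (3 / 2), ‖LFunctionTrivChar₁ 1 s‖ ≤ c := by
  obtain ⟨c, hc⟩ := (isCompact_closedBall (2 : ℂ) (3 / 2)).exists_bound_of_continuousOn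
    (differentiable_LFunctionTrivChar₁ 1).continuous.continuousOn
  exact ⟨max c 1, le_max_right _ _, fun s hs ↦ (hc s hs).trans (le_max_left _ _)⟩

theorem ne_one_of_one_lt_re {s : ℂ} (hs : 1 < s.re) : s ≠ 1 := by
  rintro rfl
  simp at hs

/-- Estermann's lemma for `ζ(s) L(s, χ)`. -/
theorem exists_estermann_zetaMul : ∃ c : ℝ, 0 < c ∧ ∀ {N : ℕ} [NeZero N]
    {χ : DirichletCharacter ℂ N}, χ ≠ 1 → χ ^ 2 = 1 →
    0 ≤ LFunction χ 1 ∧ ∀ x : ℝ, 7 / 8 ≤ x → x < 1 →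
      (LFunctionTrivChar₁ 1 x * LFunction χ x).im = 0 ∧ ∀ m : ℕ, (2 - x) ^ m ≤ 4 / 3 →
        0 ≤ (LFunctionTrivChar₁ 1 x * LFunction χ x).re →
          ((1 - x) / 2) ^ m ≤ c * N * ‖LFunction χ 1‖ ^ m := by
  obtain ⟨c, hc1, hc⟩ := exists_norm_LFunction_le
  obtain ⟨z, hz1, hz⟩ := exists_norm_LFunctionTrivChar₁_le
  refine ⟨44 * (z * c), by positivity, fun {N} _ {χ} hχ hχ2 ↦ ?_⟩
  have hN : (1 : ℝ) ≤ N := mod_cast NeZero.pos N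
  have h := estermann (a := χ.zetaMul) (P := fun s ↦ LFunctionTrivChar₁ 1 s * LFunction χ s)
    (B := z * (c * N)) (fun n ↦ zetaMul_nonneg hχ2 n)
    (χ.isMultiplicative_zetaMul.map_one).ge
    (LSeries.abscissaOfAbsConv_le_of_forall_lt_LSeriesSummable' fun y hy ↦
      χ.LSeriesSummable_zetaMul (by rw [ofReal_re]; exact_mod_cast hy))
    ((differentiable_LFunctionTrivChar₁ 1).mul (differentiable_LFunction hχ))
    (fun s hs ↦ ?_) (one_le_mul_of_one_le_of_one_le hz1 (one_le_mul_of_one_le_of_one_le hc1 hN))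
    fun s hs ↦ ?_
  · simp only [LFunctionTrivChar₁_one_one, one_mul] at h
    refine ⟨h.1, fun x hx hx1 ↦ ⟨(h.2 x hx hx1).1, fun m hm hre ↦ ?_⟩⟩
    convert! (h.2 x hx hx1).2 m hm hre using 2
    ring
  · rw [LFunctionTrivChar₁_one_apply (ne_one_of_one_lt_re hs), LSeries_zetaMul χ hs, mul_assoc]
  · rw [norm_mul]
    exact mul_le_mul (hz s hs) ((hc hχ).1 s hs) (norm_nonneg _) (by linarith)

/-- Estermann's lemma for `ζ(s) L(s, χ₁) L(s, χ₂) L(s, χ₁χ₂)`. -/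
theorem exists_estermann_zetaMul_mul : ∃ c : ℝ, 0 < c ∧ ∀ {N₁ N₂ N₃ : ℕ} [NeZero N₁] [NeZero N₂]
    [NeZero N₃] {χ₁ : DirichletCharacter ℂ N₁} {χ₂ : DirichletCharacter ℂ N₂}
    {χ₃ : DirichletCharacter ℂ N₃}, χ₁ ≠ 1 → χ₂ ≠ 1 → χ₃ ≠ 1 → χ₁ ^ 2 = 1 → χ₂ ^ 2 = 1 →
    (∀ p : ℕ, p.Prime → χ₃ p = χ₁ p * χ₂ p) →
    ∀ x : ℝ, 7 / 8 ≤ x → x < 1 → LFunctionTrivChar₁ 1 x * LFunction χ₁ x = 0 →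
      ∀ m : ℕ, (2 - x) ^ m ≤ 4 / 3 → ((1 - x) / 2) ^ m ≤
        c * (N₁ * N₂ * N₃) * (‖LFunction χ₁ 1‖ * ‖LFunction χ₂ 1‖ * ‖LFunction χ₃ 1‖) ^ m := by
  obtain ⟨c, hc1, hc⟩ := exists_norm_LFunction_le
  obtain ⟨z, hz1, hz⟩ := exists_norm_LFunctionTrivChar₁_le
  refine ⟨44 * (z * c ^ 3), by positivity,
    fun {N₁ N₂ N₃} _ _ _ {χ₁ χ₂ χ₃} hχ₁ hχ₂ hχ₃ h₁ h₂ h₃ x hx hx1 h0 m hm ↦ ?_⟩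
  have hN₁ : (1 : ℝ) ≤ N₁ := mod_cast NeZero.pos N₁
  have hN₂ : (1 : ℝ) ≤ N₂ := mod_cast NeZero.pos N₂
  have hN₃ : (1 : ℝ) ≤ N₃ := mod_cast NeZero.pos N₃
  have hL : ∀ s : ℂ, 1 < s.re → _ := fun s hs ↦ LSeries_zetaMul_mul χ₁ χ₂ χ₃ hs
  have h := estermann (a := ⇑(χ₁.zetaMul * (χ₂.arith * χ₃.arith)))
    (P := fun s ↦ LFunctionTrivChar₁ 1 s * LFunction χ₁ s * (LFunction χ₂ s * LFunction χ₃ s))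
    (B := z * (c * N₁) * ((c * N₂) * (c * N₃))) (zetaMul_mul_nonneg h₁ h₂ h₃)
    (χ₁.isMultiplicative_zetaMul.mul ((isMultiplicative_toArithmeticFunction χ₂).mul
      (isMultiplicative_toArithmeticFunction χ₃))).map_one.ge
    (LSeries.abscissaOfAbsConv_le_of_forall_lt_LSeriesSummable' fun y hy ↦
      (hL y (by rw [ofReal_re]; exact_mod_cast hy)).1)
    (((differentiable_LFunctionTrivChar₁ 1).mul (differentiable_LFunction hχ₁)).mul
      ((differentiable_LFunction hχ₂).mul (differentiable_LFunction hχ₃)))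
    (fun s hs ↦ ?_) ?_ fun s hs ↦ ?_
  · have := (h.2 x hx hx1).2 m hm (by simp only [h0, zero_mul, zero_re, le_refl])
    simp only [LFunctionTrivChar₁_one_one, one_mul, norm_mul, ← mul_assoc] at this
    convert! this using 2
    ring
  · rw [LFunctionTrivChar₁_one_apply (ne_one_of_one_lt_re hs), (hL s hs).2]
    ring
  · have := one_le_mul_of_one_le_of_one_le hc1 hN₁
    have := one_le_mul_of_one_le_of_one_le hc1 hN₂
    have := one_le_mul_of_one_le_of_one_le hc1 hN₃
    exact one_le_mul_of_one_le_of_one_le (one_le_mul_of_one_le_of_one_le hz1 ‹_›)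
      (one_le_mul_of_one_le_of_one_le ‹_› ‹_›)
  · simp only [norm_mul]
    gcongr
    · exact hz s hs
    · exact (hc hχ₁).1 s hs
    · exact (hc hχ₂).1 s hs
    · exact (hc hχ₃).1 s hs

end DirichletCharacter

end

section

open Complex Filter Topology Metric Finset
open scoped ComplexOrder Nat

/-- The Jacobi symbol `(· | N)` as a Dirichlet character. -/
noncomputable def jacobiChar (N : ℕ) [NeZero N] : DirichletCharacter ℂ N where
  toFun a := (jacobiSym a.val N : ℂ)
  map_one' := by
    have h : jacobiSym ((1 : ZMod N).val : ℕ) N = jacobiSym 1 N := by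
      rw [ZMod.val_one_eq_one_mod, Int.natCast_mod, ← jacobiSym.mod_left, Nat.cast_one]
    rw [h, jacobiSym.one_left, Int.cast_one]
  map_mul' a b := by
    rw [ZMod.val_mul, Int.natCast_mod, ← jacobiSym.mod_left, Nat.cast_mul, jacobiSym.mul_left,
      Int.cast_mul]
  map_nonunit' a ha := by
    rw [Int.cast_eq_zero, jacobiSym.eq_zero_iff]
    refine ⟨NeZero.ne N, fun h ↦ ha ?_⟩
    rw [Int.gcd_natCast_natCast] at h
    rw [← ZMod.natCast_zmod_val a]
    exact (ZMod.isUnit_iff_coprime _ _).mpr h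

variable {N : ℕ} [NeZero N]

theorem jacobiChar_natCast (m : ℕ) : jacobiChar N m = jacobiSym m N := by
  change ((jacobiSym ((m : ZMod N).val : ℕ) N : ℤ) : ℂ) = _
  rw [ZMod.val_natCast, Int.natCast_mod, ← jacobiSym.mod_left]

theorem jacobiChar_sq : jacobiChar N ^ 2 = 1 := by
  refine MulChar.isQuadratic_iff_sq_eq_one.mp fun a ↦ ?_
  change (jacobiSym (a.val : ℕ) N : ℂ) = 0 ∨ (jacobiSym (a.val : ℕ) N : ℂ) = 1 ∨
    (jacobiSym (a.val : ℕ) N : ℂ) = -1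
  rcases jacobiSym.trichotomy (a.val : ℕ) N with h | h | h <;> rw [h] <;> simp

theorem jacobiChar_mul_natCast {N₁ N₂ : ℕ} [NeZero N₁] [NeZero N₂] (m : ℕ) :
    jacobiChar (N₁ * N₂) m = jacobiChar N₁ m * jacobiChar N₂ m := by
  rw [jacobiChar_natCast, jacobiChar_natCast, jacobiChar_natCast, ← Int.cast_mul,
    jacobiSym.mul_right]

theorem jacobiChar_ne_one {p m : ℕ} (hp : p.Prime) (hp2 : p ≠ 2) (hm : m ≠ 0) (hpm : ¬ p ∣ m)
    (hN : N = p * m) : jacobiChar N ≠ 1 := by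
  have : Fact p.Prime := ⟨hp⟩
  have : NeZero m := ⟨hm⟩
  obtain ⟨a, ha⟩ := FiniteField.exists_nonsquare (F := ZMod p) (by rwa [ZMod.ringChar_zmod_n])
  obtain ⟨k, hk, hk1⟩ := Nat.chineseRemainder ((Nat.Prime.coprime_iff_not_dvd hp).mpr hpm) a.val 1
  have hkp : (k : ZMod p) = a := by
    rw [← ZMod.natCast_zmod_val a]
    exact (ZMod.natCast_eq_natCast_iff _ _ _).mpr hk
  have h1 : jacobiSym k p = -1 := by
    rw [← jacobiSym.legendreSym.to_jacobiSym, legendreSym.eq_neg_one_iff]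
    rwa [Int.cast_natCast, hkp]
  have h2 : jacobiSym k m = 1 := by
    rw [jacobiSym.mod_left, (Int.natCast_modEq_iff.mpr hk1), ← jacobiSym.mod_left, Nat.cast_one,
      jacobiSym.one_left]
  intro h
  have h3 : jacobiChar N k = -1 := by
    subst hN
    rw [jacobiChar_natCast, jacobiSym.mul_right, h1, h2]
    simp
  rw [h] at h3
  by_cases hu : IsUnit (k : ZMod N)
  · rw [MulChar.one_apply hu] at h3
    norm_num at h3
  · rw [MulChar.map_nonunit _ hu] at h3
    norm_num at h3

theorem jacobiChar_ne_one_of_squarefree (hodd : Odd N) (h1 : N ≠ 1) (hs : Squarefree N) :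
    jacobiChar N ≠ 1 := by
  obtain ⟨p, hp, m, rfl⟩ := Nat.exists_prime_and_dvd h1
  have hm : m ≠ 0 := by
    rintro rfl
    exact hs.ne_zero (mul_zero p)
  refine jacobiChar_ne_one hp ?_ hm ?_ rfl
  · rintro rfl
    exact absurd hodd (by simp)
  · intro h
    exact hp.not_isUnit (hs p (mul_dvd_mul_left p h))

theorem jacobiChar_mul_ne_one_of_squarefree {N₁ N₂ : ℕ} [NeZero N₁] [NeZero N₂] (h₁ : Odd N₁)
    (h₂ : Odd N₂) (hs₁ : Squarefree N₁) (hs₂ : Squarefree N₂) (hne : N₁ ≠ N₂) :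
    jacobiChar (N₁ * N₂) ≠ 1 := by
  have key : ∀ {a b : ℕ}, Odd a → Squarefree a → b ≠ 0 → ∀ p ∈ a.primeFactors,
      p ∉ b.primeFactors → ∃ p m, p.Prime ∧ p ≠ 2 ∧ m ≠ 0 ∧ ¬ p ∣ m ∧ a * b = p * m := by
    intro a b hodd hs hb p hpa hpb
    have hp := Nat.prime_of_mem_primeFactors hpa
    obtain ⟨m, rfl⟩ := Nat.dvd_of_mem_primeFactors hpa
    have hm : m ≠ 0 := by
      rintro rfl
      exact hs.ne_zero (mul_zero p)
    refine ⟨p, m * b, hp, ?_, mul_ne_zero hm hb, fun h ↦ ?_, mul_assoc _ _ _⟩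
    · rintro rfl
      exact absurd hodd (by simp)
    · rcases (hp.dvd_mul).mp h with h | h
      · exact hp.not_isUnit (hs p (mul_dvd_mul_left p h))
      · exact hpb (Nat.mem_primeFactors.mpr ⟨hp, h, hb⟩)
  have hpf : N₁.primeFactors ≠ N₂.primeFactors := by
    intro h
    rw [← Nat.prod_primeFactors_of_squarefree hs₁, h,
      Nat.prod_primeFactors_of_squarefree hs₂] at hne
    exact hne rfl
  have : ∃ p m, p.Prime ∧ p ≠ 2 ∧ m ≠ 0 ∧ ¬ p ∣ m ∧ N₁ * N₂ = p * m := by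
    by_cases h : N₁.primeFactors ⊆ N₂.primeFactors
    · have h' : ¬ N₂.primeFactors ⊆ N₁.primeFactors := fun h' ↦ hpf (h.antisymm h')
      obtain ⟨p, hp, hp'⟩ := not_subset.mp h'
      rw [mul_comm]
      exact key h₂ hs₂ (NeZero.ne _) p hp hp'
    · obtain ⟨p, hp, hp'⟩ := not_subset.mp h
      exact key h₁ hs₁ (NeZero.ne _) p hp hp'
  obtain ⟨p, m, hp, hp2, hm, hpm, h⟩ := this
  exact jacobiChar_ne_one hp hp2 hm hpm h

end

section

open NumberField NumberField.InfinitePlace Module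

section Discriminant

variable {K : Type*} [Field K] [NumberField K] {n : ℕ} {ω : 𝓞 K}

theorem not_isSquare_four_mul_sq_add_one (hn : n ≠ 0) : ¬ IsSquare (4 * n ^ 2 + 1) := by
  rintro ⟨a, ha⟩
  have h1 : 2 * n < a := by nlinarith
  nlinarith [Nat.pos_of_ne_zero hn]

theorem linearIndependent_one_omega (hn : n ≠ 0) (hω : ω ^ 2 = ω + (n : 𝓞 K) ^ 2) :
    LinearIndependent ℚ ![(1 : K), (ω : K)] := by
  have hωK : (ω : K) ^ 2 = ω + (n : K) ^ 2 := by
    simpa using congrArg (algebraMap (𝓞 K) K) hω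
  rw [LinearIndependent.pair_iff]
  intro s t hst
  by_cases ht : t = 0
  · subst ht
    simpa using hst
  exfalso
  have hst' : (s : K) + t * ω = 0 := by
    simpa [Algebra.smul_def] using hst
  have h : ((s * 2 + t) ^ 2 : K) = (t : K) ^ 2 * (4 * n ^ 2 + 1) := by
    have : ((s * 2 + t) : K) = - t * (2 * ω - 1) := by linear_combination 2 * hst'
    rw [this]
    linear_combination 4 * (t : K) ^ 2 * hωK
  have h' : (s * 2 + t) ^ 2 = t ^ 2 * (4 * n ^ 2 + 1) := by exact_mod_cast h
  refine not_isSquare_four_mul_sq_add_one hn (Rat.isSquare_natCast_iff.mp ⟨(s * 2 + t) / t, ?_⟩)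
  push_cast
  field_simp
  linear_combination -h'

theorem trace_eq_one_of_sq_eq_add {F L : Type*} [Field F] [Field L] [Algebra F L] {x : L} {c : F}
    (hx : x ^ 2 = x + algebraMap F L c) (b : Basis (Fin 2) F L) (hb0 : b 0 = 1) (hb1 : b 1 = x) :
    Algebra.trace F L x = 1 := by
  have h0 : x * b 0 = b 1 := by rw [hb0, hb1, mul_one]
  have h1 : x * b 1 = b 1 + c • b 0 := by rw [hb0, hb1, ← pow_two, hx, Algebra.smul_def, mul_one]
  rw [Algebra.trace_eq_matrix_trace b, Matrix.trace_fin_two, Algebra.leftMulMatrix_eq_repr_mul,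
    Algebra.leftMulMatrix_eq_repr_mul, h0, h1, map_add, map_smul]
  simp

theorem trace_omega (hn : n ≠ 0) (hK : finrank ℚ K = 2) (hω : ω ^ 2 = ω + (n : 𝓞 K) ^ 2) :
    Algebra.trace ℤ (𝓞 K) ω = 1 := by
  have hωK : (ω : K) ^ 2 = ω + algebraMap ℚ K ((n : ℚ) ^ 2) := by
    simpa using congrArg (algebraMap (𝓞 K) K) hω
  have hq := trace_eq_one_of_sq_eq_add hωK (basisOfLinearIndependentOfCardEqFinrank
    (linearIndependent_one_omega hn hω) (by rw [Fintype.card_fin, hK])) (by simp) (by simp)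
  rw [← Algebra.coe_trace_int] at hq
  exact_mod_cast hq

theorem trace_int_natCast (hK : finrank ℚ K = 2) (a : ℤ) :
    Algebra.trace ℤ (𝓞 K) (a : 𝓞 K) = 2 * a := by
  have := Algebra.trace_algebraMap (R := ℤ) (S := 𝓞 K) a
  rw [RingOfIntegers.rank, hK] at this
  simpa using this

theorem discr_eq_four_mul_sq_add_one (hn : n ≠ 0) (hK : finrank ℚ K = 2)
    (hω : ω ^ 2 = ω + (n : 𝓞 K) ^ 2) (hd : Squarefree (4 * n ^ 2 + 1)) :
    discr K = 4 * (n : ℤ) ^ 2 + 1 := by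
  have h1 : Algebra.trace ℤ (𝓞 K) 1 = 2 := by simpa using trace_int_natCast hK 1
  have h2 := trace_omega hn hK hω
  have h3 : Algebra.trace ℤ (𝓞 K) (ω * ω) = 1 + 2 * (n : ℤ) ^ 2 := by
    have := trace_int_natCast hK ((n : ℤ) ^ 2)
    push_cast at this
    rw [← pow_two, hω, map_add, h2, this]
  have hdisc : Algebra.discr ℤ ![1, ω] = 4 * (n : ℤ) ^ 2 + 1 := by
    rw [Algebra.discr_def, Matrix.det_fin_two]
    simp [Algebra.traceMatrix_apply, Algebra.traceForm_apply, h1, h2, h3]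
    ring
  have hcard : finrank ℤ (𝓞 K) = 2 := by rw [RingOfIntegers.rank, hK]
  let b : Basis (Fin 2) ℤ (𝓞 K) := finBasisOfFinrankEq ℤ (𝓞 K) hcard
  have hdet := Algebra.discr_of_matrix_vecMul (b : Fin 2 → 𝓞 K) (b.toMatrix ![1, ω])
  rw [Basis.toMatrix_map_vecMul, hdisc, discr_eq_discr] at hdet
  set D := (b.toMatrix ![1, ω]).det
  have hu : IsUnit D := by
    have hsq : Squarefree (4 * (n : ℤ) ^ 2 + 1) := by
      have := Int.squarefree_natCast.mpr hd
      push_cast at this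
      exact this
    refine hsq D ⟨discr K, ?_⟩
    rw [hdet, pow_two]
  rw [hdet, Int.isUnit_sq hu, one_mul]

end Discriminant

section Regulator

variable {K : Type*} [Field K] [NumberField K] {n : ℕ} {ω : 𝓞 K}

theorem nrRealPlaces_eq_two (hK : finrank ℚ K = 2) (σ : K →+* ℝ) :
    nrRealPlaces K = 2 ∧ nrComplexPlaces K = 0 := by
  have h := card_add_two_mul_card_eq_rank K
  have hreal : ComplexEmbedding.IsReal (Complex.ofRealHom.comp σ) := by
    rw [ComplexEmbedding.isReal_iff]
    ext x
    simp [ComplexEmbedding.conjugate]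
  have : 0 < nrRealPlaces K :=
    @Fintype.card_pos_iff _ (_) |>.mpr ⟨mkReal ⟨_, hreal⟩⟩
  lia

theorem log_two_mul_add_sqrt_pos (hn : n ≠ 0) :
    0 < Real.log (2 * n + Real.sqrt (4 * n ^ 2 + 1)) := by
  refine Real.log_pos ?_
  have : (1 : ℝ) ≤ n := by exact_mod_cast Nat.pos_of_ne_zero hn
  have := Real.sqrt_nonneg (4 * (n : ℝ) ^ 2 + 1)
  linarith

theorem abs_log_place_eq (hω : ω ^ 2 = ω + (n : 𝓞 K) ^ 2)
    (w : InfinitePlace K) :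
    |Real.log (w (2 * n + 2 * ω - 1))| = Real.log (2 * n + Real.sqrt (4 * n ^ 2 + 1)) := by
  have hωK : (ω : K) ^ 2 = ω + (n : K) ^ 2 := by
    simpa using congrArg (algebraMap (𝓞 K) K) hω
  set S : ℝ := Real.sqrt (4 * n ^ 2 + 1) with hS
  have hS2 : S ^ 2 = 4 * n ^ 2 + 1 := Real.sq_sqrt (by positivity)
  have hSn : 2 * n < S := Real.lt_sqrt_of_sq_lt (by nlinarith)
  have hpos : (0 : ℝ) ≤ n := n.cast_nonneg
  have hlog : 0 ≤ Real.log (2 * n + S) := by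
    refine Real.log_nonneg ?_
    have : 1 ≤ S := Real.one_le_sqrt.mpr (by nlinarith)
    linarith
  rw [← norm_embedding_eq]
  set z : ℂ := w.embedding (2 * ω - 1) with hz
  have hzS : z = S ∨ z = -S := by
    rw [← sq_eq_sq_iff_eq_or_eq_neg]
    have : (2 * ω - 1 : K) ^ 2 = 4 * n ^ 2 + 1 := by linear_combination 4 * hωK
    rw [hz, ← map_pow, this]
    rw [← Complex.ofReal_pow, hS2]
    push_cast
    simp only [map_add, map_mul, map_pow, map_natCast, map_ofNat, map_one]
  have hsum : w.embedding (2 * n + 2 * ω - 1) = 2 * n + z := by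
    rw [hz, add_sub_assoc, map_add, map_mul, map_natCast, map_ofNat]
  rw [hsum]
  rcases hzS with h | h
  · rw [h, show (2 * n + S : ℂ) = ((2 * n + S : ℝ) : ℂ) by push_cast; ring, Complex.norm_real,
      Real.norm_of_nonneg (by linarith), abs_of_nonneg hlog]
  · rw [h, show (2 * n + -S : ℂ) = ((-(2 * n + S)⁻¹ : ℝ) : ℂ) by
      have : (2 * n + S) ≠ 0 := by linarith
      have h' : 2 * n + -S = -(2 * n + S)⁻¹ := by
        field_simp
        linear_combination -hS2
      rw [← h']
      push_cast
      ring, Complex.norm_real, norm_neg, norm_inv, Real.norm_of_nonneg (by linarith),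
      Real.log_inv, abs_neg, abs_of_nonneg hlog]

theorem regulator_le_log (hn : n ≠ 0) (hK : finrank ℚ K = 2) (σ : K →+* ℝ)
    (hω : ω ^ 2 = ω + (n : 𝓞 K) ^ 2) :
    Units.regulator K ≤ 2 * Real.log (2 * n + Real.sqrt (4 * n ^ 2 + 1)) := by
  classical
  have hL := log_two_mul_add_sqrt_pos hn
  obtain ⟨h1, h2⟩ := nrRealPlaces_eq_two hK σ
  have hcard : Fintype.card (InfinitePlace K) = 2 := by
    rw [card_eq_nrRealPlaces_add_nrComplexPlaces, h1, h2]
  have hrank : Units.rank K = 1 := by rw [Units.rank, hcard]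
  let u : (𝓞 K)ˣ := ⟨2 * n + 2 * ω - 1, 2 * ω - 1 - 2 * n, by linear_combination 4 * hω,
    by linear_combination 4 * hω⟩
  have hu : algebraMap (𝓞 K) K u = 2 * n + 2 * ω - 1 := by
    change algebraMap (𝓞 K) K (2 * n + 2 * ω - 1) = _
    simp only [map_add, map_sub, map_mul, map_natCast, map_ofNat, map_one]
  obtain ⟨v, hv⟩ : ∃ v : Fin (Units.rank K) → (𝓞 K)ˣ, ∀ i, v i = u := ⟨fun _ ↦ u, fun _ ↦ rfl⟩
  let w' : InfinitePlace K := Classical.arbitrary _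
  have hcard' : Fintype.card {w : InfinitePlace K // w ≠ w'} = Fintype.card (Fin (Units.rank K)) := by
    rw [Fintype.card_subtype_compl, hcard, Fintype.card_subtype_eq, Fintype.card_fin, hrank]
  have hcard1 : Fintype.card {w : InfinitePlace K // w ≠ w'} = 1 := by
    rw [hcard', Fintype.card_fin, hrank]
  have hreg := Units.regOfFamily_eq_det v w' (Fintype.equivOfCardEq hcard')
  obtain ⟨w, hw⟩ := Fintype.card_eq_one_iff.mp hcard1
  let : Unique {w : InfinitePlace K // w ≠ w'} := ⟨⟨w⟩, hw⟩
  rw [Matrix.det_unique, Matrix.of_apply, hv, hu, abs_mul,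
    abs_log_place_eq hω] at hreg
  rw [Nat.abs_cast] at hreg
  have hm1 : (1 : ℝ) ≤ (mult (default : {w : InfinitePlace K // w ≠ w'}).val : ℝ) := by
    exact_mod_cast mult_pos
  have hm2 : (mult (default : {w : InfinitePlace K // w ≠ w'}).val : ℝ) ≤ 2 := by
    rw [mult]
    split_ifs <;> norm_num
  have hpos : 0 < Units.regOfFamily v := by
    rw [hreg]
    positivity
  have hle : Units.regulator K ≤ Units.regOfFamily v := by
    have h := Units.regOfFamily_div_regulator v
    have hR := Units.regulator_pos K
    have h0 : 0 < Units.regOfFamily v / Units.regulator K := by positivity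
    rw [h] at h0
    have h1 : (1 : ℝ) ≤ Units.regOfFamily v / Units.regulator K := by
      rw [h]
      exact_mod_cast Nat.cast_pos.mp h0
    rwa [one_le_div hR] at h1
  refine hle.trans ?_
  rw [hreg]
  gcongr

theorem dedekindZeta_residue_le (hn : n ≠ 0) (hK : finrank ℚ K = 2) (σ : K →+* ℝ)
    (hω : ω ^ 2 = ω + (n : 𝓞 K) ^ 2) (hd : Squarefree (4 * n ^ 2 + 1)) :
    dedekindZeta_residue K ≤ 8 * classNumber K *
      Real.log (2 * n + Real.sqrt (4 * n ^ 2 + 1)) / Real.sqrt (4 * n ^ 2 + 1) := by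
  obtain ⟨h1, h2⟩ := nrRealPlaces_eq_two hK σ
  have hL := log_two_mul_add_sqrt_pos hn
  have hR := regulator_le_log hn hK σ hω
  have hR0 := Units.regulator_pos K
  have ht : (1 : ℝ) ≤ Units.torsionOrder K := by exact_mod_cast Units.torsionOrder_pos K
  rw [dedekindZeta_residue_def, h1, h2, discr_eq_four_mul_sq_add_one hn hK hω hd]
  have : |((4 * (n : ℤ) ^ 2 + 1 : ℤ) : ℝ)| = 4 * n ^ 2 + 1 := by
    rw [abs_of_nonneg (by positivity)]
    push_cast
    ring
  push_cast at this ⊢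
  rw [this]
  have hS : 0 < Real.sqrt (4 * (n : ℝ) ^ 2 + 1) := Real.sqrt_pos.mpr (by positivity)
  gcongr ?_ / ?_
  · nlinarith [mul_le_mul_of_nonneg_right hR (Nat.cast_nonneg (α := ℝ) (classNumber K))]
  · nlinarith

end Regulator

end

section

open NumberField Module Filter Topology
open scoped ComplexOrder

section CountIdeals

variable {K : Type*} [Field K] [NumberField K]

theorem span_natCast_isCoprime {R : Type*} [CommRing R] {m n : ℕ} (h : m.Coprime n) {I : Ideal R}
    (hm : (m : R) ∈ I) (hn : (n : R) ∈ I) : I = ⊤ := by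
  have hc : IsCoprime (m : R) (n : R) := by
    have := (Nat.isCoprime_iff_coprime.mpr h).map (Int.castRingHom R)
    simpa using this
  obtain ⟨a, b, hab⟩ := hc
  exact (Ideal.eq_top_iff_one _).mpr (hab ▸ I.add_mem (I.mul_mem_left a hm) (I.mul_mem_left b hn))

theorem mul_sup_span_natCast {R : Type*} [CommRing R] [IsDedekindDomain R] {I J : Ideal R} {m n : ℕ}
    (h : m.Coprime n) (hm : (m : R) ∈ I) (hn : (n : R) ∈ J) : I * J ⊔ Ideal.span {(m : R)} = I := by
  obtain ⟨A, hA⟩ := Ideal.dvd_span_singleton.mpr hm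
  have hmem : (m : R) ∈ A :=
    Ideal.mul_le_right (I := I) (hA ▸ Ideal.mem_span_singleton_self (m : R))
  have hJA : J ⊔ A = ⊤ :=
    span_natCast_isCoprime h (Ideal.mem_sup_right hmem) (Ideal.mem_sup_left hn)
  rw [hA, ← Ideal.mul_sup, hJA, Ideal.mul_top]

theorem mul_sup_span_absNorm {I J : Ideal (𝓞 K)}
    (h : (Ideal.absNorm I).Coprime (Ideal.absNorm J)) :
    I * J ⊔ Ideal.span {(Ideal.absNorm I : 𝓞 K)} = I :=
  mul_sup_span_natCast h (Ideal.absNorm_mem I) (Ideal.absNorm_mem J)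

instance (m : ℕ) : Finite {I : Ideal (𝓞 K) // Ideal.absNorm I = m} :=
  (Ideal.finite_setOfPred_absNorm_eq m).to_subtype

theorem card_absNorm_mul_card_absNorm_le {m n : ℕ} (h : m.Coprime n) :
    Nat.card {I : Ideal (𝓞 K) // Ideal.absNorm I = m} *
      Nat.card {I : Ideal (𝓞 K) // Ideal.absNorm I = n} ≤
        Nat.card {I : Ideal (𝓞 K) // Ideal.absNorm I = m * n} := by
  rw [← Nat.card_prod]
  refine Nat.card_le_card_of_injective
    (fun x ↦ ⟨x.1.1 * x.2.1, by rw [map_mul, x.1.2, x.2.2]⟩) ?_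
  rintro ⟨⟨I, hI⟩, ⟨J, hJ⟩⟩ ⟨⟨I', hI'⟩, ⟨J', hJ'⟩⟩ heq
  replace heq : I * J = I' * J' := congrArg Subtype.val heq
  have h1 : I = I' := by
    rw [← mul_sup_span_absNorm (I := I) (J := J) (by rwa [hI, hJ]),
      ← mul_sup_span_absNorm (I := I') (J := J') (by rwa [hI', hJ']), heq, hI, hI']
  have h2 : J = J' := by
    rw [← mul_sup_span_absNorm (I := J) (J := I) (by rwa [hI, hJ, Nat.coprime_comm]),
      ← mul_sup_span_absNorm (I := J') (J := I') (by rwa [hI', hJ', Nat.coprime_comm]),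
      mul_comm J, mul_comm J', heq, hJ, hJ']
  subst h1 h2
  rfl

end CountIdeals

section PrimePowers

variable {K : Type*} [Field K] [NumberField K] {n : ℕ} {ω : 𝓞 K}

theorem absNorm_span_natCast_eq_sq (hK : finrank ℚ K = 2) (p : ℕ) :
    Ideal.absNorm (Ideal.span {(p : 𝓞 K)}) = p ^ 2 := by
  rw [Ideal.absNorm_span_natCast, RingOfIntegers.rank, hK]

theorem one_le_card_of_even (hK : finrank ℚ K = 2) (p : ℕ) {k : ℕ} (hk : Even k) :
    1 ≤ Nat.card {I : Ideal (𝓞 K) // Ideal.absNorm I = p ^ k} := by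
  obtain ⟨j, rfl⟩ := hk
  rw [Nat.one_le_iff_ne_zero, Nat.card_ne_zero]
  refine ⟨⟨Ideal.span {(p : 𝓞 K)} ^ j, ?_⟩, inferInstance⟩
  rw [map_pow, absNorm_span_natCast_eq_sq hK, ← pow_mul, two_mul]

theorem one_le_card_of_dvd (hK : finrank ℚ K = 2) (hω : ω ^ 2 = ω + (n : 𝓞 K) ^ 2)
    (hd : Squarefree (4 * n ^ 2 + 1)) {p : ℕ} (hp : p.Prime) (hpd : p ∣ 4 * n ^ 2 + 1) (k : ℕ) :
    1 ≤ Nat.card {I : Ideal (𝓞 K) // Ideal.absNorm I = p ^ k} := by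
  obtain ⟨m, hm⟩ := hpd
  have hpm : p.Coprime m := by
    rw [hp.coprime_iff_not_dvd]
    intro h
    exact hp.not_isUnit (hd p (hm ▸ mul_dvd_mul_left p h))
  have hmR : (4 * n ^ 2 + 1 : 𝓞 K) = p * m := by exact_mod_cast congrArg (Nat.cast (R := 𝓞 K)) hm
  set P : Ideal (𝓞 K) := Ideal.span {(p : 𝓞 K), 2 * ω - 1} with hP
  have hPP : P * P = Ideal.span {(p : 𝓞 K)} := by
    rw [hP, Ideal.span_pair_mul_span_pair]
    refine le_antisymm ?_ ?_
    · rw [Ideal.span_le]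
      rintro x (rfl | rfl | rfl | rfl)
      · exact Ideal.mem_span_singleton.mpr ⟨_, rfl⟩
      · exact Ideal.mem_span_singleton.mpr ⟨_, rfl⟩
      · exact Ideal.mem_span_singleton.mpr ⟨2 * ω - 1, mul_comm _ _⟩
      · exact Ideal.mem_span_singleton.mpr ⟨m, by rw [← hmR]; linear_combination 4 * hω⟩
    · rw [Ideal.span_singleton_le_iff_mem]
      have hc : IsCoprime (p : 𝓞 K) (m : 𝓞 K) := by
        have := (Nat.isCoprime_iff_coprime.mpr hpm).map (Int.castRingHom (𝓞 K))
        simpa using this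
      obtain ⟨a, b, hab⟩ := hc
      have : a * (p * p) + b * ((2 * ω - 1) * (2 * ω - 1)) = (p : 𝓞 K) := by
        linear_combination (p : 𝓞 K) * hab + 4 * b * hω + b * hmR
      refine this.subst (motive := (· ∈ _)) ?_
      exact Ideal.add_mem _ (Ideal.mul_mem_left _ _ (Ideal.subset_span (by simp)))
        (Ideal.mul_mem_left _ _ (Ideal.subset_span (by simp)))
  have hN : Ideal.absNorm P = p := by
    have := congrArg Ideal.absNorm hPP
    rw [map_mul, absNorm_span_natCast_eq_sq hK, ← pow_two] at this
    exact Nat.pow_left_injective two_ne_zero this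
  rw [Nat.one_le_iff_ne_zero, Nat.card_ne_zero]
  exact ⟨⟨P ^ k, by rw [map_pow, hN]⟩, inferInstance⟩

theorem succ_le_card_of_dvd (hn : n ≠ 0) (hK : finrank ℚ K = 2) (hω : ω ^ 2 = ω + (n : 𝓞 K) ^ 2)
    {p : ℕ} (hp : p.Prime) {r : ℤ} (hr : (p : ℤ) ∣ r ^ 2 - r - n ^ 2) (hr' : ¬ (p : ℤ) ∣ 2 * r - 1)
    (k : ℕ) : k + 1 ≤ Nat.card {I : Ideal (𝓞 K) // Ideal.absNorm I = p ^ k} := by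
  obtain ⟨m, hm⟩ := hr
  have hmR : (r ^ 2 - r - n ^ 2 : 𝓞 K) = p * m := by
    exact_mod_cast congrArg (Int.cast (R := 𝓞 K)) hm
  have hc : IsCoprime (p : 𝓞 K) (2 * r - 1 : 𝓞 K) := by
    have : IsCoprime (p : ℤ) (2 * r - 1) :=
      (Nat.prime_iff_prime_int.mp hp).coprime_iff_not_dvd.mpr hr'
    simpa using this.map (Int.castRingHom (𝓞 K))
  obtain ⟨a, b, hab⟩ := hc
  set P : Ideal (𝓞 K) := Ideal.span {(p : 𝓞 K), ω - r} with hP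
  set Q : Ideal (𝓞 K) := Ideal.span {(p : 𝓞 K), ω - 1 + r} with hQ
  have hPQ : P * Q = Ideal.span {(p : 𝓞 K)} := by
    rw [hP, hQ, Ideal.span_pair_mul_span_pair]
    refine le_antisymm ?_ ?_
    · rw [Ideal.span_le]
      rintro x (rfl | rfl | rfl | rfl)
      · exact Ideal.mem_span_singleton.mpr ⟨_, rfl⟩
      · exact Ideal.mem_span_singleton.mpr ⟨_, rfl⟩
      · exact Ideal.mem_span_singleton.mpr ⟨ω - r, mul_comm _ _⟩
      · exact Ideal.mem_span_singleton.mpr ⟨-m, by linear_combination hω - hmR⟩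
    · rw [Ideal.span_singleton_le_iff_mem]
      have : a * (p * p) + (b * (p * (ω - 1 + r)) - b * ((ω - r) * p)) = (p : 𝓞 K) := by
        linear_combination (p : 𝓞 K) * hab
      refine this.subst (motive := (· ∈ _)) ?_
      exact Ideal.add_mem _ (Ideal.mul_mem_left _ _ (Ideal.subset_span (by simp)))
        (Ideal.sub_mem _ (Ideal.mul_mem_left _ _ (Ideal.subset_span (by simp)))
          (Ideal.mul_mem_left _ _ (Ideal.subset_span (by simp))))
  have hcop : IsCoprime P Q := by
    rw [Ideal.isCoprime_iff_sup_eq, Ideal.eq_top_iff_one]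
    have : (1 : 𝓞 K) = (a * p + b * (ω - 1 + r)) - b * (ω - r) := by
      linear_combination -hab
    rw [this]
    exact Ideal.sub_mem _ (Ideal.mem_sup_right (Ideal.add_mem _
      (Ideal.mul_mem_left _ _ (Ideal.subset_span (by simp)))
      (Ideal.mul_mem_left _ _ (Ideal.subset_span (by simp)))))
      (Ideal.mem_sup_left (Ideal.mul_mem_left _ _ (Ideal.subset_span (by simp))))
  have htr : ∀ c : ℤ, ¬ (p : ℤ) ∣ 1 + 2 * c → ω + (c : 𝓞 K) ∉ Ideal.span {(p : 𝓞 K)} := by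
    intro c hpc hmem
    obtain ⟨y, hy⟩ := Ideal.mem_span_singleton.mp hmem
    have := congrArg (Algebra.trace ℤ (𝓞 K)) hy
    rw [map_add, trace_omega hn hK hω, trace_int_natCast hK,
      show (p : 𝓞 K) * y = (p : ℤ) • y by simp [zsmul_eq_mul], map_smul, smul_eq_mul] at this
    exact hpc ⟨_, this⟩
  have hNP : Ideal.absNorm P ≠ 1 := by
    rw [Ne, Ideal.absNorm_eq_one_iff]
    intro h
    rw [h, Ideal.top_mul] at hPQ
    refine htr (r - 1) (fun h ↦ hr' (by convert! h using 1; ring)) (hPQ ▸ Ideal.subset_span ?_)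
    right
    push_cast
    exact Set.mem_singleton_iff.mpr (by ring)
  have hNQ : Ideal.absNorm Q ≠ 1 := by
    rw [Ne, Ideal.absNorm_eq_one_iff]
    intro h
    rw [h, Ideal.mul_top] at hPQ
    refine htr (-r) (fun h ↦ hr' ?_) (hPQ ▸ Ideal.subset_span ?_)
    · rw [← dvd_neg]
      convert! h using 1
      ring
    · right
      push_cast
      exact Set.mem_singleton_iff.mpr (by ring)
  have hNPQ : Ideal.absNorm P * Ideal.absNorm Q = p ^ 2 := by
    rw [← map_mul, hPQ, absNorm_span_natCast_eq_sq hK]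
  obtain ⟨hNP', hNQ'⟩ := (hp.mul_eq_prime_sq_iff hNP hNQ).mp hNPQ
  have hinj : ∀ {i j : ℕ}, i < j → j ≤ k → P ^ i * Q ^ (k - i) ≠ P ^ j * Q ^ (k - j) := by
    intro i j hij hj heq
    have hP0 : P ^ i ≠ 0 := pow_ne_zero _ fun h ↦ by simp [h] at hNP'; exact hp.ne_zero hNP'.symm
    have hQ0 : Q ^ (k - j) ≠ 0 :=
      pow_ne_zero _ fun h ↦ by simp [h] at hNQ'; exact hp.ne_zero hNQ'.symm
    obtain ⟨e, rfl⟩ := Nat.exists_eq_add_of_lt hij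
    rw [show k - i = e + 1 + (k - (i + e + 1)) by lia, pow_add Q, ← mul_assoc,
      add_assoc i e 1, pow_add P] at heq
    have h := mul_left_cancel₀ hP0 (mul_right_cancel₀ hQ0 heq)
    have hPe := hcop.pow (m := e + 1) (n := e + 1)
    rw [h, isCoprime_self] at hPe
    have := congrArg Ideal.absNorm (Ideal.isUnit_iff.mp hPe)
    rw [map_pow, hNP', Ideal.absNorm_top] at this
    exact hp.one_lt.ne' ((Nat.pow_eq_one.mp this).resolve_right e.succ_ne_zero)
  have hcard : Nat.card (Fin (k + 1)) = k + 1 := by simp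
  rw [← hcard]
  refine Nat.card_le_card_of_injective
    (fun i ↦ ⟨P ^ (i : ℕ) * Q ^ (k - i), ?_⟩) ?_
  · rw [map_mul, map_pow, map_pow, hNP', hNQ', ← pow_add]
    congr 1
    lia
  · intro i j h
    replace h : P ^ (i : ℕ) * Q ^ (k - i) = P ^ (j : ℕ) * Q ^ (k - j) := congrArg Subtype.val h
    rcases lt_trichotomy (i : ℕ) j with hij | hij | hij
    · exact absurd h (hinj hij (by lia))
    · exact Fin.ext hij
    · exact absurd h.symm (hinj hij (by lia))

end PrimePowers

end

section

open NumberField Module Filter Topology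
open scoped ComplexOrder

section Comparison

variable {K : Type*} [Field K] [NumberField K] {n : ℕ} {ω : 𝓞 K}

theorem exists_dvd_of_jacobiSym_eq_one {p : ℕ} (hp : p.Prime)
    (h : jacobiSym p (4 * n ^ 2 + 1) = 1) :
    ∃ r : ℤ, (p : ℤ) ∣ r ^ 2 - r - n ^ 2 ∧ ¬ (p : ℤ) ∣ 2 * r - 1 := by
  rcases hp.eq_two_or_odd' with rfl | hodd
  · refine ⟨0, ?_, by norm_num⟩
    have h8 : jacobiSym 2 (4 * n ^ 2 + 1) = 1 := h
    rw [jacobiSym.at_two (by exact ⟨2 * n ^ 2, by ring⟩)] at h8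
    rcases Nat.even_or_odd n with ⟨k, hk⟩ | ⟨k, hk⟩
    · exact ⟨-(2 * k ^ 2), by push_cast [hk]; ring⟩
    · exfalso
      obtain ⟨j, hj⟩ := Nat.even_mul_succ_self k
      have : 4 * n ^ 2 + 1 = 8 * (4 * j) + 5 := by
        rw [hk]
        linear_combination 16 * hj
      rw [this] at h8
      have h5 : (((8 * (4 * j) + 5 : ℕ)) : ZMod 8) = 5 := by
        push_cast
        rw [show (8 : ZMod 8) = 0 from rfl, zero_mul, zero_add]
      rw [h5] at h8
      exact absurd h8 (by decide)
  · have hrec := jacobiSym.quadratic_reciprocity_one_mod_four' (a := p) (b := 4 * n ^ 2 + 1) hodd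
      (by lia)
    rw [h] at hrec
    have : Fact p.Prime := ⟨hp⟩
    rw [← jacobiSym.legendreSym.to_jacobiSym] at hrec
    have h0 : (((4 * n ^ 2 + 1 : ℕ) : ℤ) : ZMod p) ≠ 0 := by
      intro h0
      rw [(legendreSym.eq_zero_iff p _).mpr h0] at hrec
      exact one_ne_zero hrec
    obtain ⟨y, hy⟩ := (legendreSym.eq_one_iff p h0).mp hrec.symm
    have hsq : ∃ s : ℤ, Odd s ∧ (p : ℤ) ∣ s ^ 2 - (4 * n ^ 2 + 1) := by
      have key : ∀ s : ℤ, (s : ZMod p) = y → (p : ℤ) ∣ s ^ 2 - (4 * n ^ 2 + 1) := by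
        intro s hs
        rw [← ZMod.intCast_zmod_eq_zero_iff_dvd _ p]
        push_cast at hy ⊢
        rw [hs, hy]
        ring
      rcases Int.even_or_odd (y.val : ℤ) with he | ho
      · refine ⟨y.val + p, he.add_odd (by exact_mod_cast hodd), key _ ?_⟩
        simp
      · exact ⟨y.val, ho, key _ (by simp)⟩
    obtain ⟨s, ⟨t, rfl⟩, hs⟩ := hsq
    have hpp := Nat.prime_iff_prime_int.mp hp
    refine ⟨t + 1, ?_, fun hdvd ↦ h0 ?_⟩
    · have h4 : (p : ℤ) ∣ 4 * ((t + 1) ^ 2 - (t + 1) - n ^ 2) := by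
        convert! hs using 1
        ring
      refine (hpp.dvd_or_dvd h4).resolve_left fun h ↦ ?_
      have : p ∣ 4 := by exact_mod_cast h
      have := (Nat.prime_dvd_prime_iff_eq hp Nat.prime_two).mp
        (hp.dvd_of_dvd_pow (show p ∣ 2 ^ 2 by simpa using this))
      subst this
      exact absurd hodd (by decide)
    · rw [ZMod.intCast_zmod_eq_zero_iff_dvd]
      have h1 : (p : ℤ) ∣ (2 * t + 1) ^ 2 := by
        refine dvd_pow ?_ two_ne_zero
        convert! hdvd using 1
        ring
      have := dvd_sub h1 hs
      push_cast
      convert! this using 1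
      ring

theorem sum_jacobiSym_pow_le_card (hn : n ≠ 0) (hK : finrank ℚ K = 2)
    (hω : ω ^ 2 = ω + (n : 𝓞 K) ^ 2) (hd : Squarefree (4 * n ^ 2 + 1)) {p : ℕ} (hp : p.Prime)
    (k : ℕ) : ∑ i ∈ Finset.range (k + 1), jacobiSym p (4 * n ^ 2 + 1) ^ i ≤
      Nat.card {I : Ideal (𝓞 K) // Ideal.absNorm I = p ^ k} := by
  rcases jacobiSym.trichotomy p (4 * n ^ 2 + 1) with h | h | h
  · rw [h, Finset.sum_eq_single_of_mem 0 (by simp) fun i _ hi ↦ zero_pow hi, pow_zero]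
    rw [jacobiSym.eq_zero_iff, Int.gcd_natCast_natCast] at h
    have := one_le_card_of_dvd hK hω hd hp
      ((hp.coprime_iff_not_dvd.not.mp h.2).imp_symm fun h ↦ h) k
    exact_mod_cast this
  · obtain ⟨r, hr, hr'⟩ := exists_dvd_of_jacobiSym_eq_one hp h
    have := succ_le_card_of_dvd hn hK hω hp hr hr' k
    rw [h]
    simp only [one_pow, Finset.sum_const, Finset.card_range, nsmul_eq_mul, mul_one]
    exact_mod_cast this
  · rw [h, neg_one_geom_sum]
    split_ifs with hk
    · positivity
    · rw [Nat.even_add_one, not_not] at hk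
      exact_mod_cast one_le_card_of_even hK p hk

theorem zetaMul_jacobiChar_le_card (hn : n ≠ 0) (hK : finrank ℚ K = 2)
    (hω : ω ^ 2 = ω + (n : 𝓞 K) ^ 2) (hd : Squarefree (4 * n ^ 2 + 1)) (m : ℕ) :
    (jacobiChar (4 * n ^ 2 + 1)).zetaMul m ≤
      (Nat.card {I : Ideal (𝓞 K) // Ideal.absNorm I = m} : ℂ) := by
  induction m using Nat.recOnPosPrimePosCoprime with
  | prime_pow p k hp hk =>
    rw [DirichletCharacter.zetaMul, ArithmeticFunction.mul_apply_prime_pow _ _ hp,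
      ← Finset.sum_range_reflect]
    have := sum_jacobiSym_pow_le_card hn hK hω hd hp k
    have h' : ((∑ i ∈ Finset.range (k + 1), jacobiSym p (4 * n ^ 2 + 1) ^ i : ℤ) : ℂ) ≤
        ((Nat.card {I : Ideal (𝓞 K) // Ideal.absNorm I = p ^ k} : ℤ) : ℂ) := by
      exact_mod_cast this
    rw [Int.cast_natCast] at h'
    refine le_of_eq_of_le ?_ h'
    push_cast
    refine Finset.sum_congr rfl fun i hi ↦ ?_
    have hi' : k - (k - i) = i := by
      have := Finset.mem_range.mp hi
      lia
    rw [hi', ArithmeticFunction.natCoe_apply, ArithmeticFunction.zeta_apply_ne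
      (pow_ne_zero _ hp.ne_zero), Nat.cast_one, one_mul]
    exact (DirichletCharacter.arith_prime_pow _ hp i).trans (by rw [jacobiChar_natCast])
  | zero => simp
  | one =>
    rw [(DirichletCharacter.isMultiplicative_zetaMul _).map_one]
    have : 1 ≤ Nat.card {I : Ideal (𝓞 K) // Ideal.absNorm I = 1} := by
      simp
    exact_mod_cast this
  | coprime a b ha hb hab iha ihb =>
    rw [(DirichletCharacter.isMultiplicative_zetaMul _).map_mul_of_coprime hab]
    refine (mul_le_mul iha ihb (DirichletCharacter.zetaMul_nonneg jacobiChar_sq b)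
      (Nat.cast_nonneg _)).trans ?_
    exact_mod_cast card_absNorm_mul_card_absNorm_le hab

theorem term_le_term {f g : ℕ → ℂ} (h : ∀ n, f n ≤ g n) (s : ℝ) (n : ℕ) :
    LSeries.term f s n ≤ LSeries.term g s n := by
  rcases eq_or_ne n 0 with rfl | hn
  · simp
  · rw [LSeries.term_of_ne_zero hn, LSeries.term_of_ne_zero hn, div_eq_mul_inv, div_eq_mul_inv]
    refine mul_le_mul_of_nonneg_right (h n) ?_
    rw [show ((n : ℂ) ^ (s : ℂ))⁻¹ = ((((n : ℝ) ^ s)⁻¹ : ℝ) : ℂ) by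
      rw [Complex.ofReal_inv, Complex.ofReal_cpow n.cast_nonneg, Complex.ofReal_natCast]]
    exact Complex.zero_le_real.mpr (by positivity)

theorem norm_LFunction_jacobiChar_le (hn : n ≠ 0) (hK : finrank ℚ K = 2)
    (hω : ω ^ 2 = ω + (n : 𝓞 K) ^ 2) (hd : Squarefree (4 * n ^ 2 + 1)) :
    ‖DirichletCharacter.LFunction (jacobiChar (4 * n ^ 2 + 1)) 1‖ ≤ dedekindZeta_residue K := by
  set χ := jacobiChar (4 * n ^ 2 + 1) with hχ
  have hχ1 : χ ≠ 1 := jacobiChar_ne_one_of_squarefree ⟨2 * n ^ 2, by ring⟩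
    (by simpa using hn) hd
  obtain ⟨c, -, hc⟩ := DirichletCharacter.exists_estermann_zetaMul
  have hpos : 0 ≤ DirichletCharacter.LFunction χ 1 := (hc hχ1 jacobiChar_sq).1
  have hres := tendsto_sub_one_mul_dedekindZeta_nhdsGT K
  have hlim : Tendsto (fun s : ℝ ↦ ((s : ℂ) - 1) * LSeries χ.zetaMul s) (𝓝[>] 1)
      (𝓝 (DirichletCharacter.LFunction χ 1)) := by
    have hcont : ContinuousAt (fun s : ℝ ↦ DirichletCharacter.LFunctionTrivChar₁ 1 (s : ℂ) *
        DirichletCharacter.LFunction χ (s : ℂ)) 1 := by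
      refine ContinuousAt.comp (f := fun s : ℝ ↦ (s : ℂ)) (g := fun s : ℂ ↦
        DirichletCharacter.LFunctionTrivChar₁ 1 s * DirichletCharacter.LFunction χ s) ?_
        Complex.continuous_ofReal.continuousAt
      exact (((DirichletCharacter.differentiable_LFunctionTrivChar₁ 1).mul
        (DirichletCharacter.differentiable_LFunction hχ1)).continuous).continuousAt
    have := hcont.tendsto.mono_left (nhdsWithin_le_nhds (s := Set.Ioi 1))
    rw [Complex.ofReal_one, DirichletCharacter.LFunctionTrivChar₁_one_one, one_mul] at this
    refine this.congr' ?_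
    filter_upwards [self_mem_nhdsWithin] with s hs
    have hs' : 1 < (s : ℂ).re := by simpa using hs
    rw [DirichletCharacter.LFunctionTrivChar₁_one_apply
      (DirichletCharacter.ne_one_of_one_lt_re hs'), DirichletCharacter.LSeries_zetaMul χ hs',
      mul_assoc]
  have hle : DirichletCharacter.LFunction χ 1 ≤ (dedekindZeta_residue K : ℂ) := by
    refine le_of_tendsto_of_tendsto hlim hres ?_
    have hne : ((dedekindZeta_residue K : ℝ) : ℂ) ≠ 0 :=
      Complex.ofReal_ne_zero.mpr (dedekindZeta_residue_ne_zero K)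
    filter_upwards [self_mem_nhdsWithin, hres.eventually_ne hne] with s hs hs0
    have hs' : 1 < (s : ℂ).re := by simpa using hs
    have hsum : LSeriesSummable
        (fun n ↦ (Nat.card {I : Ideal (𝓞 K) // Ideal.absNorm I = n} : ℂ)) s := by
      by_contra h
      refine hs0 ?_
      rw [dedekindZeta, LSeries, tsum_eq_zero_of_not_summable h, mul_zero]
    have hs1 : (0 : ℂ) ≤ (s : ℂ) - 1 := by
      rw [← Complex.ofReal_one, ← Complex.ofReal_sub]
      exact Complex.zero_le_real.mpr (sub_nonneg.mpr (le_of_lt hs))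
    refine mul_le_mul_of_nonneg_left ?_ hs1
    exact Summable.tsum_le_tsum
      (term_le_term (zetaMul_jacobiChar_le_card hn hK hω hd) s)
      (χ.LSeriesSummable_zetaMul hs') hsum
  have hnorm := Complex.norm_of_nonneg' hpos
  rw [← hnorm] at hle
  exact Complex.real_le_real.mp hle

end Comparison

end

section

open NumberField Module Filter Topology
open scoped ComplexOrder

section Siegel

open DirichletCharacter

variable {N : ℕ} [NeZero N] {χ : DirichletCharacter ℂ N}

theorem re_nonneg_of_forall_ne_zero (hχ : χ ≠ 1) (hχ2 : χ ^ 2 = 1) {x : ℝ} (hx : 7 / 8 ≤ x)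
    (hx1 : x < 1)
    (hne : ∀ y : ℝ, x ≤ y → y < 1 → LFunctionTrivChar₁ 1 y * LFunction χ y ≠ 0) :
    0 ≤ (LFunctionTrivChar₁ 1 x * LFunction χ x).re := by
  obtain ⟨c, -, hc⟩ := exists_estermann_zetaMul
  obtain ⟨hpos, him⟩ := hc hχ hχ2
  by_contra! hneg
  have hcont : Continuous fun y : ℝ ↦ (LFunctionTrivChar₁ 1 (y : ℂ) * LFunction χ (y : ℂ)).re :=
    Complex.continuous_re.comp <| (((differentiable_LFunctionTrivChar₁ 1).mul
      (differentiable_LFunction hχ)).continuous).comp Complex.continuous_ofReal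
  have h1 : 0 < (LFunctionTrivChar₁ 1 ((1 : ℝ) : ℂ) * LFunction χ ((1 : ℝ) : ℂ)).re := by
    rw [Complex.ofReal_one, LFunctionTrivChar₁_one_one, one_mul]
    exact (Complex.pos_iff.mp (hpos.lt_of_ne (LFunction_apply_one_ne_zero hχ).symm)).1
  obtain ⟨y, ⟨hxy, hy1⟩, hy⟩ := intermediate_value_Icc hx1.le hcont.continuousOn ⟨hneg.le, h1.le⟩
  have hy1' : y < 1 := by
    refine hy1.lt_of_ne ?_
    rintro rfl
    exact h1.ne' hy
  exact hne y hxy hy1' (Complex.ext hy (him y (hx.trans hxy) hy1').1)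

theorem rpow_neg_three_eighths_pow {d : ℝ} (hd : 0 ≤ d) :
    (d ^ (-(3 / 8) : ℝ)) ^ 16 = (d ^ 6)⁻¹ := by
  rw [← Real.rpow_mul_natCast hd, ← Real.rpow_natCast d 6, ← Real.rpow_neg hd]
  norm_num

theorem rpow_one_eighth_pow {d : ℝ} (hd : 0 ≤ d) : (d ^ (1 / 8 : ℝ)) ^ 16 = d ^ 2 := by
  rw [← Real.rpow_mul_natCast hd, ← Real.rpow_natCast d 2]
  norm_num

/-- A weak form of **Siegel's theorem** for `L(1, χ)` with `χ` a Jacobi symbol. -/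
theorem exists_lt_norm_LFunction_jacobiChar {B : ℝ} (hB : 0 ≤ B) :
    ∃ M : ℕ, ∀ d : ℕ, M < d → ∀ [NeZero d], Odd d → Squarefree d →
      B * (d : ℝ) ^ (-(3 / 8) : ℝ) < ‖LFunction (jacobiChar d) 1‖ := by
  by_cases hex : ∃ d₁ : ℕ, ∃ _ : NeZero d₁, Odd d₁ ∧ Squarefree d₁ ∧ d₁ ≠ 1 ∧
      ∃ β : ℝ, 63 / 64 ≤ β ∧ β < 1 ∧ LFunctionTrivChar₁ 1 β * LFunction (jacobiChar d₁) β = 0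
  · obtain ⟨d₁, _, hodd₁, hsq₁, hd₁, β, hβ, hβ1, hzero⟩ := hex
    obtain ⟨c, hc0, hc⟩ := exists_estermann_zetaMul_mul
    obtain ⟨c', hc1', hc'⟩ := exists_norm_LFunction_le
    set ε : ℝ := ((1 - β) / 2) ^ 16 with hε
    have hε0 : 0 < ε := pow_pos (by linarith) _
    set A : ℝ := c * d₁ ^ 4 * (‖LFunction (jacobiChar d₁) 1‖ * B * c') ^ 16 with hA
    obtain ⟨M, hM⟩ := exists_nat_gt (A / ε)
    refine ⟨max M d₁, fun d hd _ hodd hsq ↦ ?_⟩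
    by_contra! hbad
    have hdM : M < d := (le_max_left _ _).trans_lt hd
    have hdd₁ : d₁ < d := (le_max_right _ _).trans_lt hd
    have hd1 : (1 : ℝ) ≤ d := mod_cast NeZero.pos d
    have h3 := jacobiChar_mul_ne_one_of_squarefree hodd₁ hodd hsq₁ hsq hdd₁.ne
    have key := hc (jacobiChar_ne_one_of_squarefree hodd₁ hd₁ hsq₁)
      (jacobiChar_ne_one_of_squarefree hodd (by have := NeZero.pos d₁; lia) hsq) h3 jacobiChar_sq
      jacobiChar_sq (fun p _ ↦ jacobiChar_mul_natCast p) β (by linarith) hβ1 hzero 16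
      ((pow_le_pow_left₀ (by linarith) (show 2 - β ≤ 65 / 64 by linarith) 16).trans
        (by norm_num))
    have hL3 := (hc' h3).2
    have hA0 : ε ≤ A * ((d : ℝ) ^ 2)⁻¹ := by
      calc ε ≤ c * (d₁ * d * (d₁ * d : ℕ)) * (‖LFunction (jacobiChar d₁) 1‖ *
            (B * (d : ℝ) ^ (-(3 / 8) : ℝ)) * (c' * ((d₁ * d : ℕ) : ℝ) ^ (1 / 8 : ℝ))) ^ 16 := by
            refine key.trans ?_
            gcongr
        _ = c * (d₁ * d * (d₁ * d)) * ((‖LFunction (jacobiChar d₁) 1‖ * B * c') ^ 16 *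
            ((d : ℝ) ^ (-(3 / 8) : ℝ)) ^ 16 * (((d₁ * d : ℕ) : ℝ) ^ (1 / 8 : ℝ)) ^ 16) := by
            push_cast
            ring
        _ = A * ((d : ℝ) ^ 2)⁻¹ := by
            rw [rpow_neg_three_eighths_pow (by positivity), rpow_one_eighth_pow (by positivity), hA]
            push_cast
            field_simp
    rw [← div_eq_mul_inv, le_div_iff₀ (by positivity)] at hA0
    rw [div_lt_iff₀ hε0] at hM
    have : (M : ℝ) < d := by exact_mod_cast hdM
    have : (d : ℝ) ≤ d ^ 2 := by nlinarith
    nlinarith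
  · push Not at hex
    obtain ⟨c, hc0, hc⟩ := exists_estermann_zetaMul
    obtain ⟨M, hM⟩ := exists_nat_gt (c * B ^ 16 * 128 ^ 16)
    refine ⟨max M 1, fun d hd _ hodd hsq ↦ ?_⟩
    by_contra! hbad
    have hdM : M < d := (le_max_left _ _).trans_lt hd
    have hd1 : 1 < d := (le_max_right _ _).trans_lt hd
    have hd1' : (1 : ℝ) ≤ d := by exact_mod_cast hd1.le
    have hχ := jacobiChar_ne_one_of_squarefree hodd hd1.ne' hsq
    have hnn := re_nonneg_of_forall_ne_zero hχ jacobiChar_sq (x := 63 / 64) (by norm_num)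
      (by norm_num) (hex d ‹_› hodd hsq hd1.ne')
    have key := ((hc hχ jacobiChar_sq).2 (63 / 64) (by norm_num) (by norm_num)).2 16 (by norm_num)
      hnn
    have h5 : (1 / 128 : ℝ) ^ 16 ≤ c * B ^ 16 * ((d : ℝ) ^ 5)⁻¹ := by
      calc (1 / 128 : ℝ) ^ 16 ≤ c * d * (B * (d : ℝ) ^ (-(3 / 8) : ℝ)) ^ 16 := by
            refine le_trans (le_of_eq (by norm_num)) (key.trans ?_)
            gcongr
        _ = c * B ^ 16 * ((d : ℝ) ^ 5)⁻¹ := by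
            rw [mul_pow, rpow_neg_three_eighths_pow (by positivity)]
            field_simp
    rw [← div_eq_mul_inv, le_div_iff₀ (by positivity)] at h5
    have h6 : (d : ℝ) ^ 5 ≤ c * B ^ 16 * 128 ^ 16 := by
      calc (d : ℝ) ^ 5 = (1 / 128) ^ 16 * d ^ 5 * 128 ^ 16 := by ring
        _ ≤ _ := by gcongr
    have h7 : (d : ℝ) ≤ d ^ 5 := le_self_pow₀ hd1' (by norm_num)
    have : (M : ℝ) < d := by exact_mod_cast hdM
    linarith

end Siegel

section ClassNumber

theorem log_two_mul_add_sqrt_le (n : ℕ) :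
    Real.log (2 * n + Real.sqrt (4 * n ^ 2 + 1)) / Real.sqrt (4 * n ^ 2 + 1) ≤
      8 * (4 * (n : ℝ) ^ 2 + 1) ^ (-(3 / 8) : ℝ) := by
  set d : ℝ := 4 * (n : ℝ) ^ 2 + 1 with hd
  have hd0 : 0 < d := by positivity
  have hS : 0 < Real.sqrt d := Real.sqrt_pos.mpr hd0
  have h2n : 2 * (n : ℝ) ≤ Real.sqrt d := Real.le_sqrt_of_sq_le (by rw [hd]; nlinarith)
  have hlog : Real.log (2 * n + Real.sqrt d) ≤ 8 * d ^ (1 / 8 : ℝ) := by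
    calc Real.log (2 * n + Real.sqrt d) ≤ (2 * n + Real.sqrt d) ^ (1 / 4 : ℝ) / (1 / 4) :=
          Real.log_le_rpow_div (by positivity) (by norm_num)
      _ ≤ (2 * Real.sqrt d) ^ (1 / 4 : ℝ) / (1 / 4) := by
          gcongr
          linarith
      _ = 2 ^ (1 / 4 : ℝ) * d ^ (1 / 8 : ℝ) / (1 / 4) := by
          rw [Real.mul_rpow two_pos.le hS.le, Real.sqrt_eq_rpow, ← Real.rpow_mul hd0.le]
          norm_num
      _ ≤ 2 * d ^ (1 / 8 : ℝ) / (1 / 4) := by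
          gcongr
          exact Real.rpow_le_self_of_one_le one_le_two (by norm_num)
      _ = 8 * d ^ (1 / 8 : ℝ) := by ring
  rw [div_le_iff₀ hS]
  refine hlog.trans (le_of_eq ?_)
  rw [Real.sqrt_eq_rpow, mul_assoc, ← Real.rpow_add hd0]
  norm_num

theorem exists_quadratic_generator {n : ℕ} (hn : n ≠ 0) {x : ℝ}
    (hx : x = Real.sqrt (4 * (n : ℝ) ^ 2 + 1)) {K : Type} [Field K] [NumberField K]
    (e : K ≃ₐ[ℚ] IntermediateField.adjoin ℚ {x}) :
    finrank ℚ K = 2 ∧ ∃ ω : 𝓞 K, ω ^ 2 = ω + (n : 𝓞 K) ^ 2 := by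
  have hx2 : x ^ 2 = 4 * n ^ 2 + 1 := by rw [hx, Real.sq_sqrt (by positivity)]
  constructor
  · open Polynomial in
    have haeval : aeval x (X ^ 2 - C (4 * (n : ℚ) ^ 2 + 1)) = 0 := by
      simp [hx2]
    have hmonic : (X ^ 2 - C (4 * (n : ℚ) ^ 2 + 1)).Monic :=
      monic_X_pow_sub_C _ two_ne_zero
    have hx_int : IsIntegral ℚ x := ⟨_, hmonic, haeval⟩
    rw [e.toLinearEquiv.finrank_eq, IntermediateField.adjoin.finrank hx_int]
    refine le_antisymm ?_ ((minpoly.two_le_natDegree_iff hx_int).mpr ?_)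
    · refine (natDegree_le_of_dvd (minpoly.dvd ℚ x haeval) hmonic.ne_zero).trans ?_
      rw [natDegree_X_pow_sub_C]
    · rintro ⟨q, rfl⟩
      refine not_isSquare_four_mul_sq_add_one hn (Rat.isSquare_natCast_iff.mp ⟨q, ?_⟩)
      rw [eq_ratCast] at hx2
      push_cast
      rw [← pow_two]
      exact_mod_cast hx2.symm
  · let θ : K := e.symm (IntermediateField.AdjoinSimple.gen ℚ x)
    have hgen : (IntermediateField.AdjoinSimple.gen ℚ x) ^ 2 = 4 * n ^ 2 + 1 := by
      apply (algebraMap (IntermediateField.adjoin ℚ {x}) ℝ).injective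
      simp only [map_pow, map_add, map_mul, map_natCast, map_ofNat, map_one,
        IntermediateField.AdjoinSimple.algebraMap_gen]
      exact hx2
    have hθ : θ ^ 2 = 4 * n ^ 2 + 1 := by
      rw [← map_pow, hgen]
      simp only [map_add, map_mul, map_pow, map_natCast, map_ofNat, map_one]
    have hω : ((1 + θ) / 2) ^ 2 = (1 + θ) / 2 + (n : K) ^ 2 := by
      field_simp
      linear_combination hθ
    have hx_int : IsIntegral ℤ ((1 + θ) / 2) := by
      open Polynomial in
      refine ⟨X ^ 2 - X - C ((n : ℤ) ^ 2), by monicity!, ?_⟩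
      rw [eval₂_sub, eval₂_sub, eval₂_pow, eval₂_X, eval₂_C, hω]
      simp only [algebraMap_int_eq, map_pow, map_natCast]
      ring
    obtain ⟨w, hw⟩ : ∃ w : 𝓞 K, algebraMap (𝓞 K) K w = (1 + θ) / 2 := ⟨⟨_, hx_int⟩, rfl⟩
    refine ⟨w, FaithfulSMul.algebraMap_injective (𝓞 K) K ?_⟩
    rw [map_pow, map_add, map_pow, map_natCast, hw, hω]

end ClassNumber

end

/-- For every constant `C` there is `M : ℕ` such that for every `n > M` for which
`4n²+1` is prime or a product of two distinct primes, the class number of the real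
quadratic field `ℚ(√(4n²+1))` (the subfield of `ℝ` generated over `ℚ` by `√(4n²+1)`)
is greater than `C`: the class number tends to infinity along such `n`. -/
theorem stmt_5 (C : ℕ) :
    ∃ M : ℕ, ∀ n : ℕ, M < n →
      (Nat.Prime (4 * n ^ 2 + 1) ∨
        ∃ p q : ℕ, p.Prime ∧ q.Prime ∧ p ≠ q ∧ 4 * n ^ 2 + 1 = p * q) →
      ∀ x : ℝ, x = Real.sqrt (4 * (n : ℝ) ^ 2 + 1) →
      ∀ (K : Type) [Field K] [NumberField K],
        Nonempty (K ≃ₐ[ℚ] (IntermediateField.adjoin ℚ {x})) →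
        C < NumberField.classNumber K := by
  obtain ⟨M, hM⟩ := exists_lt_norm_LFunction_jacobiChar (B := 64 * C) (by positivity)
  refine ⟨M, fun n hMn hpq x hx K _ _ ⟨e⟩ ↦ ?_⟩
  have hn : n ≠ 0 := by omega
  have hd : Squarefree (4 * n ^ 2 + 1) := by
    obtain h | ⟨p, q, hp, hq, hne, h⟩ := hpq
    · exact h.prime.squarefree
    · rw [h, Nat.squarefree_mul ((Nat.coprime_primes hp hq).mpr hne)]
      exact ⟨hp.prime.squarefree, hq.prime.squarefree⟩
  obtain ⟨hK, ω, hω⟩ := exists_quadratic_generator hn hx e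
  let σ : K →+* ℝ :=
    (algebraMap (IntermediateField.adjoin ℚ {x}) ℝ).comp (e : K →+* IntermediateField.adjoin ℚ {x})
  by_contra! h
  refine (hM (4 * n ^ 2 + 1) (by nlinarith) ⟨2 * n ^ 2, by ring⟩ hd).not_ge ?_
  calc _ ≤ NumberField.dedekindZeta_residue K := norm_LFunction_jacobiChar_le hn hK hω hd
    _ ≤ 8 * NumberField.classNumber K * (Real.log (2 * n + √(4 * n ^ 2 + 1)) / √(4 * n ^ 2 + 1)) := by
        rw [← mul_div_assoc]
        exact dedekindZeta_residue_le hn hK σ hω hd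
    _ ≤ 8 * C * (8 * (4 * (n : ℝ) ^ 2 + 1) ^ (-(3 / 8) : ℝ)) := by
        have hlog : 0 ≤ Real.log (2 * n + √(4 * (n : ℝ) ^ 2 + 1)) := by
          refine Real.log_nonneg ?_
          have : (1 : ℝ) ≤ √(4 * (n : ℝ) ^ 2 + 1) := Real.one_le_sqrt.mpr (by nlinarith)
          linarith [n.cast_nonneg (α := ℝ)]
        gcongr
        exact log_two_mul_add_sqrt_le n
    _ = _ := by
        push_cast
        ring
end
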